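/- Existence of degenerate magic angles for potentials with rational Fourier coefficients: Let S ⊂ Λ* be finite and let U(z) := Σ_{p∈S} a_p·exp(i⟨p+K,z⟩) where each coefficient a_p lies in π·ℚ(ω/√3) (π times the smallest subfield of ℂ containing ω/√3), and assume U(ωz) = ω·U(z) for all z. Consider the chiral model D(α) built from U. If there exists at least one magic parameter α ∈ ℂ, then there exists a magic parameter α ∈ ℂ which is non-simple, i.e. dim_ℂ Ker(α,k) ≥ 2 for every k ∈ ℂ. -/

import Mathlib

noncomputable section

open Complex MeasureTheory

namespace TBG

/-- `ω = exp(2πi/3)`. -/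
def ω : ℂ := Complex.exp (2 * Real.pi * Complex.I / 3)

/-- The moiré lattice `Λ = ℤω + ℤ ⊂ ℂ`. -/
def Λ : Set ℂ := {z : ℂ | ∃ m n : ℤ, z = m * ω + n}

/-- The dual lattice `Λ* = (4πi/√3)·Λ`. -/
def Λdual : Set ℂ := {p : ℂ | ∃ m n : ℤ, p = 4 * Real.pi * Complex.I / Real.sqrt 3 * (m * ω + n)}

/-- The high symmetry point `K = 4π/3`. -/
def K : ℂ := 4 * Real.pi / 3

/-- `⟨z,w⟩ = Re (z · conj w)`. -/
def pair (z w : ℂ) : ℝ := (z * (starRingEnd ℂ) w).re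

/-- `2 D_z̄ f = (1/i)(∂_x f + i ∂_y f)`. -/
def Dbar (f : ℂ → ℂ) (z : ℂ) : ℂ :=
  1 / Complex.I * (fderiv ℝ f z 1 + Complex.I * fderiv ℝ f z Complex.I)

/-- A tunnelling potential: smooth, with the translational and rotational symmetries. -/
def IsTunnelling (U : ℂ → ℂ) : Prop :=
  ContDiff ℝ (⊤ : ℕ∞) U ∧
    (∀ γ ∈ Λ, ∀ z : ℂ, U (z + γ) = Complex.exp (Complex.I * (pair γ K : ℂ)) * U z) ∧
    ∀ z : ℂ, U (ω * z) = ω * U z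

/-- Membership in `ker_{L²₀}(D(α)+k)` for the chiral model with tunnelling
potentials `U₊ = Up`, `U₋ = Um`: smooth solutions of `(D(α)+k)u = 0` with the
Floquet boundary conditions. -/
def InKer (Up Um : ℂ → ℂ) (α k : ℂ) (u : ℂ → ℂ × ℂ) : Prop :=
  ContDiff ℝ (⊤ : ℕ∞) u ∧
    (∀ z : ℂ, Dbar (fun w => (u w).1) z + k * (u z).1 + α * Up z * (u z).2 = 0) ∧
    (∀ z : ℂ, Dbar (fun w => (u w).2) z + k * (u z).2 + α * Um z * (u z).1 = 0) ∧
    (∀ γ ∈ Λ, ∀ z : ℂ, (u (z + γ)).1 = Complex.exp (-Complex.I * (pair γ K : ℂ)) * (u z).1) ∧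
    (∀ γ ∈ Λ, ∀ z : ℂ, (u (z + γ)).2 = Complex.exp (Complex.I * (pair γ K : ℂ)) * (u z).2)

/-- `Ker(α,k)` as a set of functions. -/
def kerSet (Up Um : ℂ → ℂ) (α k : ℂ) : Set (ℂ → ℂ × ℂ) := {u | InKer Up Um α k u}

/-- `dim_ℂ Ker(α,k)` (the set `Ker(α,k)` is a linear subspace, so the finrank of its span
is its dimension). -/
def kerDim (Up Um : ℂ → ℂ) (α k : ℂ) : ℕ :=
  Module.finrank ℂ ↥(Submodule.span ℂ (kerSet Up Um α k))

/-- `Ker_p(α) = {u ∈ Ker(α,0) : u(ωz) = ω^(−p)·u(z)}`. -/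
def kerPSet (Up Um : ℂ → ℂ) (α : ℂ) (p : ℕ) : Set (ℂ → ℂ × ℂ) :=
  {u | u ∈ kerSet Up Um α 0 ∧ ∀ z : ℂ, u (ω * z) = (ω ^ (-(p : ℤ))) • u z}

/-- `dim_ℂ Ker_p(α)`. -/
def kerPDim (Up Um : ℂ → ℂ) (α : ℂ) (p : ℕ) : ℕ :=
  Module.finrank ℂ ↥(Submodule.span ℂ (kerPSet Up Um α p))

/-- `α` is magic: the flat band condition `Ker(α,k) ≠ {0}` for every `k`. -/
def IsMagic (Up Um : ℂ → ℂ) (α : ℂ) : Prop :=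
  ∀ k : ℂ, ∃ u ∈ kerSet Up Um α k, u ≠ 0


/-- Membership in `π·ℚ(ω/√3)`: `π` times the smallest subfield of `ℂ` containing `ω/√3`. -/
def InPiQomega (c : ℂ) : Prop :=
  ∃ q ∈ Subfield.closure {ω / (Real.sqrt 3 : ℂ)}, c = (Real.pi : ℂ) * q

instance isAlgebraic_algebraicClosure_rat : Algebra.IsAlgebraic ℚ (AlgebraicClosure ℚ) := by
  convert AlgebraicClosure.isAlgebraic ℚ
  · rfl
  · exact Subsingleton.elim _ _

instance isGalois_algebraicClosure_rat : IsGalois ℚ (AlgebraicClosure ℚ) := by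
  have : Normal ℚ (AlgebraicClosure ℚ) :=
    normal_iff.mpr fun x => ⟨Algebra.IsIntegral.isIntegral x, IsAlgClosed.splits _⟩
  exact {}

open Polynomial in
lemma isIntegral_leadingCoeff_pow_mul_aeval {E : Type*} [Field E] (r : E) (l : ℤ)
    (h : IsIntegral ℤ ((l : E) * r)) (g : ℤ[X]) (D : ℕ) (hD : g.natDegree ≤ D) :
    IsIntegral ℤ ((l : E) ^ D * aeval r g) := by
  rw [aeval_eq_sum_range' (Nat.lt_succ_of_le hD), Finset.mul_sum]
  refine IsIntegral.sum _ fun i hi => ?_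
  have hi' : i ≤ D := Nat.lt_succ_iff.mp (Finset.mem_range.mp hi)
  have : (l : E) ^ D * (g.coeff i • r ^ i)
      = ((g.coeff i * l ^ (D - i) : ℤ) : E) * ((l : E) * r) ^ i := by
    rw [zsmul_eq_mul, mul_pow]
    push_cast
    rw [← Nat.sub_add_cancel hi', pow_add]
    simp only [Nat.add_sub_cancel]
    ring
  rw [this]
  exact (isIntegral_algebraMap (R := ℤ) (A := E)
    (x := (g.coeff i * l ^ (D - i)))).mul (h.pow i)

open Polynomial in
/-- A Galois-stable finite multiset of algebraic numbers consists of roots of an integer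
polynomial. -/
lemma exists_int_poly_of_galois_stable (S : Multiset (AlgebraicClosure ℚ))
    (hS : ∀ σ : AlgebraicClosure ℚ ≃ₐ[ℚ] AlgebraicClosure ℚ, S.map σ = S) :
    ∃ f : ℤ[X], f.eval 0 ≠ 0 ∧ ∀ r ∈ S, r ≠ 0 → aeval r f = 0 := by
  set F : (AlgebraicClosure ℚ)[X] := (S.map (fun r => X - C r)).prod with hF
  have hF0 : F ≠ 0 := (monic_multiset_prod_of_monic _ _ fun r _ => monic_X_sub_C r).ne_zero
  have hfix : ∀ σ : AlgebraicClosure ℚ ≃ₐ[ℚ] AlgebraicClosure ℚ,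
      F.map (σ : AlgebraicClosure ℚ →+* AlgebraicClosure ℚ) = F := by
    intro σ
    rw [hF, Polynomial.map_multiset_prod, Multiset.map_map]
    conv_rhs => rw [← hS σ]
    rw [Multiset.map_map]
    congr 1
    refine Multiset.map_congr rfl fun r _ => ?_
    simp
  obtain ⟨F0, hF0'⟩ : ∃ F0 : ℚ[X], F0.map (algebraMap ℚ (AlgebraicClosure ℚ)) = F := by
    have : F ∈ Polynomial.lifts (algebraMap ℚ (AlgebraicClosure ℚ)) := by
      rw [Polynomial.lifts_iff_coeff_lifts]
      intro n
      rw [InfiniteGalois.mem_range_algebraMap_iff_fixed]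
      intro σ
      conv_rhs => rw [← hfix σ]
      simp
    rwa [Polynomial.mem_lifts] at this
  have hF00 : F0 ≠ 0 := by
    rintro rfl
    simp at hF0'
    exact hF0 hF0'.symm
  obtain ⟨b, hb, hf1⟩ := IsLocalization.integerNormalization_spec (nonZeroDivisors ℤ) F0
  set f1 := IsLocalization.integerNormalization (nonZeroDivisors ℤ) F0 with hf1d
  have hf1ne : f1 ≠ 0 := by
    rw [hf1d, Ne, IsLocalization.integerNormalization_eq_zero_iff le_rfl]
    exact hF00
  obtain ⟨f, hf, hdvd⟩ := exists_eq_pow_rootMultiplicity_mul_and_not_dvd f1 hf1ne 0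
  refine ⟨f, ?_, ?_⟩
  · intro h0
    exact hdvd (dvd_iff_isRoot.mpr h0)
  · intro r hr hr0
    have h1 : aeval r f1 = 0 := by
      have h2 : aeval r (f1.map (algebraMap ℤ ℚ)) = 0 := by
        rw [hf1, map_zsmul]
        have : aeval r F0 = 0 := by
          rw [aeval_def, ← eval_map, hF0', hF]
          rw [eval_multiset_prod, Multiset.map_map]
          apply Multiset.prod_eq_zero
          rw [Multiset.mem_map]
          exact ⟨r, hr, by simp⟩
        rw [this, smul_zero]
      rwa [aeval_map_algebraMap] at h2
    rw [hf] at h1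
    simp at h1
    rcases h1 with h1 | h1
    · exact absurd h1.1 hr0
    · exact h1

lemma exists_int_of_galois_stable (x : AlgebraicClosure ℚ)
    (hx : ∀ σ : AlgebraicClosure ℚ ≃ₐ[ℚ] AlgebraicClosure ℚ, σ x = x)
    (hi : IsIntegral ℤ x) : ∃ n : ℤ, x = n := by
  obtain ⟨y, rfl⟩ := (InfiniteGalois.mem_range_algebraMap_iff_fixed x).mpr hx
  have : IsIntegral ℤ y :=
    (isIntegral_algebraMap_iff (algebraMap ℚ (AlgebraicClosure ℚ)).injective).mp hi
  obtain ⟨n, rfl⟩ := IsIntegrallyClosed.isIntegral_iff.mp this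
  exact ⟨n, by simp⟩

lemma exists_prime_pow_div_factorial_lt (M : ℕ) (x C : ℝ) :
    ∃ p : ℕ, p.Prime ∧ M < p ∧ C * (|x| ^ p / (p - 1).factorial) < 1 := by
  have h := (FloorSemiring.tendsto_pow_div_factorial_atTop |x|).const_mul (|C| * |x|)
  rw [mul_zero] at h
  have h2 := (h.eventually (gt_mem_nhds one_pos)).and (Filter.eventually_ge_atTop (M + 1))
  obtain ⟨N, hN⟩ := Filter.eventually_atTop.mp h2
  obtain ⟨p, hp, hpp⟩ := Nat.exists_infinite_primes (N + 1)
  obtain ⟨q, rfl⟩ : ∃ q, p = q + 1 := ⟨p - 1, by omega⟩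
  refine ⟨q + 1, hpp, ?_, ?_⟩
  · have := (hN q (by omega)).2
    omega
  · have := (hN q (by omega)).1
    refine lt_of_le_of_lt ?_ this
    simp only [Nat.add_sub_cancel]
    calc C * (|x| ^ (q + 1) / q.factorial) ≤ |C| * (|x| ^ (q + 1) / q.factorial) := by
          gcongr; exact le_abs_self C
      _ = _ := by rw [pow_succ]; ring

open Polynomial in
/-- If the sum of exponentials over a Galois-stable multiset vanishes, then `0` is not in it. -/
lemma sum_exp_ne_zero_of_galois_stable (φ : AlgebraicClosure ℚ →ₐ[ℚ] ℂ)
    (S : Multiset (AlgebraicClosure ℚ))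
    (hS : ∀ σ : AlgebraicClosure ℚ ≃ₐ[ℚ] AlgebraicClosure ℚ, S.map σ = S)
    (h0 : 0 ∈ S) : (S.map fun r => cexp (φ r)).sum ≠ 0 := by
  classical
  intro hsum
  obtain ⟨f, hf0, hfr⟩ := exists_int_poly_of_galois_stable S hS
  obtain ⟨c, hc⟩ := LindemannWeierstrass.exp_polynomial_approx f hf0
  set l := f.leadingCoeff with hl
  have hfne : f ≠ 0 := by rintro rfl; simp at hf0
  have hl0 : l ≠ 0 := leadingCoeff_ne_zero.mpr hfne
  set d := f.natDegree with hd
  set N := S.count 0 with hN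
  have hNpos : 0 < N := Multiset.count_pos.mpr h0
  set S' := S.filter (· ≠ 0) with hS'
  have hsplit : S = Multiset.replicate N 0 + S' := by
    conv_lhs => rw [← Multiset.filter_add_not (fun x => x = 0) S]
    congr 1
    convert Multiset.filter_eq' S 0
  obtain ⟨p, hp, hpM, hpC⟩ := exists_prime_pow_div_factorial_lt
    ((f.eval 0).natAbs + N + l.natAbs) (|(l : ℝ)| ^ d * c) (S'.card)
  obtain ⟨n, hpn, gp, hgp, happ⟩ := hc p (by omega) hp
  have hintr : ∀ r ∈ S, IsIntegral ℤ ((l : AlgebraicClosure ℚ) ^ (p * d) * aeval r gp) := by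
    intro r hr
    refine isIntegral_leadingCoeff_pow_mul_aeval r l ?_ gp (p * d) (by omega)
    by_cases hr0 : r = 0
    · rw [hr0, mul_zero]; exact isIntegral_zero
    · have := isIntegral_leadingCoeff_smul f r (hfr r hr hr0)
      rwa [zsmul_eq_mul] at this
  set G : AlgebraicClosure ℚ := (S.map fun r => (l : AlgebraicClosure ℚ) ^ (p * d) * aeval r gp).sum
    with hG
  obtain ⟨m, hm⟩ : ∃ m : ℤ, G = m := by
    apply exists_int_of_galois_stable
    · intro σ
      rw [hG, map_multiset_sum, Multiset.map_map]
      conv_rhs => rw [← hS σ]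
      rw [Multiset.map_map]
      congr 1
      refine Multiset.map_congr rfl fun r _ => ?_
      have := Polynomial.aeval_algHom_apply
        ((σ : AlgebraicClosure ℚ →ₐ[ℚ] AlgebraicClosure ℚ).restrictScalars ℤ) r gp
      simp only [AlgHom.coe_restrictScalars'] at this
      simp only [Function.comp_apply, map_mul, map_pow, map_intCast]
      exact congrArg _ this.symm
    · rw [hG]
      apply IsIntegral.multiset_sum
      intro y hy
      rw [Multiset.mem_map] at hy
      obtain ⟨r, hr, rfl⟩ := hy
      exact hintr r hr
  have hmC : (m : ℂ) = (l : ℂ) ^ (p * d) * (S.map fun r => aeval (φ r) gp).sum := by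
    have := congrArg φ hm
    rw [hG, map_multiset_sum, Multiset.map_map] at this
    rw [map_intCast] at this
    rw [← this, ← Multiset.sum_map_mul_left]
    congr 1
    refine Multiset.map_congr rfl fun r _ => ?_
    simp only [Function.comp_apply, map_mul, map_pow, map_intCast]
    congr 1
    exact (Polynomial.aeval_algHom_apply (φ.restrictScalars ℤ) r gp).symm
  have hE : (S'.map fun r => cexp (φ r)).sum = -(N : ℂ) := by
    rw [hsplit] at hsum
    simp at hsum
    linear_combination hsum
  have hA : (S.map fun r => aeval (φ r) gp).sum
      = N * (gp.eval 0 : ℤ) + (S'.map fun r => aeval (φ r) gp).sum := by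
    conv_lhs => rw [hsplit]
    simp [Polynomial.aeval_def, Polynomial.eval₂_at_zero, Polynomial.coeff_zero_eq_eval_zero]
  have hbound : ‖(S'.map fun r => (n • cexp (φ r) - p • aeval (φ r) gp)).sum‖
      ≤ S'.card * (c ^ p / (p - 1).factorial) := by
    have h1 : ∀ T : Multiset (AlgebraicClosure ℚ), (∀ r ∈ T, r ∈ S') →
        ‖(T.map fun r => (n • cexp (φ r) - p • aeval (φ r) gp)).sum‖
        ≤ T.card * (c ^ p / (p - 1).factorial) := by
      intro T
      induction T using Multiset.induction_on with
      | empty => simp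
      | cons a T ih =>
        intro hT
        rw [Multiset.map_cons, Multiset.sum_cons, Multiset.card_cons]
        refine (norm_add_le _ _).trans ?_
        have ha := hT a (Multiset.mem_cons_self a T)
        rw [hS', Multiset.mem_filter] at ha
        have hroot : φ a ∈ f.aroots ℂ := by
          rw [mem_aroots]
          refine ⟨hfne, ?_⟩
          have := Polynomial.aeval_algHom_apply (φ.restrictScalars ℤ) a f
          simp only [AlgHom.coe_restrictScalars'] at this
          rw [this, hfr a ha.1 ha.2, map_zero]
        have := happ hroot
        have := ih fun r hr => hT r (Multiset.mem_cons_of_mem hr)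
        push_cast
        linarith
    exact h1 S' fun r hr => hr
  have hsumeq : (S'.map fun r => (n • cexp (φ r) - p • aeval (φ r) gp)).sum
      = -(n * N) - p * (S'.map fun r => aeval (φ r) gp).sum := by
    rw [Multiset.sum_map_sub]
    simp only [zsmul_eq_mul, nsmul_eq_mul]
    rw [Multiset.sum_map_mul_left, Multiset.sum_map_mul_left, hE]
    ring
  set J : ℤ := -(n * N * l ^ (p * d)) - p * (m - l ^ (p * d) * (N * gp.eval 0)) with hJ
  have hJC : (J : ℂ) = (l : ℂ) ^ (p * d) *
      (S'.map fun r => (n • cexp (φ r) - p • aeval (φ r) gp)).sum := by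
    rw [hsumeq, hJ]
    push_cast
    rw [hmC, hA]
    ring
  have hJlt : ‖(J : ℂ)‖ < 1 := by
    rw [hJC, norm_mul]
    refine lt_of_le_of_lt ?_ hpC
    refine (mul_le_mul_of_nonneg_left hbound (norm_nonneg _)).trans ?_
    rw [norm_pow, Complex.norm_intCast, abs_mul, abs_pow, abs_abs, mul_pow, ← pow_mul, mul_comm d p]
    have : c ^ p ≤ |c| ^ p := by rw [← abs_pow]; exact le_abs_self _
    calc |(l : ℝ)| ^ (p * d) * (S'.card * (c ^ p / (p - 1).factorial))
        = S'.card * ((|(l : ℝ)| ^ (p * d) * c ^ p) / (p - 1).factorial) := by ring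
      _ ≤ _ := by gcongr
  have hJ0 : J = 0 := by
    rw [Complex.norm_intCast] at hJlt
    have : |J| < 1 := by exact_mod_cast hJlt
    rwa [Int.abs_lt_one_iff] at this
  have hdvd : (p : ℤ) ∣ n * N * l ^ (p * d) := by
    refine ⟨-(m - l ^ (p * d) * (N * gp.eval 0)), ?_⟩
    linear_combination hJ - hJ0
  have hpI : Prime (p : ℤ) := Nat.prime_iff_prime_int.mp hp
  rcases hpI.dvd_or_dvd hdvd with h | h
  · rcases hpI.dvd_or_dvd h with h | h
    · exact hpn h
    · have := Nat.le_of_dvd hNpos (Int.natCast_dvd_natCast.mp h)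
      omega
  · have := Int.natCast_dvd.mp (hpI.dvd_of_dvd_pow h)
    have := Nat.le_of_dvd (Int.natAbs_pos.mpr hl0) this
    omega

open Polynomial in
/-- If `β` is algebraic over `ℚ` then `exp β ≠ -1`. -/
lemma exp_ne_neg_one_of_isAlgebraic (β : ℂ) (hβ : IsAlgebraic ℚ β) : cexp β ≠ -1 := by
  classical
  intro hexp
  let φ : AlgebraicClosure ℚ →ₐ[ℚ] ℂ := IsAlgClosed.lift
  set P := minpoly ℚ β with hP
  have hPne : P ≠ 0 := minpoly.ne_zero hβ.isIntegral
  set R := (P.aroots (AlgebraicClosure ℚ)).toFinset with hR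
  have hmem : ∀ b, b ∈ R ↔ aeval b P = 0 := by
    intro b
    rw [hR, Multiset.mem_toFinset, mem_aroots]
    simp [hPne]
  obtain ⟨b0, hb0, hb0'⟩ : ∃ b0 ∈ R, φ b0 = β := by
    have hs : (P.map (algebraMap ℚ (AlgebraicClosure ℚ))).Splits := IsAlgClosed.splits _
    have h2 := hs.image_rootSet φ
    have h3 : β ∈ P.rootSet ℂ := by
      rw [mem_rootSet]
      exact ⟨hPne, minpoly.aeval ℚ β⟩
    rw [← h2] at h3
    obtain ⟨b0, hb0, h⟩ := h3
    exact ⟨b0, (hmem b0).mpr (mem_rootSet.mp hb0).2, h⟩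
  set S : Multiset (AlgebraicClosure ℚ) := R.powerset.val.map (fun s => ∑ b ∈ s, b) with hSd
  refine sum_exp_ne_zero_of_galois_stable φ S ?_ ?_ ?_
  · intro σ
    have hRσ : R.map σ.toEquiv.toEmbedding = R := by
      apply Finset.eq_of_subset_of_card_le
      · intro x hx
        rw [Finset.mem_map] at hx
        obtain ⟨y, hy, rfl⟩ := hx
        rw [hmem] at hy ⊢
        have := Polynomial.aeval_algHom_apply (σ : AlgebraicClosure ℚ →ₐ[ℚ] AlgebraicClosure ℚ) y P
        rw [hy, map_zero] at this
        exact this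
      · rw [Finset.card_map]
    have hpow : R.powerset.map (Finset.mapEmbedding σ.toEquiv.toEmbedding).toEmbedding
        = R.powerset := by
      apply Finset.eq_of_subset_of_card_le
      · intro x hx
        rw [Finset.mem_map] at hx
        obtain ⟨y, hy, rfl⟩ := hx
        rw [Finset.mem_powerset] at hy ⊢
        conv_rhs => rw [← hRσ]
        exact Finset.map_subset_map.mpr hy
      · rw [Finset.card_map]
    rw [hSd]
    conv_rhs => rw [← hpow]
    rw [Finset.map_val, Multiset.map_map, Multiset.map_map]
    refine Multiset.map_congr rfl fun s _ => ?_
    simp [Finset.mapEmbedding_apply, Finset.sum_map]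
  · rw [hSd, Multiset.mem_map]
    exact ⟨∅, by simp, by simp⟩
  · rw [hSd, Multiset.map_map]
    have : ∑ s ∈ R.powerset, cexp (φ (∑ b ∈ s, b)) = ∏ b ∈ R, (1 + cexp (φ b)) := by
      rw [Finset.prod_one_add]
      refine Finset.sum_congr rfl fun s _ => ?_
      rw [map_sum, Complex.exp_sum]
    refine Eq.trans this ?_
    exact Finset.prod_eq_zero hb0 (by rw [hb0', hexp]; ring)

lemma not_isAlgebraic_pi : ¬ IsAlgebraic ℚ (Real.pi : ℂ) := by
  intro h
  refine exp_ne_neg_one_of_isAlgebraic (Real.pi * I) (h.mul ?_) Complex.exp_pi_mul_I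
  refine (IsIntegral.of_pow two_pos ?_).isAlgebraic
  rw [I_sq]
  exact isIntegral_one.neg

/-- The field of complex numbers algebraic over `ℚ`. -/
def 𝔸 : IntermediateField ℚ ℂ := algebraicClosure ℚ ℂ

lemma mem_𝔸 {x : ℂ} : x ∈ 𝔸 ↔ IsAlgebraic ℚ x := mem_algebraicClosure_iff

/-- An algebraic number that is an algebraic multiple of `π` vanishes. -/
lemma eq_zero_of_mem_of_pi_mul {t y : ℂ} (ht : t ∈ 𝔸) (hy : y ∈ 𝔸) (h : t = Real.pi * y) :
    t = 0 := by
  by_contra h0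
  have hy0 : y ≠ 0 := by rintro rfl; simp at h; exact h0 h
  have : (Real.pi : ℂ) ∈ 𝔸 := by
    have : (Real.pi : ℂ) = t / y := by rw [h]; field_simp
    rw [this]
    exact div_mem ht hy
  exact not_isAlgebraic_pi (mem_𝔸.mp this)

section Determinants

variable {n : Type*} [Fintype n] [DecidableEq n]

/-- A Hadamard type bound: the determinant is at most the product of the `ℓ¹` norms of the
columns. -/
lemma norm_det_le_prod_sum (M : Matrix n n ℂ) : ‖M.det‖ ≤ ∏ j, ∑ i, ‖M i j‖ := by
  rw [Matrix.det_apply', Finset.prod_univ_sum]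
  refine (norm_sum_le _ _).trans ?_
  have h1 : ∀ σ : Equiv.Perm n, ‖((Equiv.Perm.sign σ : ℤ) : ℂ) * ∏ i, M (σ i) i‖
      = ∏ i, ‖M (σ i) i‖ := by
    intro σ
    rw [norm_mul, norm_prod]
    rcases Int.units_eq_one_or (Equiv.Perm.sign σ) with h | h <;> simp [h]
  rw [Finset.sum_congr rfl fun σ _ => h1 σ]
  have hinj : Function.Injective (fun σ : Equiv.Perm n => (σ : n → n)) := DFunLike.coe_injective
  rw [← Finset.sum_image (f := fun x : n → n => ∏ i, ‖M (x i) i‖)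
    (g := fun σ : Equiv.Perm n => (σ : n → n)) fun σ _ τ _ h => hinj h]
  refine Finset.sum_le_sum_of_subset_of_nonneg ?_ fun x _ _ =>
    Finset.prod_nonneg fun i _ => norm_nonneg _
  intro x _
  simp

lemma eval_charpolyRev_eq_det (B : Matrix n n ℂ) (z : ℂ) :
    B.charpolyRev.eval z = (1 - z • B).det := by
  rw [Matrix.charpolyRev, ← Polynomial.coe_evalRingHom, RingHom.map_det]
  congr 1
  ext i j
  simp [Matrix.one_apply]
  split_ifs <;> simp [mul_comm]

lemma norm_eval_charpolyRev_le (B : Matrix n n ℂ) (z : ℂ) :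
    ‖B.charpolyRev.eval z‖ ≤ Real.exp (‖z‖ * ∑ j, ∑ i, ‖B i j‖) := by
  rw [eval_charpolyRev_eq_det, Finset.mul_sum, Real.exp_sum]
  refine (norm_det_le_prod_sum _).trans ?_
  refine Finset.prod_le_prod (fun j _ => Finset.sum_nonneg fun i _ => norm_nonneg _) fun j _ => ?_
  have : ∑ i, ‖(1 - z • B) i j‖ ≤ 1 + ‖z‖ * ∑ i, ‖B i j‖ := by
    calc ∑ i, ‖(1 - z • B) i j‖ ≤ ∑ i, ((if i = j then 1 else 0) + ‖z‖ * ‖B i j‖) := by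
          refine Finset.sum_le_sum fun i _ => ?_
          rw [Matrix.sub_apply, Matrix.smul_apply, Matrix.one_apply]
          refine (norm_sub_le _ _).trans ?_
          rw [smul_eq_mul, norm_mul]
          split_ifs <;> simp
      _ = _ := by rw [Finset.sum_add_distrib, Finset.mul_sum]; simp
  refine this.trans ?_
  have := Real.add_one_le_exp (‖z‖ * ∑ i, ‖B i j‖)
  linarith

open Polynomial in
/-- The adjugate of `1 - X B`. -/
def adjRev (B : Matrix n n ℂ) : Matrix n n ℂ[X] := (1 - (X : ℂ[X]) • B.map C).adjugate

open Polynomial in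
lemma adjRev_eq (B : Matrix n n ℂ) :
    adjRev B = B.charpolyRev • 1 + (X : ℂ[X]) • (adjRev B * B.map C) := by
  have h := Matrix.adjugate_mul (1 - (X : ℂ[X]) • B.map C)
  rw [mul_sub, mul_one, Matrix.mul_smul] at h
  rw [Matrix.charpolyRev, ← h, adjRev]
  simp

open Polynomial in
lemma derivative_charpolyRev (B : Matrix n n ℂ) :
    derivative B.charpolyRev = -(adjRev B * B.map C).trace := by
  apply Polynomial.eq_of_infinite_eval_eq
  have hP0 : B.charpolyRev ≠ 0 := by
    intro h
    have := Matrix.eval_charpolyRev (M := B)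
    simp [h] at this
  have hfin : {z | B.charpolyRev.eval z = 0}.Finite := by
    have := (B.charpolyRev).roots.toFinset.finite_toSet
    refine this.subset fun z hz => ?_
    simp only [Finset.mem_coe, Multiset.mem_toFinset]
    rw [mem_roots hP0]
    exact hz
  refine hfin.infinite_compl.mono fun z hz => ?_
  have hz' : B.charpolyRev.eval z ≠ 0 := hz
  rw [eval_charpolyRev_eq_det] at hz'
  set M : Matrix n n ℂ := 1 - z • B with hM
  have hMu : IsUnit M.det := isUnit_iff_ne_zero.mpr hz'
  have h1 : ∀ h : ℂ, B.charpolyRev.eval (z + h)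
      = M.det * (1 + (M⁻¹ * B).trace * (-h) +
        Polynomial.eval (-h) (1 + (X : ℂ[X]) • (M⁻¹ * B).map C).det.divX.divX * (-h) ^ 2) := by
    intro h
    rw [eval_charpolyRev_eq_det, ← Matrix.det_one_add_smul, ← Matrix.det_mul, mul_add, mul_one,
      Matrix.mul_smul, ← Matrix.mul_assoc, Matrix.mul_nonsing_inv _ hMu, Matrix.one_mul, hM]
    congr 1
    rw [add_smul, neg_smul]
    abel
  have h2 : HasDerivAt (fun h : ℂ => B.charpolyRev.eval (z + h))
      (M.det * ((M⁻¹ * B).trace * (-1))) 0 := by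
    rw [funext h1]
    have e1 : HasDerivAt (fun h : ℂ => -h) (-1) 0 := (hasDerivAt_id (0 : ℂ)).neg
    have e2 := ((Polynomial.differentiable
      ((1 + (X : ℂ[X]) • (M⁻¹ * B).map C).det.divX.divX)).differentiableAt
        (x := -(0 : ℂ))).hasDerivAt.comp (0 : ℂ) e1
    have e3 := ((e1.const_mul (M⁻¹ * B).trace).const_add 1).add (e2.mul (e1.pow 2))
    have e4 := e3.const_mul M.det
    refine e4.congr_deriv ?_
    simp
  have h3 : HasDerivAt (fun h : ℂ => B.charpolyRev.eval (z + h))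
      ((derivative B.charpolyRev).eval z) 0 := by
    have := (B.charpolyRev.hasDerivAt (z + 0)).comp_const_add z 0
    simpa using this
  show (derivative B.charpolyRev).eval z = _
  rw [h3.unique h2]
  have h4 : (adjRev B * B.map C).map (Polynomial.evalRingHom z) = M.adjugate * B := by
    rw [Matrix.map_mul, adjRev]
    congr 1
    · change (Polynomial.evalRingHom z).mapMatrix _ = _
      rw [RingHom.map_adjugate]
      congr 1
      ext i j
      simp [hM, Matrix.one_apply]
      split_ifs <;> simp [mul_comm]
    · ext i j
      simp
  have h5 : Polynomial.eval z (adjRev B * B.map C).trace = (M.adjugate * B).trace := by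
    rw [← h4]
    simp only [Matrix.trace, Matrix.diag_apply, Matrix.map_apply, Polynomial.coe_evalRingHom,
      Polynomial.eval_finsetSum]
  rw [Polynomial.eval_neg, h5]
  have h6 : M.adjugate = M.det • M⁻¹ := by
    rw [Matrix.inv_def, smul_smul, Ring.mul_inverse_cancel _ hMu, one_smul]
  rw [h6, Matrix.smul_mul, Matrix.trace_smul, smul_eq_mul]
  ring

open Polynomial in
lemma derivative_charpolyRev_eq_sum (B : Matrix n n ℂ) (N : ℕ) :
    derivative B.charpolyRev =
      -(B.charpolyRev * ∑ k ∈ Finset.range N, X ^ k * C (B ^ (k + 1)).trace)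
        - X ^ N * (adjRev B * (B.map C) ^ (N + 1)).trace := by
  induction N with
  | zero => simp [derivative_charpolyRev]
  | succ N ih =>
    rw [ih, Finset.sum_range_succ]
    have h : (adjRev B * (B.map C) ^ (N + 1)).trace = B.charpolyRev * C (B ^ (N + 1)).trace
        + X * (adjRev B * (B.map C) ^ (N + 1 + 1)).trace := by
      conv_lhs => rw [adjRev_eq]
      rw [Matrix.add_mul, Matrix.trace_add, Matrix.smul_mul, Matrix.smul_mul, Matrix.one_mul,
        Matrix.trace_smul, Matrix.trace_smul, smul_eq_mul, smul_eq_mul, Matrix.mul_assoc,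
        ← pow_succ']
      congr 2
      have : (B.map C) ^ (N + 1) = (B ^ (N + 1)).map (C : ℂ →+* ℂ[X]) :=
        (map_pow (RingHom.mapMatrix (C : ℂ →+* ℂ[X])) B (N + 1)).symm
      rw [this]
      simp [Matrix.trace]
    rw [h]
    ring

open Polynomial in
lemma coeff_charpolyRev_succ (B : Matrix n n ℂ) (N : ℕ) :
    B.charpolyRev.coeff (N + 1) * (N + 1) =
      -∑ k ∈ Finset.range (N + 1), B.charpolyRev.coeff (N - k) * (B ^ (k + 1)).trace := by
  have h := congrArg (fun p => p.coeff N) (derivative_charpolyRev_eq_sum B (N + 1))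
  simp only [coeff_derivative] at h
  rw [h, coeff_sub, coeff_neg, coeff_X_pow_mul', if_neg (by omega), sub_zero, Finset.mul_sum,
    finsetSum_coeff]
  congr 1
  refine Finset.sum_congr rfl fun k hk => ?_
  rw [mul_left_comm, coeff_X_pow_mul', if_pos (by have := Finset.mem_range.mp hk; omega),
    coeff_mul_C]

lemma iteratedDeriv_eval_zero (p : Polynomial ℂ) (N : ℕ) :
    iteratedDeriv N (fun z => p.eval z) 0 = N.factorial * p.coeff N := by
  have : ∀ (k : ℕ) (p : Polynomial ℂ), iteratedDeriv k (fun z => p.eval z)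
      = fun z => ((Polynomial.derivative^[k]) p).eval z := by
    intro k
    induction k with
    | zero => intro p; simp
    | succ k ih =>
      intro p
      rw [iteratedDeriv_succ', Function.iterate_succ_apply, ← ih]
      congr 1
      ext z
      simp
  rw [this]
  simp only
  rw [← Polynomial.coeff_zero_eq_eval_zero, Polynomial.coeff_iterate_derivative]
  simp [Nat.descFactorial_self]

lemma norm_coeff_charpolyRev_le (B : Matrix n n ℂ) (ρ : ℝ) (hρ : 0 < ρ) (N : ℕ) :
    ‖B.charpolyRev.coeff N‖ ≤ Real.exp (ρ * ∑ j, ∑ i, ‖B i j‖) / ρ ^ N := by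
  have h := Complex.norm_iteratedDeriv_le_of_forall_mem_sphere_norm_le (c := 0) N hρ
    (f := fun z => B.charpolyRev.eval z) (C := Real.exp (ρ * ∑ j, ∑ i, ‖B i j‖))
    B.charpolyRev.differentiable.diffContOnCl (fun z hz => by
      have := norm_eval_charpolyRev_le B z
      rwa [mem_sphere_zero_iff_norm.mp hz] at this)
  rw [iteratedDeriv_eval_zero, norm_mul, Complex.norm_natCast, mul_div_assoc] at h
  exact le_of_mul_le_mul_left h (by positivity)

end Determinants

section Kernels

variable {ι : Type*} [DecidableEq ι]

/-- Powers of an infinite matrix. -/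
def kpow (B : ι → ι → ℂ) : ℕ → ι → ι → ℂ
  | 0 => fun i j => if i = j then 1 else 0
  | n + 1 => fun i j => ∑' k, B i k * kpow B n k j

/-- The trace of the `n`-th power of an infinite matrix. -/
def ktr (B : ι → ι → ℂ) (n : ℕ) : ℂ := ∑' i, kpow B n i i

/-- The truncation of an infinite matrix to a finite block. -/
def ktrunc (B : ι → ι → ℂ) (s : Finset ι) : ι → ι → ℂ :=
  fun i j => if i ∈ s ∧ j ∈ s then B i j else 0

/-- The finite block of an infinite matrix. -/
def kblock (B : ι → ι → ℂ) (s : Finset ι) : Matrix s s ℂ := fun i j => B i j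

lemma norm_ktrunc_le (B : ι → ι → ℂ) (s : Finset ι) (i j : ι) : ‖ktrunc B s i j‖ ≤ ‖B i j‖ := by
  unfold ktrunc
  split_ifs <;> simp

variable {B : ι → ι → ℂ}

omit [DecidableEq ι] in
lemma tsum_row_le (hB : Summable fun p : ι × ι => ‖B p.1 p.2‖) (i : ι) :
    ∑' j, ‖B i j‖ ≤ ∑' p : ι × ι, ‖B p.1 p.2‖ := by
  rw [hB.tsum_prod]
  exact hB.prod.le_tsum i fun k _ => tsum_nonneg fun j => norm_nonneg _

lemma norm_kpow_le (hB : Summable fun p : ι × ι => ‖B p.1 p.2‖) {A : ι → ι → ℂ}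
    (hA : ∀ i j, ‖A i j‖ ≤ ‖B i j‖) (n : ℕ) (i j : ι) :
    ‖kpow A n i j‖ ≤ (1 + ∑' p : ι × ι, ‖B p.1 p.2‖) ^ n := by
  set R := ∑' p : ι × ι, ‖B p.1 p.2‖ with hR
  have hR0 : 0 ≤ R := tsum_nonneg fun p => norm_nonneg _
  induction n generalizing i with
  | zero => simp only [kpow, pow_zero]; split_ifs <;> simp
  | succ n ih =>
    have hs := (hB.prod_factor i).mul_right ((1 + R) ^ n)
    have : ‖kpow A (n + 1) i j‖ ≤ ∑' k, ‖B i k‖ * (1 + R) ^ n := by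
      refine tsum_of_norm_bounded hs.hasSum fun k => ?_
      rw [norm_mul]
      exact mul_le_mul (hA i k) (ih k) (norm_nonneg _) (norm_nonneg _)
    refine this.trans ?_
    rw [tsum_mul_right, pow_succ', ]
    gcongr
    have := tsum_row_le hB i
    linarith

lemma norm_kpow_succ_le (hB : Summable fun p : ι × ι => ‖B p.1 p.2‖) {A : ι → ι → ℂ}
    (hA : ∀ i j, ‖A i j‖ ≤ ‖B i j‖) (n : ℕ) (i j : ι) :
    ‖kpow A (n + 1) i j‖ ≤ (∑' k, ‖B i k‖) * (1 + ∑' p : ι × ι, ‖B p.1 p.2‖) ^ n := by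
  rw [← tsum_mul_right]
  refine tsum_of_norm_bounded ((hB.prod_factor i).mul_right _).hasSum fun k => ?_
  rw [norm_mul]
  exact mul_le_mul (hA i k) (norm_kpow_le hB hA n k j) (norm_nonneg _) (norm_nonneg _)

lemma tendsto_kpow_ktrunc (hB : Summable fun p : ι × ι => ‖B p.1 p.2‖) (n : ℕ) (i j : ι) :
    Filter.Tendsto (fun s : Finset ι => kpow (ktrunc B s) n i j) Filter.atTop
      (nhds (kpow B n i j)) := by
  induction n generalizing i with
  | zero => exact tendsto_const_nhds
  | succ n ih =>
    refine tendsto_tsum_of_dominated_convergence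
      ((hB.prod_factor i).mul_right ((1 + ∑' p : ι × ι, ‖B p.1 p.2‖) ^ n)) (fun k => ?_)
      (Filter.Eventually.of_forall fun s k => ?_)
    · refine Filter.Tendsto.mul ?_ (ih k)
      refine tendsto_const_nhds.congr' ?_
      filter_upwards [Filter.eventually_ge_atTop ({i, k} : Finset ι)] with s hs
      have hi : i ∈ s := hs (by simp)
      have hk : k ∈ s := hs (by simp)
      simp [ktrunc, hi, hk]
    · rw [norm_mul]
      exact mul_le_mul (norm_ktrunc_le B s i k) (norm_kpow_le hB (norm_ktrunc_le B s) n k j)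
        (norm_nonneg _) (norm_nonneg _)

lemma tendsto_ktr_ktrunc (hB : Summable fun p : ι × ι => ‖B p.1 p.2‖) (n : ℕ) :
    Filter.Tendsto (fun s : Finset ι => ktr (ktrunc B s) (n + 1)) Filter.atTop
      (nhds (ktr B (n + 1))) :=
  tendsto_tsum_of_dominated_convergence (hB.prod.mul_right _)
    (fun i => tendsto_kpow_ktrunc hB (n + 1) i i)
    (Filter.Eventually.of_forall fun s i => norm_kpow_succ_le hB (norm_ktrunc_le B s) n i i)

lemma kblock_pow_apply (B : ι → ι → ℂ) (s : Finset ι) (n : ℕ) (i j : s) :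
    (kblock B s ^ n) i j = kpow (ktrunc B s) n i j := by
  induction n generalizing i with
  | zero => rw [pow_zero, Matrix.one_apply]; simp only [kpow, Subtype.ext_iff]
  | succ n ih =>
    rw [pow_succ', Matrix.mul_apply]
    simp only [kpow]
    rw [tsum_eq_sum (s := s)]
    · rw [← Finset.sum_coe_sort s fun k => ktrunc B s i k * kpow (ktrunc B s) n k j]
      refine Finset.sum_congr rfl fun k _ => ?_
      rw [ih]
      simp [ktrunc, kblock]
    · intro k hk
      simp [ktrunc, hk]

lemma trace_kblock_pow (B : ι → ι → ℂ) (s : Finset ι) (n : ℕ) :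
    (kblock B s ^ (n + 1)).trace = ktr (ktrunc B s) (n + 1) := by
  rw [ktr, tsum_eq_sum (s := s), Matrix.trace,
    ← Finset.sum_coe_sort s fun i => kpow (ktrunc B s) (n + 1) i i]
  · exact Finset.sum_congr rfl fun i _ => kblock_pow_apply B s (n + 1) i i
  · intro i hi
    simp [kpow, ktrunc, hi]

lemma tendsto_trace_kblock_pow (hB : Summable fun p : ι × ι => ‖B p.1 p.2‖) (n : ℕ) :
    Filter.Tendsto (fun s : Finset ι => (kblock B s ^ (n + 1)).trace) Filter.atTop
      (nhds (ktr B (n + 1))) := by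
  simp_rw [trace_kblock_pow]
  exact tendsto_ktr_ktrunc hB n

omit [DecidableEq ι] in
lemma sum_kblock_le (hB : Summable fun p : ι × ι => ‖B p.1 p.2‖) (s : Finset ι) :
    ∑ j : s, ∑ i : s, ‖kblock B s i j‖ ≤ ∑' p : ι × ι, ‖B p.1 p.2‖ := by
  rw [Finset.sum_comm]
  simp only [kblock]
  rw [Finset.sum_coe_sort s (fun i => ∑ j : s, ‖B i j‖)]
  rw [Finset.sum_congr rfl fun i _ => Finset.sum_coe_sort s (fun j => ‖B i j‖),
    ← Finset.sum_product']
  exact hB.sum_le_tsum _ fun p _ => norm_nonneg _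

lemma tendsto_coeff_charpolyRev (hB : Summable fun p : ι × ι => ‖B p.1 p.2‖)
    (hτ : ∀ n, ktr B (n + 1) = 0) (n : ℕ) :
    Filter.Tendsto (fun s : Finset ι => (kblock B s).charpolyRev.coeff n) Filter.atTop
      (nhds (if n = 0 then 1 else 0)) := by
  induction n using Nat.strong_induction_on with
  | _ n ih =>
    rcases n with _ | n
    · refine tendsto_const_nhds.congr fun s => ?_
      simp [Polynomial.coeff_zero_eq_eval_zero]
    · have h : ∀ s : Finset ι, (kblock B s).charpolyRev.coeff (n + 1) =
          -(∑ k ∈ Finset.range (n + 1), (kblock B s).charpolyRev.coeff (n - k) *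
            (kblock B s ^ (k + 1)).trace) / (n + 1) := by
        intro s
        rw [eq_div_iff (by exact_mod_cast Nat.succ_ne_zero n)]
        exact_mod_cast coeff_charpolyRev_succ (kblock B s) n
      simp_rw [h]
      have h2 : Filter.Tendsto (fun s : Finset ι => ∑ k ∈ Finset.range (n + 1),
          (kblock B s).charpolyRev.coeff (n - k) * (kblock B s ^ (k + 1)).trace) Filter.atTop
          (nhds (∑ k ∈ Finset.range (n + 1), (if n - k = 0 then (1 : ℂ) else 0) * 0)) := by
        refine tendsto_finsetSum _ fun k _ => (ih (n - k) (by omega)).mul ?_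
        have := tendsto_trace_kblock_pow hB k
        rwa [hτ] at this
      have h3 := (h2.neg).div_const ((n : ℂ) + 1)
      simpa using h3

lemma tendsto_eval_charpolyRev (hB : Summable fun p : ι × ι => ‖B p.1 p.2‖)
    (hτ : ∀ n, ktr B (n + 1) = 0) (z : ℂ) :
    Filter.Tendsto (fun s : Finset ι => (kblock B s).charpolyRev.eval z) Filter.atTop
      (nhds 1) := by
  set R := ∑' p : ι × ι, ‖B p.1 p.2‖ with hR
  set ρ : ℝ := 2 * ‖z‖ + 1 with hρ
  have hρ0 : 0 < ρ := by positivity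
  have hx : ‖z‖ / ρ < 1 := by
    rw [div_lt_one hρ0]
    have := norm_nonneg z
    linarith
  have h1 : ∀ s : Finset ι, (kblock B s).charpolyRev.eval z
      = ∑' n, (kblock B s).charpolyRev.coeff n * z ^ n := by
    intro s
    rw [Polynomial.eval_eq_sum_range, tsum_eq_sum]
    intro n hn
    rw [Polynomial.coeff_eq_zero_of_natDegree_lt, zero_mul]
    simpa using hn
  simp_rw [h1]
  have h2 : (1 : ℂ) = ∑' n : ℕ, (if n = 0 then 1 else 0) * z ^ n := by
    rw [tsum_eq_single 0]
    · simp
    · intro n hn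
      simp [hn]
  rw [h2]
  refine tendsto_tsum_of_dominated_convergence
    (bound := fun n => Real.exp (ρ * R) * (‖z‖ / ρ) ^ n)
    ((summable_geometric_of_lt_one (by positivity) hx).mul_left _)
    (fun n => (tendsto_coeff_charpolyRev hB hτ n).mul_const _)
    (Filter.Eventually.of_forall fun s n => ?_)
  rw [norm_mul, norm_pow, div_pow, ← mul_div_assoc, mul_comm (Real.exp _), mul_div_assoc,
    mul_comm]
  gcongr
  refine (norm_coeff_charpolyRev_le (kblock B s) ρ hρ0 n).trans ?_
  gcongr
  exact sum_kblock_le hB s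

/-- Cramer's rule bound. -/
lemma norm_det_mul_le {n : Type*} [Fintype n] [DecidableEq n] (B : Matrix n n ℂ) (z : ℂ)
    (v w : n → ℂ) (h : (1 - z • B).mulVec v = w) (i : n) :
    ‖B.charpolyRev.eval z‖ * ‖v i‖ ≤ (∑ k, ‖w k‖) * Real.exp (‖z‖ * ∑ j, ∑ i, ‖B i j‖) := by
  have h1 : (1 - z • B).det * v i = ((1 - z • B).updateCol i w).det := by
    rw [← Matrix.cramer_apply, Matrix.cramer_eq_adjugate_mulVec, ← h, Matrix.mulVec_mulVec,
      Matrix.adjugate_mul]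
    simp [Matrix.smul_mulVec]
  rw [eval_charpolyRev_eq_det, ← norm_mul, h1]
  refine (norm_det_le_prod_sum _).trans ?_
  rw [← Finset.mul_prod_erase Finset.univ _ (Finset.mem_univ i)]
  refine mul_le_mul (le_of_eq ?_) ?_ (Finset.prod_nonneg fun j _ =>
    Finset.sum_nonneg fun i _ => norm_nonneg _) (Finset.sum_nonneg fun i _ => norm_nonneg _)
  · simp
  · rw [Finset.mul_sum]
    calc ∏ j ∈ Finset.univ.erase i, ∑ k, ‖(1 - z • B).updateCol i w k j‖
        ≤ ∏ j ∈ Finset.univ.erase i, Real.exp (‖z‖ * ∑ k, ‖B k j‖) := by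
          refine Finset.prod_le_prod (fun j _ => Finset.sum_nonneg fun i _ => norm_nonneg _)
            fun j hj => ?_
          have hji : j ≠ i := Finset.ne_of_mem_erase hj
          have : ∑ k, ‖(1 - z • B).updateCol i w k j‖ ≤ 1 + ‖z‖ * ∑ k, ‖B k j‖ := by
            calc ∑ k, ‖(1 - z • B).updateCol i w k j‖
                ≤ ∑ k, ((if k = j then 1 else 0) + ‖z‖ * ‖B k j‖) := by
                  refine Finset.sum_le_sum fun k _ => ?_
                  rw [Matrix.updateCol_ne hji, Matrix.sub_apply, Matrix.smul_apply,
                    Matrix.one_apply]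
                  refine (norm_sub_le _ _).trans ?_
                  rw [smul_eq_mul, norm_mul]
                  split_ifs <;> simp
              _ = _ := by rw [Finset.sum_add_distrib, Finset.mul_sum]; simp
          refine this.trans ?_
          have := Real.add_one_le_exp (‖z‖ * ∑ i, ‖B i j‖)
          linarith
      _ ≤ _ := by
          rw [← Real.exp_sum]
          exact Real.exp_le_exp.mpr (Finset.sum_le_sum_of_subset_of_nonneg
            (Finset.erase_subset _ _) fun j _ _ => mul_nonneg (norm_nonneg _)
              (Finset.sum_nonneg fun i _ => norm_nonneg _))

/-- If all the traces of powers vanish, there is no bounded eigenvector. -/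
theorem eq_zero_of_ktr_eq_zero (hB : Summable fun p : ι × ι => ‖B p.1 p.2‖)
    (hτ : ∀ n, ktr B (n + 1) = 0) (z : ℂ) (v : ι → ℂ) (V : ℝ) (hV : ∀ i, ‖v i‖ ≤ V)
    (hv : ∀ i, v i = z * ∑' j, B i j * v j) : v = 0 := by
  set R := ∑' p : ι × ι, ‖B p.1 p.2‖ with hR
  funext i
  have hV0 : 0 ≤ V := (norm_nonneg _).trans (hV i)
  have hsum : ∀ k, Summable fun j => B k j * v j := fun k => by
    refine Summable.of_norm_bounded ((hB.prod_factor k).mul_right V) fun j => ?_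
    rw [norm_mul]
    exact mul_le_mul_of_nonneg_left (hV j) (norm_nonneg _)
  have key : ∀ s : Finset ι, i ∈ s → ‖(kblock B s).charpolyRev.eval z‖ * ‖v i‖ ≤
      (‖z‖ * V * (R - ∑ p ∈ s ×ˢ s, ‖B p.1 p.2‖)) * Real.exp (‖z‖ * R) := by
    intro s hi
    have hw : (1 - z • kblock B s).mulVec (fun k : s => v k)
        = fun k : s => z * ∑' j : {j // j ∉ s}, B k j * v j := by
      funext k
      rw [Matrix.sub_mulVec, Matrix.one_mulVec, Pi.sub_apply, Matrix.smul_mulVec, Pi.smul_apply,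
        smul_eq_mul, hv k, ← mul_sub]
      congr 1
      rw [← (hsum k).sum_add_tsum_subtype_compl s, ← Finset.sum_coe_sort]
      simp [Matrix.mulVec, dotProduct, kblock]
    refine (norm_det_mul_le _ z _ _ hw ⟨i, hi⟩).trans ?_
    have hle : ∑ k : s, ‖z * ∑' j : {j // j ∉ s}, B k j * v j‖
        ≤ ‖z‖ * V * (R - ∑ p ∈ s ×ˢ s, ‖B p.1 p.2‖) := by
      have h1 : ∀ k : s, ‖z * ∑' j : {j // j ∉ s}, B k j * v j‖
          ≤ ‖z‖ * V * (∑' j, ‖B k j‖ - ∑ j ∈ s, ‖B k j‖) := by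
        intro k
        rw [norm_mul, mul_assoc]
        gcongr
        rw [← (hB.prod_factor (k : ι)).sum_add_tsum_subtype_compl s, add_sub_cancel_left,
          ← tsum_mul_left]
        refine tsum_of_norm_bounded
          (((hB.prod_factor (k : ι)).subtype _).mul_left V).hasSum fun j => ?_
        rw [norm_mul, mul_comm]
        exact mul_le_mul_of_nonneg_right (hV j) (norm_nonneg _)
      refine (Finset.sum_le_sum fun k _ => h1 k).trans ?_
      rw [← Finset.mul_sum, Finset.sum_sub_distrib, Finset.sum_product,
        Finset.sum_coe_sort s (fun k => ∑' j, ‖B k j‖),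
        Finset.sum_coe_sort s (fun k => ∑ j ∈ s, ‖B k j‖)]
      gcongr
      rw [hR, hB.tsum_prod]
      exact hB.prod.sum_le_tsum _ fun k _ => tsum_nonneg fun j => norm_nonneg _
    have h0 : 0 ≤ ‖z‖ * V * (R - ∑ p ∈ s ×ˢ s, ‖B p.1 p.2‖) :=
      (Finset.sum_nonneg fun k _ => norm_nonneg _).trans hle
    gcongr
    exact sum_kblock_le hB s
  have hlim : Filter.Tendsto (fun s : Finset ι =>
      (‖z‖ * V * (R - ∑ p ∈ s ×ˢ s, ‖B p.1 p.2‖)) * Real.exp (‖z‖ * R)) Filter.atTop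
      (nhds ((‖z‖ * V * (R - R)) * Real.exp (‖z‖ * R))) := by
    refine ((tendsto_const_nhds.sub ?_).const_mul _).mul_const _
    exact hB.hasSum.comp (Filter.tendsto_atTop_finset_of_monotone
      (fun s t h => Finset.product_subset_product h h) fun p => ⟨{p.1, p.2}, by simp⟩)
  have hlim2 := (tendsto_eval_charpolyRev hB hτ z).norm.mul_const ‖v i‖
  have := le_of_tendsto_of_tendsto hlim2 hlim (by
    filter_upwards [Filter.eventually_ge_atTop ({i} : Finset ι)] with s hs
    exact key s (hs (by simp)))
  simp at this
  simpa using this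

end Kernels

lemma norm_trace_pow_le {n : Type*} [Fintype n] [DecidableEq n] (B : Matrix n n ℂ) (R ρ : ℝ)
    (hR : ∑ j, ∑ i, ‖B i j‖ ≤ R) (hρ : 0 < ρ)
    (h0 : ∀ z : ℂ, ‖z‖ < ρ → B.charpolyRev.eval z ≠ 0) (N : ℕ) :
    ‖(B ^ (N + 1)).trace‖ ≤ (N + 1) * (2 * (R + 1)) * 2 ^ (N + 1) / ρ ^ N := by
  have hR0 : 0 ≤ R := le_trans (Finset.sum_nonneg fun j _ => Finset.sum_nonneg fun i _ =>
    norm_nonneg _) hR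
  set P := B.charpolyRev with hP
  have hP0 : P.eval 0 = 1 := Matrix.eval_charpolyRev
  have hPd : Differentiable ℂ (fun z => P.eval z) := P.differentiable
  have hdiff : DifferentiableOn ℂ (fun z => (Polynomial.derivative P).eval z / P.eval z)
      (Metric.ball 0 ρ) := fun z hz =>
    ((Polynomial.derivative P).differentiable z |>.div (hPd z)
      (h0 z (mem_ball_zero_iff.mp hz))).differentiableWithinAt
  obtain ⟨g0, hg0⟩ := hdiff.isExactOn_ball
  set g : ℂ → ℂ := fun z => g0 z - g0 0 with hg
  have hgd : ∀ z ∈ Metric.ball (0 : ℂ) ρ,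
      HasDerivAt g ((Polynomial.derivative P).eval z / P.eval z) z :=
    fun z hz => (hg0 z hz).sub_const _
  have hgz : g 0 = 0 := sub_self _
  have hexp : ∀ z ∈ Metric.ball (0 : ℂ) ρ, P.eval z = cexp (g z) := by
    have hq : ∀ z ∈ Metric.ball (0 : ℂ) ρ,
        HasDerivAt (fun z => P.eval z * cexp (-g z)) 0 z := by
      intro z hz
      have h1 := (P.hasDerivAt z).mul ((hgd z hz).neg.cexp)
      refine h1.congr_deriv ?_
      have := h0 z (mem_ball_zero_iff.mp hz)
      field_simp
      ring
    intro z hz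
    have h2 := (convex_ball (0 : ℂ) ρ).is_const_of_fderivWithin_eq_zero (𝕜 := ℂ)
      (f := fun z => P.eval z * cexp (-g z))
      (fun w hw => (hq w hw).differentiableAt.differentiableWithinAt)
      (fun w hw => by
        rw [fderivWithin_of_isOpen Metric.isOpen_ball hw]
        have := (hq w hw).hasFDerivAt.fderiv
        rw [this]
        ext
        simp) hz (Metric.mem_ball_self hρ)
    simp only [hP0, hgz, neg_zero, Complex.exp_zero, mul_one] at h2
    rw [Complex.exp_neg, mul_inv_eq_one₀ (Complex.exp_ne_zero _)] at h2
    exact h2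
  have hM : 0 < (R + 1) * ρ := by positivity
  have hbc : ∀ z : ℂ, ‖z‖ = ρ / 2 → ‖g z‖ ≤ 2 * ((R + 1) * ρ) := by
    intro z hz
    have hzb : z ∈ Metric.ball (0 : ℂ) ρ := by rw [mem_ball_zero_iff, hz]; linarith
    have := Complex.borelCaratheodory_zero hM
      (fun w hw => (hgd w hw).differentiableAt.differentiableWithinAt) (fun w hw => by
        have h1 := norm_eval_charpolyRev_le B w
        rw [← hP, hexp w hw, Complex.norm_exp, Real.exp_le_exp] at h1
        have hw' := mem_ball_zero_iff.mp hw
        show (g w).re ≤ _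
        have : ‖w‖ * ∑ j, ∑ i, ‖B i j‖ ≤ ρ * (R + 1) := by
          apply mul_le_mul hw'.le (by linarith) (Finset.sum_nonneg fun j _ =>
            Finset.sum_nonneg fun i _ => norm_nonneg _) hρ.le
        linarith) hρ hzb hgz
    rw [hz] at this
    refine this.trans (le_of_eq ?_)
    field_simp
    ring
  have hcauchy := Complex.norm_iteratedDeriv_le_of_forall_mem_sphere_norm_le (c := 0) (N + 1)
    (R := ρ / 2) (C := 2 * ((R + 1) * ρ)) (f := g) (by positivity)
    (by
      refine (DifferentiableOn.diffContOnCl_ball (U := Metric.ball 0 ρ) (fun w hw =>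
        (hgd w hw).differentiableAt.differentiableWithinAt) ?_)
      exact Metric.closedBall_subset_ball (by linarith))
    (fun z hz => hbc z (mem_sphere_zero_iff_norm.mp hz))
  have hderiv : deriv g =ᶠ[nhds 0] (fun z =>
      (-∑ k ∈ Finset.range (N + 1), Polynomial.X ^ k *
        Polynomial.C (B ^ (k + 1)).trace : Polynomial ℂ).eval z) +
      (fun z => (Polynomial.X ^ (N + 1) : Polynomial ℂ).eval z) *
      (fun z => (-(adjRev B * (B.map Polynomial.C) ^ (N + 1 + 1)).trace).eval z / P.eval z) := by
    filter_upwards [Metric.isOpen_ball.mem_nhds (Metric.mem_ball_self hρ)] with z hz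
    rw [(hgd z hz).deriv, derivative_charpolyRev_eq_sum B (N + 1)]
    have := h0 z (mem_ball_zero_iff.mp hz)
    simp only [Pi.add_apply, Pi.mul_apply, Polynomial.eval_sub, Polynomial.eval_neg,
      Polynomial.eval_mul, ← hP]
    field_simp
    ring
  have hcd : ∀ p : Polynomial ℂ, ContDiffAt ℂ N (fun z => p.eval z) 0 :=
    fun p => p.differentiable.contDiff.contDiffAt
  have hval : iteratedDeriv (N + 1) g 0 = -(N.factorial * (B ^ (N + 1)).trace) := by
    have hcq : ContDiffAt ℂ N (fun z =>
        (-(adjRev B * (B.map Polynomial.C) ^ (N + 1 + 1)).trace).eval z / P.eval z) 0 :=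
      (hcd _).div (hcd _) (by rw [hP0]; exact one_ne_zero)
    have hm : ContDiffAt ℂ N ((fun z => (Polynomial.X ^ (N + 1) : Polynomial ℂ).eval z) *
        (fun z => (-(adjRev B * (B.map Polynomial.C) ^ (N + 1 + 1)).trace).eval z / P.eval z)) 0 :=
      (hcd _).mul hcq
    rw [iteratedDeriv_succ', hderiv.iteratedDeriv_eq, iteratedDeriv_add (hcd _) hm,
      iteratedDeriv_mul (hcd _) hcq, iteratedDeriv_eval_zero,
      Finset.sum_eq_zero (s := Finset.range (N + 1)) (M := ℂ)]
    · rw [add_zero, Polynomial.coeff_neg, Polynomial.finsetSum_coeff,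
        Finset.sum_eq_single N]
      · simp
      · intro k hk hkN
        rw [Polynomial.coeff_mul_C, Polynomial.coeff_X_pow, if_neg hkN.symm, zero_mul]
      · simp
    · intro i hi
      rw [iteratedDeriv_eval_zero, Polynomial.coeff_X_pow,
        if_neg (by have := Finset.mem_range.mp hi; omega)]
      simp
  rw [hval, norm_neg, norm_mul, Complex.norm_natCast, Nat.factorial_succ, div_pow] at hcauchy
  have hf : (0 : ℝ) < N.factorial := by positivity
  refine le_of_mul_le_mul_left (hcauchy.trans (le_of_eq ?_)) hf
  push_cast
  field_simp
  ring

section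

variable {ι : Type*} [DecidableEq ι] {B : ι → ι → ℂ}

omit [DecidableEq ι] in
lemma exists_normalized_of_eval_eq_zero (B : ι → ι → ℂ) (s : Finset ι) [DecidableEq s] (z : ℂ)
    (h : (kblock B s).charpolyRev.eval z = 0) :
    ∃ u : ι → ℂ, (∀ i, ‖u i‖ ≤ 1) ∧ (∃ i ∈ s, ‖u i‖ = 1) ∧
      ∀ i ∈ s, u i = z * ∑' j, B i j * u j := by
  classical
  rw [eval_charpolyRev_eq_det] at h
  obtain ⟨v, hv0, hv⟩ := Matrix.exists_mulVec_eq_zero_iff.mpr h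
  have hne : (Finset.univ : Finset s).Nonempty := by
    by_contra h
    rw [Finset.not_nonempty_iff_eq_empty, Finset.univ_eq_empty_iff] at h
    exact hv0 (Subsingleton.elim _ _)
  obtain ⟨m, -, hm⟩ := Finset.exists_max_image Finset.univ (fun i => ‖v i‖) hne
  have hm0 : v m ≠ 0 := by
    intro h0
    apply hv0
    funext i
    have := hm i (Finset.mem_univ i)
    rw [h0, norm_zero] at this
    exact norm_le_zero_iff.mp this
  set u : ι → ℂ := fun i => if hi : i ∈ s then v ⟨i, hi⟩ / v m else 0 with hu
  refine ⟨u, fun i => ?_, ⟨m, m.2, ?_⟩, fun i hi => ?_⟩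
  · simp only [hu]
    split_ifs with hi
    · rw [norm_div, div_le_one (norm_pos_iff.mpr hm0)]
      exact hm _ (Finset.mem_univ _)
    · simp
  · simp [hu, hm0]
  · have h1 := congrFun hv ⟨i, hi⟩
    rw [Matrix.sub_mulVec, Matrix.one_mulVec, Pi.sub_apply, Matrix.smul_mulVec, Pi.smul_apply,
      Pi.zero_apply, sub_eq_zero, smul_eq_mul] at h1
    rw [tsum_eq_sum (s := s) (fun j hj => by simp [hu, hj]),
      ← Finset.sum_coe_sort s fun j => B i j * u j]
    simp only [hu, Finset.coe_mem, dite_true, hi, Subtype.coe_eta]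
    rw [h1]
    simp only [Matrix.mulVec, dotProduct, kblock]
    rw [mul_div_assoc, Finset.sum_div]
    congr 1
    exact Finset.sum_congr rfl fun j _ => by ring

lemma eventually_eval_charpolyRev_ne_zero (hB : Summable fun p : ι × ι => ‖B p.1 p.2‖)
    (hno : ∀ (z : ℂ) (v : ι → ℂ), (∀ i, ‖v i‖ ≤ 1) → (∀ i, v i = z * ∑' j, B i j * v j) → v = 0)
    (ρ : ℝ) : ∀ᶠ s : Finset ι in Filter.atTop, ∀ z : ℂ, ‖z‖ < ρ →
      (kblock B s).charpolyRev.eval z ≠ 0 := by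
  by_contra hcon
  rw [Filter.not_eventually] at hcon
  set F := Filter.atTop ⊓ Filter.principal {s : Finset ι | ¬ ∀ z : ℂ, ‖z‖ < ρ →
      (kblock B s).charpolyRev.eval z ≠ 0} with hF
  have hNe : F.NeBot := Filter.frequently_mem_iff_neBot.mp hcon
  set 𝒰 := Ultrafilter.of F
  have hU : (𝒰 : Filter (Finset ι)) ≤ F := Ultrafilter.of_le F
  have hbad : ∀ᶠ s in (𝒰 : Filter (Finset ι)), ∃ (z : ℂ) (u : ι → ℂ), ‖z‖ ≤ ρ ∧
      (∀ i, ‖u i‖ ≤ 1) ∧ (∃ i ∈ s, ‖u i‖ = 1) ∧ ∀ i ∈ s, u i = z * ∑' j, B i j * u j := by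
    have : ∀ᶠ s in F, ¬ ∀ z : ℂ, ‖z‖ < ρ → (kblock B s).charpolyRev.eval z ≠ 0 :=
      Filter.mem_inf_of_right (Filter.mem_principal_self _)
    filter_upwards [hU this] with s hs
    push Not at hs
    obtain ⟨z, hz, h0⟩ := hs
    obtain ⟨u, hu⟩ := exists_normalized_of_eval_eq_zero B s z h0
    exact ⟨z, u, hz.le, hu⟩
  have hchoice : ∀ s : Finset ι, ∃ (z : ℂ) (u : ι → ℂ),
      (∃ (z : ℂ) (u : ι → ℂ), ‖z‖ ≤ ρ ∧
      (∀ i, ‖u i‖ ≤ 1) ∧ (∃ i ∈ s, ‖u i‖ = 1) ∧ ∀ i ∈ s, u i = z * ∑' j, B i j * u j) →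
      (‖z‖ ≤ ρ ∧
      (∀ i, ‖u i‖ ≤ 1) ∧ (∃ i ∈ s, ‖u i‖ = 1) ∧ ∀ i ∈ s, u i = z * ∑' j, B i j * u j) := by
    intro s
    by_cases h : ∃ (z : ℂ) (u : ι → ℂ), ‖z‖ ≤ ρ ∧
      (∀ i, ‖u i‖ ≤ 1) ∧ (∃ i ∈ s, ‖u i‖ = 1) ∧ ∀ i ∈ s, u i = z * ∑' j, B i j * u j
    · obtain ⟨z, u, h⟩ := h
      exact ⟨z, u, fun _ => h⟩
    · exact ⟨0, 0, fun h' => absurd h' h⟩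
  choose z u hzu using hchoice
  have hgood : ∀ᶠ s in (𝒰 : Filter (Finset ι)), ‖z s‖ ≤ ρ ∧ (∀ i, ‖u s i‖ ≤ 1) ∧
      (∃ i ∈ s, ‖u s i‖ = 1) ∧ ∀ i ∈ s, u s i = z s * ∑' j, B i j * u s j :=
    hbad.mono fun s hs => hzu s hs
  obtain ⟨z0, -, hz0⟩ := (isCompact_closedBall (0 : ℂ) ρ).ultrafilter_le_nhds (𝒰.map z)
    (by
      rw [Filter.le_principal_iff]
      exact hgood.mono fun s hs => mem_closedBall_zero_iff.mpr hs.1)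
  obtain ⟨v, hv, hv0⟩ := (isCompact_univ_pi fun _ : ι =>
    isCompact_closedBall (0 : ℂ) 1).ultrafilter_le_nhds (𝒰.map u)
    (by
      rw [Filter.le_principal_iff]
      exact hgood.mono fun s hs i _ => mem_closedBall_zero_iff.mpr (hs.2.1 i))
  have hzt : Filter.Tendsto z 𝒰 (nhds z0) := hz0
  have hut : ∀ i, Filter.Tendsto (fun s => u s i) 𝒰 (nhds (v i)) :=
    tendsto_pi_nhds.mp (show Filter.Tendsto u 𝒰 (nhds v) from hv0)
  have hat : (𝒰 : Filter (Finset ι)) ≤ Filter.atTop := hU.trans inf_le_left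
  have hvb : ∀ i, ‖v i‖ ≤ 1 := fun i => mem_closedBall_zero_iff.mp (hv i (Set.mem_univ i))
  have hv1 : v = 0 := by
    refine hno z0 v hvb fun i => ?_
    have h1 : Filter.Tendsto (fun s => z s * ∑' j, B i j * u s j) 𝒰
        (nhds (z0 * ∑' j, B i j * v j)) := by
      refine hzt.mul (tendsto_tsum_of_dominated_convergence (hB.prod_factor i)
        (fun j => (hut j).const_mul _) (hgood.mono fun s hs j => ?_))
      rw [norm_mul]
      exact mul_le_of_le_one_right (norm_nonneg _) (hs.2.1 j)
    refine tendsto_nhds_unique_of_eventuallyEq (hut i) h1 ?_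
    filter_upwards [hgood, hat (Filter.eventually_ge_atTop ({i} : Finset ι))] with s hs hi
    exact hs.2.2.2 i (hi (by simp))
  have hfin : {i | 1 ≤ ρ * ∑' j, ‖B i j‖}.Finite := by
    have h1 := (hB.prod.mul_left ρ).tendsto_cofinite_zero
    have h2 := h1.eventually (gt_mem_nhds one_pos)
    rw [Filter.eventually_cofinite] at h2
    simpa only [not_lt] using h2
  have hlim : Filter.Tendsto (fun s => ∑ i ∈ hfin.toFinset, ‖u s i‖) 𝒰
      (nhds (∑ i ∈ hfin.toFinset, ‖v i‖)) :=
    tendsto_finsetSum _ fun i _ => (hut i).norm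
  have hge : 1 ≤ ∑ i ∈ hfin.toFinset, ‖v i‖ := by
    refine ge_of_tendsto hlim (hgood.mono fun s hs => ?_)
    obtain ⟨i, his, hi⟩ := hs.2.2.1
    have hmem : i ∈ hfin.toFinset := by
      rw [Set.Finite.mem_toFinset, Set.mem_ofPred_eq, ← hi, hs.2.2.2 i his, norm_mul]
      refine mul_le_mul hs.1 ?_ (norm_nonneg _) ((norm_nonneg _).trans hs.1)
      refine tsum_of_norm_bounded (hB.prod_factor i).hasSum fun j => ?_
      rw [norm_mul]
      exact mul_le_of_le_one_right (norm_nonneg _) (hs.2.1 j)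
    exact hi.symm.le.trans <| Finset.single_le_sum (f := fun i => ‖u s i‖) (fun i _ => norm_nonneg _) hmem
  rw [hv1] at hge
  simp at hge
  linarith

/-- If there is no bounded eigenvector, the traces of the powers of order at least two vanish. -/
theorem ktr_eq_zero_of_no_eigenvector (hB : Summable fun p : ι × ι => ‖B p.1 p.2‖)
    (hno : ∀ (z : ℂ) (v : ι → ℂ), (∀ i, ‖v i‖ ≤ 1) → (∀ i, v i = z * ∑' j, B i j * v j) → v = 0)
    (n : ℕ) : ktr B (n + 2) = 0 := by
  set R := ∑' p : ι × ι, ‖B p.1 p.2‖ with hR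
  set A : ℝ := (n + 1 + 1) * (2 * (R + 1)) * 2 ^ (n + 1 + 1) with hA
  have hbound : ∀ ρ : ℝ, 0 < ρ → ‖ktr B (n + 1 + 1)‖ ≤ A / ρ ^ (n + 1) := by
    intro ρ hρ
    refine le_of_tendsto (tendsto_trace_kblock_pow hB (n + 1)).norm ?_
    filter_upwards [eventually_eval_charpolyRev_ne_zero hB hno ρ] with s hs
    have := norm_trace_pow_le (kblock B s) R ρ (sum_kblock_le hB s) hρ hs (n + 1)
    push_cast at this
    exact this
  have hlim : Filter.Tendsto (fun ρ : ℝ => A / ρ ^ (n + 1)) Filter.atTop (nhds 0) :=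
    tendsto_const_nhds.div_atTop (Filter.tendsto_pow_atTop (Nat.succ_ne_zero n))
  have := ge_of_tendsto hlim (by
    filter_upwards [Filter.eventually_gt_atTop (0 : ℝ)] with ρ hρ
    exact hbound ρ hρ)
  exact norm_le_zero_iff.mp this

end

/-! ### Integrals of products of simple fractions over the real line -/

lemma ofReal_sub_ne_zero {w : ℂ} (hw : w.im ≠ 0) (s : ℝ) : (s : ℂ) - w ≠ 0 := by
  intro h
  have := congrArg Complex.im h
  simp at this
  exact hw this

lemma continuous_inv_sub {w : ℂ} (hw : w.im ≠ 0) : Continuous fun s : ℝ => ((s : ℂ) - w)⁻¹ :=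
  (by fun_prop : Continuous fun s : ℝ => (s : ℂ) - w).inv₀ (ofReal_sub_ne_zero hw)

lemma integrable_norm_inv_sub_sq {w : ℂ} (hw : w.im ≠ 0) :
    Integrable fun s : ℝ => ‖((s : ℂ) - w)⁻¹‖ ^ 2 := by
  have hy : 0 < w.im ^ 2 := by positivity
  refine ((integrable_inv_one_add_sq).const_mul (2 + (1 + 2 * w.re ^ 2) / w.im ^ 2)).mono'
    (((continuous_inv_sub hw).norm.pow 2).aestronglyMeasurable) (Filter.Eventually.of_forall ?_)
  intro s
  have h1 : ‖(s : ℂ) - w‖ ^ 2 = (s - w.re) ^ 2 + w.im ^ 2 := by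
    rw [Complex.sq_norm, Complex.normSq_apply]
    simp
    ring
  have h2 : 0 < (s - w.re) ^ 2 + w.im ^ 2 := by positivity
  rw [norm_inv, inv_pow, h1, Real.norm_eq_abs, abs_of_pos (by positivity), ← div_eq_mul_inv,
    inv_eq_one_div, div_le_div_iff₀ h2 (by positivity)]
  have h3 : (2 + (1 + 2 * w.re ^ 2) / w.im ^ 2) * ((s - w.re) ^ 2 + w.im ^ 2) =
      2 * (s - w.re) ^ 2 + 2 * w.im ^ 2 + (1 + 2 * w.re ^ 2) +
        (1 + 2 * w.re ^ 2) * ((s - w.re) ^ 2 / w.im ^ 2) := by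
    field_simp
    ring
  have h4 : 0 ≤ (1 + 2 * w.re ^ 2) * ((s - w.re) ^ 2 / w.im ^ 2) := by positivity
  nlinarith [sq_nonneg (s - 2 * w.re)]

lemma integrable_inv_sub_mul_inv_sub {w w' : ℂ} (hw : w.im ≠ 0) (hw' : w'.im ≠ 0) :
    Integrable fun s : ℝ => ((s : ℂ) - w)⁻¹ * ((s : ℂ) - w')⁻¹ := by
  refine ((integrable_norm_inv_sub_sq hw).add (integrable_norm_inv_sub_sq hw')).mono'
    ((continuous_inv_sub hw).mul (continuous_inv_sub hw')).aestronglyMeasurable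
    (Filter.Eventually.of_forall fun s => ?_)
  rw [norm_mul, Pi.add_apply]
  nlinarith [two_mul_le_add_sq ‖((s : ℂ) - w)⁻¹‖ ‖((s : ℂ) - w')⁻¹‖,
    norm_nonneg ((s : ℂ) - w)⁻¹, norm_nonneg ((s : ℂ) - w')⁻¹]

lemma norm_inv_sub_le {w : ℂ} (hw : w.im ≠ 0) (s : ℝ) : ‖((s : ℂ) - w)⁻¹‖ ≤ |w.im|⁻¹ := by
  rw [norm_inv]
  refine inv_anti₀ (abs_pos.mpr hw) ?_
  have := Complex.abs_im_le_norm ((s : ℂ) - w)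
  simpa using this

/-- The product of the simple fractions with poles in `M`. -/
def fracProd (M : Multiset ℂ) (s : ℝ) : ℂ := (M.map fun w => ((s : ℂ) - w)⁻¹).prod

lemma fracProd_cons (w : ℂ) (M : Multiset ℂ) (s : ℝ) :
    fracProd (w ::ₘ M) s = ((s : ℂ) - w)⁻¹ * fracProd M s := by
  simp [fracProd]

lemma fracProd_zero (s : ℝ) : fracProd 0 s = 1 := by simp [fracProd]

lemma fracProd_replicate (n : ℕ) (w : ℂ) :
    fracProd (Multiset.replicate n w) = fun s : ℝ => ((s : ℂ) - w)⁻¹ ^ n := by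
  funext s
  rw [fracProd, Multiset.map_replicate, Multiset.prod_replicate]

lemma integrable_fracProd {M : Multiset ℂ} (hM : 2 ≤ M.card) (h : ∀ w ∈ M, w.im ≠ 0) :
    Integrable (fracProd M) := by
  induction M using Multiset.induction with
  | empty => simp at hM
  | cons w M ih =>
    have hw := h w (Multiset.mem_cons_self w M)
    have hM' : ∀ x ∈ M, x.im ≠ 0 := fun x hx => h x (Multiset.mem_cons_of_mem hx)
    rw [funext (fracProd_cons w M)]
    by_cases h2 : 2 ≤ M.card
    · exact (ih h2 hM').bdd_mul (continuous_inv_sub hw).aestronglyMeasurable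
        (Filter.Eventually.of_forall (norm_inv_sub_le hw))
    · have : M.card = 1 := by
        rw [Multiset.card_cons] at hM
        omega
      obtain ⟨w', rfl⟩ := Multiset.card_eq_one.mp this
      have := integrable_inv_sub_mul_inv_sub hw (hM' w' (by simp))
      simpa [fracProd] using this

lemma tendsto_integral_inv_sub {w c : ℂ} (hc : c ∈ slitPlane) (hc' : -c ∈ slitPlane)
    (hw : ∀ s : ℝ, c * (s - w) ∈ slitPlane) :
    Filter.Tendsto (fun R : ℝ => ∫ s in (-R)..R, ((s : ℂ) - w)⁻¹) Filter.atTop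
      (nhds (Complex.log c - Complex.log (-c))) := by
  have hc0 : c ≠ 0 := slitPlane_ne_zero hc
  have hne : ∀ s : ℝ, (s : ℂ) - w ≠ 0 := fun s h => by
    have := hw s
    rw [h, mul_zero] at this
    exact slitPlane_ne_zero this rfl
  have hint : ∀ R : ℝ, ∫ s in (-R)..R, ((s : ℂ) - w)⁻¹ =
      Complex.log (c * (R - w)) - Complex.log (c * ((-R : ℝ) - w)) := by
    intro R
    refine intervalIntegral.integral_eq_sub_of_hasDerivAt
      (f := fun s : ℝ => Complex.log (c * (s - w))) (fun s _ => ?_) ?_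
    · have h1 : HasDerivAt (fun s : ℝ => c * ((s : ℂ) - w)) (c * 1) s :=
        ((Complex.ofRealCLM.hasDerivAt.sub_const w)).const_mul c
      refine (h1.clog_real (hw s)).congr_deriv ?_
      have := hne s
      field_simp
    · exact ((by fun_prop : Continuous fun s : ℝ => (s : ℂ) - w).inv₀ hne).intervalIntegrable _ _
  have hlim : ∀ σ : ℂ, c * σ ∈ slitPlane → Filter.Tendsto
      (fun R : ℝ => Complex.log (c * (σ - (R : ℂ)⁻¹ * w))) Filter.atTop
      (nhds (Complex.log (c * σ))) := by
    intro σ hσ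
    have h0 : Filter.Tendsto (fun R : ℝ => (R : ℂ)⁻¹) Filter.atTop (nhds 0) := by
      have := (Complex.continuous_ofReal.tendsto 0).comp tendsto_inv_atTop_zero
      simpa [Function.comp_def] using this
    have h1 : Filter.Tendsto (fun R : ℝ => c * (σ - (R : ℂ)⁻¹ * w)) Filter.atTop
        (nhds (c * (σ - 0 * w))) := (tendsto_const_nhds.sub (h0.mul_const w)).const_mul c
    rw [zero_mul, sub_zero] at h1
    exact h1.clog hσ
  have h := (hlim 1 (by simpa using hc)).sub (hlim (-1) (by simpa using hc'))
  rw [mul_one, mul_neg_one] at h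
  refine h.congr' ?_
  filter_upwards [Filter.eventually_gt_atTop (0 : ℝ)] with R hR
  have hR' : (R : ℂ) ≠ 0 := by exact_mod_cast hR.ne'
  have e1 : c * ((R : ℂ) - w) = R * (c * (1 - (R : ℂ)⁻¹ * w)) := by
    field_simp
  have e2 : c * (((-R : ℝ) : ℂ) - w) = R * (c * (-1 - (R : ℂ)⁻¹ * w)) := by
    push_cast
    field_simp
  have n1 := slitPlane_ne_zero (hw R)
  have n2 := slitPlane_ne_zero (hw (-R))
  rw [e1] at n1
  rw [e2] at n2
  rw [hint, e1, e2, Complex.log_ofReal_mul hR (right_ne_zero_of_mul n1),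
    Complex.log_ofReal_mul hR (right_ne_zero_of_mul n2)]
  ring

lemma tendsto_integral_inv_sub_of_im_pos {w : ℂ} (hw : 0 < w.im) :
    Filter.Tendsto (fun R : ℝ => ∫ s in (-R)..R, ((s : ℂ) - w)⁻¹) Filter.atTop
      (nhds (Real.pi * I)) := by
  have h := tendsto_integral_inv_sub (w := w) (c := I) (by simp [mem_slitPlane_iff])
    (by simp [mem_slitPlane_iff])
    (fun s => by left; simpa using hw)
  convert h using 2
  rw [Complex.log_I, Complex.log_neg_I]
  ring

lemma tendsto_integral_inv_sub_of_im_neg {w : ℂ} (hw : w.im < 0) :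
    Filter.Tendsto (fun R : ℝ => ∫ s in (-R)..R, ((s : ℂ) - w)⁻¹) Filter.atTop
      (nhds (-(Real.pi * I))) := by
  have h := tendsto_integral_inv_sub (w := w) (c := -I) (by simp [mem_slitPlane_iff])
    (by simp [mem_slitPlane_iff])
    (fun s => by left; simpa using hw)
  convert h using 2
  rw [neg_neg, Complex.log_I, Complex.log_neg_I]
  ring

lemma inv_mul_inv_eq {x y : ℂ} {s : ℂ} (hxy : x ≠ y) (hx : s - x ≠ 0) (hy : s - y ≠ 0) :
    (s - x)⁻¹ * (s - y)⁻¹ = (x - y)⁻¹ * ((s - x)⁻¹ - (s - y)⁻¹) := by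
  have := sub_ne_zero.mpr hxy
  field_simp
  ring

lemma integral_inv_sub_mul_inv_sub {x y a b : ℂ} (hxy : x ≠ y) (hx : x.im ≠ 0) (hy : y.im ≠ 0)
    (ha : Filter.Tendsto (fun R : ℝ => ∫ s in (-R)..R, ((s : ℂ) - x)⁻¹) Filter.atTop (nhds a))
    (hb : Filter.Tendsto (fun R : ℝ => ∫ s in (-R)..R, ((s : ℂ) - y)⁻¹) Filter.atTop (nhds b)) :
    ∫ s : ℝ, ((s : ℂ) - x)⁻¹ * ((s : ℂ) - y)⁻¹ = (x - y)⁻¹ * (a - b) := by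
  have h1 := intervalIntegral_tendsto_integral (integrable_inv_sub_mul_inv_sub hx hy)
    Filter.tendsto_neg_atTop_atBot Filter.tendsto_id
  refine tendsto_nhds_unique h1 (((ha.sub hb).const_mul _).congr fun R => ?_)
  rw [← intervalIntegral.integral_sub ((continuous_inv_sub hx).intervalIntegrable _ _)
    ((continuous_inv_sub hy).intervalIntegrable _ _), ← intervalIntegral.integral_const_mul]
  exact intervalIntegral.integral_congr fun s _ =>
    (inv_mul_inv_eq hxy (ofReal_sub_ne_zero hx s) (ofReal_sub_ne_zero hy s)).symm

lemma tendsto_inv_sub_cobounded (w : ℂ) :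
    Filter.Tendsto (fun s : ℝ => ((s : ℂ) - w)⁻¹) (Bornology.cobounded ℝ) (nhds 0) := by
  refine Filter.tendsto_inv₀_cobounded.comp ?_
  rw [← tendsto_norm_atTop_iff_cobounded]
  refine Filter.tendsto_atTop_mono (f := fun s : ℝ => ‖s‖ - ‖w‖) (fun s => ?_)
    (Filter.tendsto_atTop_add_const_right _ _ tendsto_norm_cobounded_atTop)
  have := norm_sub_norm_le (s : ℂ) w
  rwa [Complex.norm_real] at this

lemma integral_inv_sub_pow {w : ℂ} (hw : w.im ≠ 0) (n : ℕ) :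
    ∫ s : ℝ, ((s : ℂ) - w)⁻¹ ^ (n + 2) = 0 := by
  have hlim : ∀ l ≤ Bornology.cobounded ℝ, Filter.Tendsto
      (fun s : ℝ => -((n + 1 : ℂ)⁻¹) * ((s : ℂ) - w)⁻¹ ^ (n + 1)) l (nhds 0) := by
    intro l hl
    have := (((tendsto_inv_sub_cobounded w).mono_left hl).pow (n + 1)).const_mul (-((n + 1 : ℂ)⁻¹))
    simpa using this
  have hderiv : ∀ s : ℝ, HasDerivAt (fun s : ℝ => -((n + 1 : ℂ)⁻¹) * ((s : ℂ) - w)⁻¹ ^ (n + 1))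
      (((s : ℂ) - w)⁻¹ ^ (n + 2)) s := by
    intro s
    have h1 : HasDerivAt (fun s : ℝ => (s : ℂ) - w) 1 s := Complex.ofRealCLM.hasDerivAt.sub_const w
    have h0 := ofReal_sub_ne_zero hw s
    have hn : (n + 1 : ℂ) ≠ 0 := by exact_mod_cast n.succ_ne_zero
    refine (((h1.inv h0).pow (n + 1)).const_mul (-((n + 1 : ℂ)⁻¹))).congr_deriv ?_
    simp only [Pi.inv_apply, Nat.add_sub_cancel]
    push_cast
    rw [div_eq_mul_inv, ← inv_pow]
    generalize ((s : ℂ) - w)⁻¹ = x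
    field_simp
    ring
  have hint : Integrable fun s : ℝ => ((s : ℂ) - w)⁻¹ ^ (n + 2) := by
    have := integrable_fracProd (M := Multiset.replicate (n + 2) w) (by simp)
      (fun x hx => by rwa [Multiset.eq_of_mem_replicate hx])
    rwa [fracProd_replicate] at this
  have := integral_of_hasDerivAt_of_tendsto hderiv hint
    (hlim _ (by rw [IsOrderBornology.cobounded_eq]; exact le_sup_left))
    (hlim _ (by rw [IsOrderBornology.cobounded_eq]; exact le_sup_right))
  rw [this, sub_zero]

lemma integral_fracProd_mem (V : Submodule 𝔸 ℂ) {W : Set ℂ}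
    (hW : ∀ w ∈ W, w.im ≠ 0 ∧ IsAlgebraic ℚ w)
    (hV : ∀ x ∈ W, ∀ y ∈ W, x ≠ y → ∫ s : ℝ, ((s : ℂ) - x)⁻¹ * ((s : ℂ) - y)⁻¹ ∈ V)
    (n : ℕ) : ∀ M : Multiset ℂ, M.card = n + 2 → (∀ w ∈ M, w ∈ W) →
      ∫ s : ℝ, fracProd M s ∈ V := by
  induction n with
  | zero =>
    intro M hM hMW
    obtain ⟨x, y, rfl⟩ := Multiset.card_eq_two.mp hM
    by_cases hxy : x = y
    · subst hxy
      have := integral_inv_sub_pow (hW x (hMW x (by simp))).1 0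
      have h2 : ∫ s : ℝ, fracProd {x, x} s = 0 := by
        rw [← this]
        simp [fracProd, pow_two]
      rw [h2]
      exact V.zero_mem
    · simpa [fracProd] using hV x (hMW x (by simp)) y (hMW y (by simp)) hxy
  | succ n ih =>
    intro M hM hMW
    obtain ⟨x, hx⟩ := Multiset.card_pos_iff_exists_mem.mp (by omega : 0 < M.card)
    by_cases hall : ∀ y ∈ M, y = x
    · have h2 : ∫ s : ℝ, fracProd M s = 0 := by
        rw [Multiset.eq_replicate_card.mpr hall, hM, fracProd_replicate]
        exact integral_inv_sub_pow (hW x (hMW x hx)).1 (n + 1)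
      rw [h2]
      exact V.zero_mem
    · push Not at hall
      obtain ⟨y, hy, hyx⟩ := hall
      obtain ⟨M', rfl⟩ := Multiset.exists_cons_of_mem hx
      have hy' : y ∈ M' := (Multiset.mem_cons.mp hy).resolve_left hyx
      obtain ⟨L, rfl⟩ := Multiset.exists_cons_of_mem hy'
      have hWx := hMW x (by simp)
      have hWy := hMW y (by simp)
      have hL : L.card = n + 1 := by simpa using hM
      have hLW : ∀ w ∈ L, w ∈ W := fun w hw => hMW w (by simp [hw])
      have hxL : ∀ w ∈ x ::ₘ L, w ∈ W := fun w hw => hMW w (by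
        rcases Multiset.mem_cons.mp hw with h | h <;> simp [h])
      have hyL : ∀ w ∈ y ::ₘ L, w ∈ W := fun w hw => hMW w (by
        rcases Multiset.mem_cons.mp hw with h | h <;> simp [h])
      have i1 : Integrable (fracProd (x ::ₘ L)) :=
        integrable_fracProd (by simp; omega) fun w hw => (hW w (hxL w hw)).1
      have i2 : Integrable (fracProd (y ::ₘ L)) :=
        integrable_fracProd (by simp; omega) fun w hw => (hW w (hyL w hw)).1
      have heq : ∫ s : ℝ, fracProd (x ::ₘ y ::ₘ L) s = (x - y)⁻¹ *
          ((∫ s : ℝ, fracProd (x ::ₘ L) s) - ∫ s : ℝ, fracProd (y ::ₘ L) s) := by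
        rw [← integral_sub i1 i2, ← integral_const_mul]
        congr 1
        funext s
        simp only [fracProd_cons]
        rw [← mul_assoc, inv_mul_inv_eq hyx.symm (ofReal_sub_ne_zero (hW x hWx).1 s)
          (ofReal_sub_ne_zero (hW y hWy).1 s)]
        ring
      rw [heq]
      exact V.smul_mem (⟨(x - y)⁻¹, inv_mem (sub_mem (mem_𝔸.mpr (hW x hWx).2)
        (mem_𝔸.mpr (hW y hWy).2))⟩ : 𝔸) (V.sub_mem (ih _ (by simp [hL]) hxL) (ih _ (by simp [hL]) hyL))

/-- The span over the algebraic numbers of the products of `m` simple fractions with poles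
in `W`. -/
def fracSpan (W : Set ℂ) (m : ℕ) : Submodule 𝔸 (ℝ → ℂ) :=
  Submodule.span 𝔸 {g | ∃ M : Multiset ℂ, M.card = m ∧ (∀ w ∈ M, w ∈ W) ∧ g = fracProd M}

lemma one_mem_fracSpan (W : Set ℂ) : (fun _ => 1) ∈ fracSpan W 0 :=
  Submodule.subset_span ⟨0, rfl, by simp, funext fun s => (fracProd_zero s).symm⟩

lemma inv_sub_mul_mem_fracSpan {W : Set ℂ} {m : ℕ} {w : ℂ} (hw : w ∈ W) {g : ℝ → ℂ}
    (hg : g ∈ fracSpan W m) : (fun s : ℝ => ((s : ℂ) - w)⁻¹ * g s) ∈ fracSpan W (m + 1) := by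
  induction hg using Submodule.span_induction with
  | mem g hg =>
    obtain ⟨M, hM, hMW, rfl⟩ := hg
    refine Submodule.subset_span ⟨w ::ₘ M, by simp [hM], ?_, ?_⟩
    · intro x hx
      rcases Multiset.mem_cons.mp hx with h | h
      · exact h ▸ hw
      · exact hMW x h
    · exact funext fun s => (fracProd_cons w M s).symm
  | zero =>
    simp only [Pi.zero_apply, mul_zero]
    exact (fracSpan W (m + 1)).zero_mem
  | add g h _ _ hg hh =>
    convert (fracSpan W (m + 1)).add_mem hg hh using 1
    funext s
    simp [mul_add]
  | smul c g _ hg =>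
    convert (fracSpan W (m + 1)).smul_mem c hg using 1
    funext s
    simp only [Pi.smul_apply, Algebra.smul_def]
    ring

lemma integrable_of_mem_fracSpan {W : Set ℂ} (hW : ∀ w ∈ W, w.im ≠ 0) {m : ℕ} (hm : 2 ≤ m)
    {g : ℝ → ℂ} (hg : g ∈ fracSpan W m) : Integrable g := by
  induction hg using Submodule.span_induction with
  | mem g hg =>
    obtain ⟨M, hM, hMW, rfl⟩ := hg
    exact integrable_fracProd (hM ▸ hm) fun w hw => hW w (hMW w hw)
  | zero => exact integrable_zero _ _ _
  | add g h _ _ hg hh => exact hg.add hh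
  | smul c g _ hg => exact hg.const_mul (c : ℂ)

lemma integral_mem_of_mem_fracSpan (V : Submodule 𝔸 ℂ) {W : Set ℂ}
    (hW : ∀ w ∈ W, w.im ≠ 0 ∧ IsAlgebraic ℚ w)
    (hV : ∀ x ∈ W, ∀ y ∈ W, x ≠ y → ∫ s : ℝ, ((s : ℂ) - x)⁻¹ * ((s : ℂ) - y)⁻¹ ∈ V)
    {m : ℕ} (hm : 2 ≤ m) {g : ℝ → ℂ} (hg : g ∈ fracSpan W m) : ∫ s, g s ∈ V := by
  have hW' : ∀ w ∈ W, w.im ≠ 0 := fun w hw => (hW w hw).1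
  obtain ⟨n, rfl⟩ := Nat.exists_eq_add_of_le' hm
  induction hg using Submodule.span_induction with
  | mem g hg =>
    obtain ⟨M, hM, hMW, rfl⟩ := hg
    exact integral_fracProd_mem V hW hV n M hM hMW
  | zero => simp
  | add g h hg' hh' hg hh =>
    have := integral_add (integrable_of_mem_fracSpan hW' hm hg')
      (integrable_of_mem_fracSpan hW' hm hh')
    simp only [Pi.add_apply]
    rw [this]
    exact V.add_mem hg hh
  | smul c g hg' hg =>
    have : ∫ s, (c • g) s = c • ∫ s, g s := integral_const_mul (c : ℂ) g
    rw [this]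
    exact V.smul_mem c hg

/-- `π` times the algebraic numbers. -/
def piSpan : Submodule 𝔸 ℂ := Submodule.span 𝔸 {(Real.pi : ℂ)}

lemma mem_piSpan {z : ℂ} : z ∈ piSpan ↔ ∃ y ∈ 𝔸, z = Real.pi * y := by
  rw [piSpan, Submodule.mem_span_singleton]
  constructor
  · rintro ⟨a, rfl⟩
    exact ⟨a, a.2, mul_comm _ _⟩
  · rintro ⟨y, hy, rfl⟩
    exact ⟨⟨y, hy⟩, mul_comm _ _⟩

lemma integral_mem_piSpan {W : Set ℂ} (hW : ∀ w ∈ W, w.im ≠ 0 ∧ IsAlgebraic ℚ w)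
    {m : ℕ} (hm : 2 ≤ m) {g : ℝ → ℂ} (hg : g ∈ fracSpan W m) : ∫ s, g s ∈ piSpan := by
  have hI : I ∈ 𝔸 := mem_𝔸.mpr ⟨Polynomial.X ^ 2 + 1, by
    intro h
    have := congrArg (Polynomial.eval 0) h
    simp at this, by simp⟩
  have key : ∀ w ∈ W, ∃ ε ∈ 𝔸, Filter.Tendsto
      (fun R : ℝ => ∫ s in (-R)..R, ((s : ℂ) - w)⁻¹) Filter.atTop (nhds (Real.pi * ε)) := by
    intro w hw
    rcases lt_or_gt_of_ne (hW w hw).1 with h | h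
    · exact ⟨-I, neg_mem hI, by simpa using tendsto_integral_inv_sub_of_im_neg h⟩
    · exact ⟨I, hI, tendsto_integral_inv_sub_of_im_pos h⟩
  refine integral_mem_of_mem_fracSpan _ hW (fun x hx y hy hxy => ?_) hm hg
  obtain ⟨ε, hε, h1⟩ := key x hx
  obtain ⟨ε', hε', h2⟩ := key y hy
  rw [integral_inv_sub_mul_inv_sub hxy (hW x hx).1 (hW y hy).1 h1 h2, mem_piSpan]
  exact ⟨(x - y)⁻¹ * (ε - ε'), mul_mem (inv_mem (sub_mem (mem_𝔸.mpr (hW x hx).2)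
    (mem_𝔸.mpr (hW y hy).2))) (sub_mem hε hε'), by ring⟩

lemma integral_eq_zero_of_im_pos {W : Set ℂ} (hW : ∀ w ∈ W, 0 < w.im ∧ IsAlgebraic ℚ w)
    {m : ℕ} (hm : 2 ≤ m) {g : ℝ → ℂ} (hg : g ∈ fracSpan W m) : ∫ s, g s = 0 := by
  refine (Submodule.mem_bot 𝔸).mp (integral_mem_of_mem_fracSpan ⊥
    (fun w hw => ⟨(hW w hw).1.ne', (hW w hw).2⟩) (fun x hx y hy hxy => ?_) hm hg)
  rw [integral_inv_sub_mul_inv_sub hxy (hW x hx).1.ne' (hW y hy).1.ne'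
    (tendsto_integral_inv_sub_of_im_pos (hW x hx).1)
    (tendsto_integral_inv_sub_of_im_pos (hW y hy).1), sub_self, mul_zero]
  rfl

lemma integral_eq_zero_of_im_neg {W : Set ℂ} (hW : ∀ w ∈ W, w.im < 0 ∧ IsAlgebraic ℚ w)
    {m : ℕ} (hm : 2 ≤ m) {g : ℝ → ℂ} (hg : g ∈ fracSpan W m) : ∫ s, g s = 0 := by
  refine (Submodule.mem_bot 𝔸).mp (integral_mem_of_mem_fracSpan ⊥
    (fun w hw => ⟨(hW w hw).1.ne, (hW w hw).2⟩) (fun x hx y hy hxy => ?_) hm hg)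
  rw [integral_inv_sub_mul_inv_sub hxy (hW x hx).1.ne (hW y hy).1.ne
    (tendsto_integral_inv_sub_of_im_neg (hW x hx).1)
    (tendsto_integral_inv_sub_of_im_neg (hW y hy).1), sub_self, mul_zero]
  rfl

/-! ### The Eisenstein lattice -/

lemma ω_re : ω.re = -1 / 2 := by
  have : (2 * Real.pi * I / 3 : ℂ) = ((Real.pi - Real.pi / 3 : ℝ) : ℂ) * I := by
    push_cast
    ring
  rw [ω, this, Complex.exp_ofReal_mul_I_re, Real.cos_pi_sub, Real.cos_pi_div_three]
  norm_num

lemma ω_im : ω.im = √3 / 2 := by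
  have : (2 * Real.pi * I / 3 : ℂ) = ((Real.pi - Real.pi / 3 : ℝ) : ℂ) * I := by
    push_cast
    ring
  rw [ω, this, Complex.exp_ofReal_mul_I_im, Real.sin_pi_sub, Real.sin_pi_div_three]

lemma sq_sqrt_three : √3 ^ 2 = (3 : ℝ) := Real.sq_sqrt (by norm_num)

lemma ω_sq : ω ^ 2 = -1 - ω := by
  apply Complex.ext
  · simp [pow_two, ω_re, ω_im]
    nlinarith [sq_sqrt_three]
  · simp [pow_two, ω_re, ω_im]
    ring

lemma ω_cube : ω ^ 3 = 1 := by
  linear_combination (ω - 1) * ω_sq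

lemma ω_ne_one : ω ≠ 1 := by
  intro h
  have := ω_re
  rw [h] at this
  norm_num at this

lemma ω_ne_zero : ω ≠ 0 := by
  intro h
  have := ω_cube
  rw [h] at this
  norm_num at this

lemma norm_ω : ‖ω‖ = 1 := by
  have h : ‖ω‖ ^ 3 = 1 := by rw [← norm_pow, ω_cube, norm_one]
  exact (pow_eq_one_iff_of_nonneg (norm_nonneg _) (by norm_num)).mp h

/-- The embedding of `ℤ × ℤ` as the lattice `ℤω + ℤ`. -/
def emb (i : ℤ × ℤ) : ℂ := i.1 * ω + i.2

/-- Multiplication by `ω` on the lattice. -/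
def rot (i : ℤ × ℤ) : ℤ × ℤ := (i.2 - i.1, -i.1)

/-- The class of a lattice vector modulo `√-3`. -/
def cls (i : ℤ × ℤ) : ZMod 3 := (i.1 + i.2 : ℤ)

lemma emb_add (i j : ℤ × ℤ) : emb (i + j) = emb i + emb j := by
  simp [emb]; ring

lemma emb_sub (i j : ℤ × ℤ) : emb (i - j) = emb i - emb j := by
  simp [emb]; ring

lemma emb_neg (i : ℤ × ℤ) : emb (-i) = -emb i := by
  simp [emb]; ring

lemma emb_zero : emb 0 = 0 := by simp [emb]

lemma emb_rot (i : ℤ × ℤ) : emb (rot i) = ω * emb i := by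
  simp only [emb, rot]
  push_cast
  linear_combination (-i.1 : ℂ) * ω_sq

lemma rot_neg (i : ℤ × ℤ) : rot (-i) = -rot i := by
  ext <;> (simp [rot]; try ring)

lemma rot_sub (i j : ℤ × ℤ) : rot (i - j) = rot i - rot j := by
  ext <;> simp [rot] <;> ring

lemma rot_zero : rot 0 = 0 := by simp [rot]

lemma rot_rot_rot (i : ℤ × ℤ) : rot (rot (rot i)) = i := by
  ext <;> simp only [rot] <;> ring

lemma cls_add (i j : ℤ × ℤ) : cls (i + j) = cls i + cls j := by
  simp [cls]; ring

lemma cls_sub (i j : ℤ × ℤ) : cls (i - j) = cls i - cls j := by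
  simp [cls]; ring

lemma cls_zero : cls 0 = 0 := by simp [cls]

lemma cls_rot (i : ℤ × ℤ) : cls (rot i) = cls i := by
  have h : i.2 - i.1 + -i.1 = i.1 + i.2 + (-3 * i.1) := by ring
  rw [cls, rot, h]
  push_cast
  have : (3 : ZMod 3) = 0 := rfl
  rw [this]
  simp [cls]

lemma emb_im (i : ℤ × ℤ) : (emb i).im = i.1 * (√3 / 2) := by
  simp [emb, ω_im]

lemma emb_re (i : ℤ × ℤ) : (emb i).re = i.2 - i.1 / 2 := by
  simp [emb, ω_re]; ring

lemma sq_norm_emb (i : ℤ × ℤ) : ‖emb i‖ ^ 2 = i.1 ^ 2 - i.1 * i.2 + i.2 ^ 2 := by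
  rw [Complex.sq_norm, Complex.normSq_apply, emb_re, emb_im]
  linear_combination ((i.1 : ℝ) ^ 2 / 4) * sq_sqrt_three

lemma norm_le_two_mul_norm_emb (i : ℤ × ℤ) : ‖i‖ ≤ 2 * ‖emb i‖ := by
  have h := sq_norm_emb i
  rw [Prod.norm_def, max_le_iff, Int.norm_eq_abs, Int.norm_eq_abs]
  constructor <;>
  · refine abs_le_of_sq_le_sq ?_ (by positivity)
    nlinarith [sq_nonneg ((i.1 : ℝ) - 2 * i.2), sq_nonneg ((i.2 : ℝ) - 2 * i.1), sq_nonneg (i.1 : ℝ),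
      sq_nonneg (i.2 : ℝ)]

lemma emb_eq_zero {i : ℤ × ℤ} : emb i = 0 ↔ i = 0 := by
  constructor
  · intro h
    have := norm_le_two_mul_norm_emb i
    rw [h, norm_zero, mul_zero] at this
    exact norm_le_zero_iff.mp this
  · rintro rfl
    exact emb_zero

lemma emb_injective : Function.Injective emb := fun i j h => by
  rw [← sub_eq_zero, ← emb_eq_zero, emb_sub, h, sub_self]

lemma finite_norm_emb_le (r : ℝ) : {i : ℤ × ℤ | ‖emb i‖ ≤ r}.Finite := by
  refine (isCompact_iff_finite.mp (isCompact_closedBall (0 : ℤ × ℤ) (2 * r))).subset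
    (fun i hi => mem_closedBall_zero_iff.mpr ?_)
  exact (norm_le_two_mul_norm_emb i).trans (mul_le_mul_of_nonneg_left hi zero_le_two)

/-- The weight `1 + |q|` on the lattice. -/
def wt (i : ℤ × ℤ) : ℝ := 1 + ‖emb i‖

lemma one_le_wt (i : ℤ × ℤ) : 1 ≤ wt i := by
  have := norm_nonneg (emb i)
  rw [wt]
  linarith

lemma wt_pos (i : ℤ × ℤ) : 0 < wt i := one_pos.trans_le (one_le_wt i)

lemma wt_le_mul (i d : ℤ × ℤ) : wt i ≤ wt (i - d) * wt d := by
  have h : ‖emb i‖ ≤ ‖emb (i - d)‖ + ‖emb d‖ := by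
    rw [emb_sub]
    simpa using norm_add_le (emb i - emb d) (emb d)
  have := mul_nonneg (norm_nonneg (emb (i - d))) (norm_nonneg (emb d))
  simp only [wt]
  nlinarith

lemma summable_wt_pow {n : ℕ} (hn : 3 ≤ n) (A : ℝ) : Summable fun i : ℤ × ℤ => A / wt i ^ n := by
  have h1 : Summable fun i : ℤ × ℤ => ‖i‖ ^ (-3 : ℝ) := by
    rw [← (finTwoArrowEquiv ℤ).summable_iff]
    refine (EisensteinSeries.summable_one_div_norm_rpow (k := 3) (by norm_num)).congr fun x => ?_
    congr 1
    refine le_antisymm ((pi_norm_le_iff_of_nonneg (norm_nonneg _)).mpr fun k => ?_)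
      (max_le (norm_le_pi_norm x 0) (norm_le_pi_norm x 1))
    fin_cases k
    · exact le_max_left _ _
    · exact le_max_right _ _
  refine Summable.of_norm_bounded_eventually (h1.mul_left (|A| * 8)) ?_
  have h0 : ({0} : Set (ℤ × ℤ))ᶜ ∈ Filter.cofinite := by simp
  filter_upwards [h0] with i hi
  have hi0 : 0 < ‖i‖ := norm_pos_iff.mpr hi
  have h2 : ‖i‖ ≤ 2 * wt i := by
    have := norm_le_two_mul_norm_emb i
    rw [wt]
    linarith
  have h3 : ‖i‖ ^ (-3 : ℝ) = (‖i‖ ^ 3)⁻¹ := by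
    rw [Real.rpow_neg hi0.le]
    norm_cast
  have h4 : ‖i‖ ^ 3 ≤ 8 * wt i ^ n := calc
    ‖i‖ ^ 3 ≤ (2 * wt i) ^ 3 := pow_le_pow_left₀ hi0.le h2 3
    _ = 8 * wt i ^ 3 := by ring
    _ ≤ 8 * wt i ^ n := by gcongr; exact one_le_wt i
  rw [h3, norm_div, Real.norm_eq_abs, norm_pow, Real.norm_of_nonneg (wt_pos i).le,
    ← div_eq_mul_inv, div_le_div_iff₀ (pow_pos (wt_pos i) n) (by positivity)]
  nlinarith [abs_nonneg A]

/-- A uniform lower bound away from the poles. -/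
lemma exists_wt_le {Y : Set (ℤ × ℤ)} {𝒦 : Set ℂ} (h𝒦 : IsCompact 𝒦)
    (h : ∀ i ∈ Y, ∀ κ ∈ 𝒦, emb i + κ ≠ 0) :
    ∃ c : ℝ, 0 < c ∧ ∀ i ∈ Y, ∀ κ ∈ 𝒦, c * wt i ≤ ‖emb i + κ‖ := by
  obtain ⟨ρ, hρ⟩ := h𝒦.isBounded.exists_norm_le
  have hfin := finite_norm_emb_le (1 + 2 * |ρ|)
  have h1 : ∀ i ∈ {i | ‖emb i‖ ≤ 1 + 2 * |ρ|}, ∀ᶠ c in nhdsWithin (0 : ℝ) (Set.Ioi 0),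
      i ∈ Y → ∀ κ ∈ 𝒦, c * wt i ≤ ‖emb i + κ‖ := by
    intro i _
    by_cases hi : i ∈ Y
    · obtain ⟨δ, hδ, hb⟩ := h𝒦.exists_forall_le' (f := fun κ => ‖emb i + κ‖) (a := 0)
        (by fun_prop) (fun κ hκ => norm_pos_iff.mpr (h i hi κ hκ))
      have hpos : 0 < δ / wt i := div_pos hδ (wt_pos i)
      filter_upwards [Ioo_mem_nhdsGT hpos] with c hc _ κ hκ
      exact ((lt_div_iff₀ (wt_pos i)).mp hc.2).le.trans (hb κ hκ)
    · exact Filter.Eventually.of_forall fun c hi' => absurd hi' hi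
  have h2 := (hfin.eventually_all).mpr h1
  have h3 : ∀ᶠ c in nhdsWithin (0 : ℝ) (Set.Ioi 0), c < 1 / 4 :=
    Filter.mem_of_superset (Ioo_mem_nhdsGT (by norm_num : (0 : ℝ) < 1 / 4)) fun c hc => hc.2
  obtain ⟨c, ⟨hc, hc4⟩, hc0⟩ := ((h2.and h3).and self_mem_nhdsWithin).exists
  refine ⟨c, hc0, fun i hi κ hκ => ?_⟩
  by_cases hs : ‖emb i‖ ≤ 1 + 2 * |ρ|
  · exact hc i hs hi κ hκ
  · push Not at hs
    have h4 : ‖emb i‖ - ‖κ‖ ≤ ‖emb i + κ‖ := by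
      simpa using norm_sub_le_norm_add (emb i) κ
    have h5 := (hρ κ hκ).trans (le_abs_self ρ)
    have : c * wt i ≤ 1 / 4 * wt i := mul_le_mul_of_nonneg_right hc4.le (wt_pos i).le
    rw [wt] at this ⊢
    linarith [abs_nonneg ρ]

/-! ### The hopping operator on the lattice -/

/-- Convolution with a finitely supported function. -/
def hop (β : (ℤ × ℤ) →₀ ℂ) : (ℤ × ℤ → ℂ) →ₗ[ℂ] (ℤ × ℤ → ℂ) where
  toFun v i := ∑ d ∈ β.support, β d * v (i - d)
  map_add' v w := by
    funext i
    simp [mul_add, Finset.sum_add_distrib]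
  map_smul' c v := by
    funext i
    simp [Finset.mul_sum, mul_left_comm]

lemma hop_apply (β : (ℤ × ℤ) →₀ ℂ) (v : ℤ × ℤ → ℂ) (i : ℤ × ℤ) :
    hop β v i = ∑ d ∈ β.support, β d * v (i - d) := rfl

/-- Convolution with `β`, divided by `q + κ` and restricted to the lattice points in `Y`. -/
def op (β : (ℤ × ℤ) →₀ ℂ) (Y : Set (ℤ × ℤ)) (κ : ℂ) : Module.End ℂ (ℤ × ℤ → ℂ) where
  toFun v := Y.indicator fun i => hop β v i / (emb i + κ)
  map_add' v w := by
    funext i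
    by_cases hi : i ∈ Y <;> simp [hi, add_div]
  map_smul' c v := by
    funext i
    by_cases hi : i ∈ Y <;> simp [hi, mul_div_assoc]

section

variable {β : (ℤ × ℤ) →₀ ℂ} {Y : Set (ℤ × ℤ)} {κ : ℂ}

lemma op_apply_of_mem {i : ℤ × ℤ} (hi : i ∈ Y) (v : ℤ × ℤ → ℂ) :
    op β Y κ v i = hop β v i / (emb i + κ) :=
  Set.indicator_of_mem hi fun i => hop β v i / (emb i + κ)

lemma op_apply_of_notMem {i : ℤ × ℤ} (hi : i ∉ Y) (v : ℤ × ℤ → ℂ) :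
    op β Y κ v i = 0 :=
  Set.indicator_of_notMem hi fun i => hop β v i / (emb i + κ)

lemma sum_norm_hop_le {J : Finset (ℤ × ℤ)} {v : ℤ × ℤ → ℤ × ℤ → ℂ} {A : ℝ} {s : ℕ}
    (h : ∀ i, ∑ j ∈ J, ‖v j i‖ ≤ A / wt i ^ s) (i : ℤ × ℤ) :
    ∑ j ∈ J, ‖hop β (v j) i‖ ≤ (A * ∑ d ∈ β.support, ‖β d‖ * wt d ^ s) / wt i ^ s := by
  have hA : 0 ≤ A := by
    have := (Finset.sum_nonneg fun j _ => norm_nonneg (v j 0)).trans (h 0)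
    rwa [wt, emb_zero, norm_zero, add_zero, one_pow, div_one] at this
  calc ∑ j ∈ J, ‖hop β (v j) i‖
      ≤ ∑ j ∈ J, ∑ d ∈ β.support, ‖β d‖ * ‖v j (i - d)‖ := by
        gcongr with j _
        rw [hop_apply]
        exact (norm_sum_le _ _).trans_eq (Finset.sum_congr rfl fun d _ => norm_mul _ _)
    _ = ∑ d ∈ β.support, ‖β d‖ * ∑ j ∈ J, ‖v j (i - d)‖ := by
        rw [Finset.sum_comm]
        simp_rw [Finset.mul_sum]
    _ ≤ ∑ d ∈ β.support, ‖β d‖ * (A * wt d ^ s / wt i ^ s) := by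
        gcongr with d _
        refine (h _).trans ?_
        rw [div_le_div_iff₀ (pow_pos (wt_pos _) s) (pow_pos (wt_pos _) s), mul_assoc, ← mul_pow]
        gcongr
        · exact (wt_pos _).le
        · rw [mul_comm]
          exact wt_le_mul i d
    _ = _ := by
        rw [Finset.mul_sum, Finset.sum_div]
        exact Finset.sum_congr rfl fun d _ => by ring

lemma sum_norm_op_le {c : ℝ} (hc : 0 < c) (hκ : ∀ i ∈ Y, c * wt i ≤ ‖emb i + κ‖)
    {J : Finset (ℤ × ℤ)} {v : ℤ × ℤ → ℤ × ℤ → ℂ} {A : ℝ} {s : ℕ}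
    (h : ∀ i, ∑ j ∈ J, ‖v j i‖ ≤ A / wt i ^ s) (i : ℤ × ℤ) :
    ∑ j ∈ J, ‖op β Y κ (v j) i‖ ≤
      (A * (∑ d ∈ β.support, ‖β d‖ * wt d ^ s) / c) / wt i ^ (s + 1) := by
  have h1 := sum_norm_hop_le (β := β) h i
  have h0 : 0 ≤ ∑ j ∈ J, ‖hop β (v j) i‖ := Finset.sum_nonneg fun j _ => norm_nonneg _
  have hw := wt_pos i
  have h2 : (∑ j ∈ J, ‖hop β (v j) i‖) / (c * wt i) ≤
      (A * (∑ d ∈ β.support, ‖β d‖ * wt d ^ s) / c) / wt i ^ (s + 1) := by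
    refine (div_le_div_of_nonneg_right h1 (by positivity)).trans_eq ?_
    field_simp
    ring
  refine le_trans ?_ h2
  by_cases hi : i ∈ Y
  · simp_rw [op_apply_of_mem hi, norm_div]
    rw [← Finset.sum_div]
    exact div_le_div_of_nonneg_left h0 (by positivity) (hκ i hi)
  · simp only [op_apply_of_notMem hi, norm_zero, Finset.sum_const_zero]
    positivity

/-- Applying the operator `a` times improves the decay by the power `a`, uniformly in `κ`. -/
lemma exists_sum_norm_op_pow_le (β : (ℤ × ℤ) →₀ ℂ) (Y : Set (ℤ × ℤ)) {c : ℝ} (hc : 0 < c) (A : ℝ)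
    (s a : ℕ) : ∃ A' : ℝ, ∀ κ : ℂ, (∀ i ∈ Y, c * wt i ≤ ‖emb i + κ‖) →
      ∀ (J : Finset (ℤ × ℤ)) (v : ℤ × ℤ → ℤ × ℤ → ℂ), (∀ i, ∑ j ∈ J, ‖v j i‖ ≤ A / wt i ^ s) →
        ∀ i, ∑ j ∈ J, ‖(op β Y κ ^ a) (v j) i‖ ≤ A' / wt i ^ (s + a) := by
  induction a with
  | zero => exact ⟨A, fun κ _ J v h i => by simpa using h i⟩
  | succ a ih =>
    obtain ⟨A', hA'⟩ := ih
    refine ⟨A' * (∑ d ∈ β.support, ‖β d‖ * wt d ^ (s + a)) / c, fun κ hκ J v h i => ?_⟩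
    have := sum_norm_op_le (β := β) hc hκ (hA' κ hκ J v h) i
    simpa only [pow_succ', Module.End.mul_apply, add_assoc] using this

lemma exists_norm_op_pow_le (β : (ℤ × ℤ) →₀ ℂ) (Y : Set (ℤ × ℤ)) {c : ℝ} (hc : 0 < c) (A : ℝ)
    (s a : ℕ) : ∃ A' : ℝ, ∀ κ : ℂ, (∀ i ∈ Y, c * wt i ≤ ‖emb i + κ‖) →
      ∀ v : ℤ × ℤ → ℂ, (∀ i, ‖v i‖ ≤ A / wt i ^ s) →
        ∀ i, ‖(op β Y κ ^ a) v i‖ ≤ A' / wt i ^ (s + a) := by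
  obtain ⟨A', hA'⟩ := exists_sum_norm_op_pow_le β Y hc A s a
  refine ⟨A', fun κ hκ v hv i => ?_⟩
  have := hA' κ hκ {0} (fun _ => v) (by simpa using hv) i
  simpa using this

lemma norm_single_le (j i : ℤ × ℤ) : ‖(Pi.single j 1 : ℤ × ℤ → ℂ) i‖ ≤ 1 / wt i ^ 0 := by
  rw [Pi.single_apply]
  split_ifs <;> simp

/-! ### Supports -/

lemma exists_support_bound (β : (ℤ × ℤ) →₀ ℂ) : ∃ D : ℝ, 0 ≤ D ∧ ∀ d ∈ β.support, ‖emb d‖ ≤ D := by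
  refine ⟨∑ d ∈ β.support, ‖emb d‖, by positivity, fun d hd => ?_⟩
  exact Finset.single_le_sum (f := fun d => ‖emb d‖) (fun _ _ => norm_nonneg _) hd

lemma op_pow_single_eq_zero {D : ℝ} (hD : ∀ d ∈ β.support, ‖emb d‖ ≤ D) (j : ℤ × ℤ) (a : ℕ) :
    ∀ i, a * D < ‖emb i - emb j‖ → (op β Y κ ^ a) (Pi.single j 1) i = 0 := by
  induction a with
  | zero =>
    intro i hi
    have : i ≠ j := by
      rintro rfl
      simp at hi
    simp [this]
  | succ a ih =>
    intro i hi
    rw [pow_succ', Module.End.mul_apply]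
    by_cases hY : i ∈ Y
    · rw [op_apply_of_mem hY, hop_apply, Finset.sum_eq_zero, zero_div]
      intro d hd
      rw [ih, mul_zero]
      have h1 := norm_sub_norm_le (emb i - emb j) (emb d)
      have h2 := hD d hd
      have h3 : emb (i - d) - emb j = emb i - emb j - emb d := by rw [emb_sub]; ring
      rw [h3]
      push_cast at hi
      linarith
    · exact op_apply_of_notMem hY _

/-! ### Operators with finite rows -/

/-- Each coordinate of the image depends linearly on finitely many coordinates. -/
def RowFinite (A : Module.End ℂ (ℤ × ℤ → ℂ)) : Prop :=
  ∀ i, ∃ c : (ℤ × ℤ) →₀ ℂ, ∀ v, A v i = ∑ j ∈ c.support, c j * v j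

lemma rowFinite_iff {A : Module.End ℂ (ℤ × ℤ → ℂ)} : RowFinite A ↔
    ∀ i, ∃ c : (ℤ × ℤ) →₀ ℂ, ∀ v, A v i = c.sum fun j b => b * v j := Iff.rfl

lemma RowFinite.add {A B : Module.End ℂ (ℤ × ℤ → ℂ)} (hA : RowFinite A) (hB : RowFinite B) :
    RowFinite (A + B) := by
  rw [rowFinite_iff] at *
  intro i
  obtain ⟨c, hc⟩ := hA i
  obtain ⟨c', hc'⟩ := hB i
  refine ⟨c + c', fun v => ?_⟩
  rw [LinearMap.add_apply, Pi.add_apply, hc, hc',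
    Finsupp.sum_add_index' (by simp) (by intros; ring)]

lemma RowFinite.smul {A : Module.End ℂ (ℤ × ℤ → ℂ)} (hA : RowFinite A) (b : ℂ) :
    RowFinite (b • A) := by
  rw [rowFinite_iff] at *
  intro i
  obtain ⟨c, hc⟩ := hA i
  refine ⟨b • c, fun v => ?_⟩
  rw [LinearMap.smul_apply, Pi.smul_apply, hc, Finsupp.sum_smul_index (by simp), smul_eq_mul,
    Finsupp.mul_sum]
  simp only [mul_assoc]

lemma RowFinite.mul {A B : Module.End ℂ (ℤ × ℤ → ℂ)} (hA : RowFinite A) (hB : RowFinite B) :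
    RowFinite (A * B) := by
  rw [rowFinite_iff] at *
  intro i
  obtain ⟨c, hc⟩ := hA i
  choose e he using hB
  refine ⟨c.sum fun j b => b • e j, fun v => ?_⟩
  rw [Module.End.mul_apply, hc, Finsupp.sum_sum_index (by simp) (by intros; ring)]
  refine Finsupp.sum_congr fun j _ => ?_
  rw [he, Finsupp.sum_smul_index (by simp), Finsupp.mul_sum]
  simp only [mul_assoc]

lemma RowFinite.one : RowFinite 1 := by
  rw [rowFinite_iff]
  exact fun i => ⟨Finsupp.single i 1, fun v => by simp⟩

lemma RowFinite.pow {A : Module.End ℂ (ℤ × ℤ → ℂ)} (hA : RowFinite A) (n : ℕ) :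
    RowFinite (A ^ n) := by
  induction n with
  | zero => exact RowFinite.one
  | succ n ih => exact pow_succ A n ▸ ih.mul hA

lemma rowFinite_op : RowFinite (op β Y κ) := by
  rw [rowFinite_iff]
  intro i
  by_cases hi : i ∈ Y
  · refine ⟨β.sum fun d b => Finsupp.single (i - d) (b / (emb i + κ)), fun v => ?_⟩
    rw [op_apply_of_mem hi, hop_apply, Finsupp.sum_sum_index (by simp) (by intros; ring), Finset.sum_div]
    refine Finset.sum_congr rfl fun d _ => ?_
    simp only [Finsupp.sum_single_index, zero_mul]
    ring
  · exact ⟨0, fun v => by rw [op_apply_of_notMem hi, Finsupp.sum_zero_index]⟩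

lemma RowFinite.hasSum {A : Module.End ℂ (ℤ × ℤ → ℂ)} (hA : RowFinite A) (v : ℤ × ℤ → ℂ)
    (i : ℤ × ℤ) : HasSum (fun j => A (Pi.single j 1) i * v j) (A v i) := by
  obtain ⟨c, hc⟩ := hA i
  have h1 : ∀ j, A (Pi.single j 1) i = c j := by
    intro j
    rw [hc]
    simp [Pi.single_apply]
    exact fun h => h.symm
  simp_rw [h1]
  rw [hc]
  exact hasSum_sum_of_ne_finset_zero fun j hj => by
    rw [Finsupp.notMem_support_iff.mp hj, zero_mul]

lemma RowFinite.kpow {A : Module.End ℂ (ℤ × ℤ → ℂ)} (hA : RowFinite A) (n : ℕ) (i j : ℤ × ℤ) :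
    kpow (fun i j => A (Pi.single j 1) i) n i j = (A ^ n) (Pi.single j 1) i := by
  induction n generalizing i with
  | zero => simp [TBG.kpow, Pi.single_apply]
  | succ n ih =>
    rw [TBG.kpow, pow_succ', Module.End.mul_apply]
    simp_rw [ih]
    exact (hA.hasSum _ i).tsum_eq

end

/-! ### Symmetries of the hopping operator -/

section

variable {β : (ℤ × ℤ) →₀ ℂ} {Y : Set (ℤ × ℤ)} {κ : ℂ}

/-- Rotation as a permutation of the lattice. -/
def rotEquiv : Equiv.Perm (ℤ × ℤ) where
  toFun := rot
  invFun := fun i => rot (rot i)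
  left_inv := rot_rot_rot
  right_inv := rot_rot_rot

lemma rot_injective : Function.Injective rot := rotEquiv.injective

/-- Rotation about the lattice point `q`, acting on functions. -/
def rotAt (q : ℤ × ℤ) : Module.End ℂ (ℤ × ℤ → ℂ) := LinearMap.funLeft ℂ ℂ fun i => q + rot (i - q)

lemma rotAt_apply (q : ℤ × ℤ) (v : ℤ × ℤ → ℂ) (i : ℤ × ℤ) : rotAt q v i = v (q + rot (i - q)) := rfl

lemma hop_rot (hβ : ∀ d, β (rot d) = ω * β d) (q : ℤ × ℤ) (v : ℤ × ℤ → ℂ) (i : ℤ × ℤ) :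
    hop β v (q + rot (i - q)) = ω * hop β (rotAt q v) i := by
  rw [hop_apply, hop_apply, Finset.mul_sum]
  symm
  refine Finset.sum_equiv rotEquiv (fun d => ?_) (fun d _ => ?_)
  · rw [Finsupp.mem_support_iff, Finsupp.mem_support_iff]
    show β d ≠ 0 ↔ β (rot d) ≠ 0
    rw [hβ, mul_ne_zero_iff, and_iff_right ω_ne_zero]
  · show ω * (β d * rotAt q v (i - d)) = β (rot d) * v (q + rot (i - q) - rot d)
    rw [hβ, rotAt_apply, mul_assoc, sub_right_comm, rot_sub (i - q) d, add_sub_assoc]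

lemma rotAt_op (hβ : ∀ d, β (rot d) = ω * β d) (q : ℤ × ℤ)
    (hY : ∀ i, q + rot (i - q) ∈ Y ↔ i ∈ Y) (v : ℤ × ℤ → ℂ) :
    rotAt q (op β Y (-emb q) v) = op β Y (-emb q) (rotAt q v) := by
  funext i
  rw [rotAt_apply]
  by_cases hi : i ∈ Y
  · rw [op_apply_of_mem ((hY i).mpr hi), op_apply_of_mem hi, hop_rot hβ, emb_add, emb_rot,
      add_neg_cancel_comm, emb_sub, ← sub_eq_add_neg, mul_div_mul_left _ _ ω_ne_zero]
  · rw [op_apply_of_notMem (mt (hY i).mp hi), op_apply_of_notMem hi]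

lemma rotAt_single (q : ℤ × ℤ) : rotAt q (Pi.single q 1) = Pi.single q 1 := by
  funext i
  rw [rotAt_apply, Pi.single_apply, Pi.single_apply]
  congr 1
  rw [add_eq_left, eq_iff_iff]
  constructor
  · intro h
    rw [← rot_zero] at h
    exact sub_eq_zero.mp (rot_injective h)
  · rintro rfl
    rw [sub_self, rot_zero]

/-- The lattice points that are not of class zero. -/
def nzcls : Set (ℤ × ℤ) := {i | cls i ≠ 0}

lemma rot_mem_nzcls (q i : ℤ × ℤ) : q + rot (i - q) ∈ nzcls ↔ i ∈ nzcls := by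
  simp only [nzcls, Set.mem_ofPred_eq]
  rw [cls_add, cls_rot, ← cls_add, add_sub_cancel]

lemma hop_shift (γ : ℤ × ℤ) (v : ℤ × ℤ → ℂ) (i : ℤ × ℤ) :
    hop β (fun j => v (j - γ)) i = hop β v (i - γ) := by
  simp only [hop_apply, sub_right_comm]

lemma op_shift (γ : ℤ × ℤ) (hY : ∀ i, i + γ ∈ Y ↔ i ∈ Y) (v : ℤ × ℤ → ℂ) :
    op β Y κ (fun j => v (j - γ)) = fun i => op β Y (κ + emb γ) v (i - γ) := by
  funext i
  by_cases hi : i - γ ∈ Y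
  · rw [op_apply_of_mem hi, op_apply_of_mem (by have := (hY (i - γ)).mpr hi; rwa [sub_add_cancel] at this),
      hop_shift, emb_sub]
    ring
  · rw [op_apply_of_notMem hi,
      op_apply_of_notMem (by have := mt (hY (i - γ)).mp hi; rwa [sub_add_cancel] at this)]

lemma op_pow_shift (γ : ℤ × ℤ) (hY : ∀ i, i + γ ∈ Y ↔ i ∈ Y) (v : ℤ × ℤ → ℂ) (a : ℕ) :
    (op β Y κ ^ a) (fun j => v (j - γ)) = fun i => (op β Y (κ + emb γ) ^ a) v (i - γ) := by
  induction a with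
  | zero => rfl
  | succ a ih => rw [pow_succ', pow_succ', Module.End.mul_apply, ih, op_shift γ hY]; rfl

lemma add_mem_nzcls {γ : ℤ × ℤ} (hγ : cls γ = 0) (i : ℤ × ℤ) : i + γ ∈ nzcls ↔ i ∈ nzcls := by
  simp only [nzcls, Set.mem_ofPred_eq, cls_add, hγ, add_zero]

/-- The diagonal entries of the powers of the operator. -/
def diagEntry (β : (ℤ × ℤ) →₀ ℂ) (Y : Set (ℤ × ℤ)) (m : ℕ) (κ : ℂ) (i : ℤ × ℤ) : ℂ :=
  (op β Y κ ^ m) (Pi.single i 1) i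

/-- The trace of the powers of the operator. -/
def opTrace (β : (ℤ × ℤ) →₀ ℂ) (Y : Set (ℤ × ℤ)) (m : ℕ) (κ : ℂ) : ℂ :=
  ∑' i, diagEntry β Y m κ i

lemma diagEntry_add {γ : ℤ × ℤ} (hY : ∀ i, i + γ ∈ Y ↔ i ∈ Y) (m : ℕ) (κ : ℂ) (i : ℤ × ℤ) :
    diagEntry β Y m κ (i + γ) = diagEntry β Y m (κ + emb γ) i := by
  have h : (Pi.single (i + γ) 1 : ℤ × ℤ → ℂ) = fun j => (Pi.single i 1 : ℤ × ℤ → ℂ) (j - γ) := by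
    funext j
    simp only [Pi.single_apply, sub_eq_iff_eq_add]
  rw [diagEntry, h, op_pow_shift γ hY]
  show (op β Y (κ + emb γ) ^ m) (Pi.single i 1) (i + γ - γ) = _
  rw [add_sub_cancel_right]
  rfl

lemma opTrace_add {γ : ℤ × ℤ} (hY : ∀ i, i + γ ∈ Y ↔ i ∈ Y) (m : ℕ) (κ : ℂ) :
    opTrace β Y m (κ + emb γ) = opTrace β Y m κ := by
  exact (tsum_congr fun i => (diagEntry_add hY m κ i).symm).trans
    ((Equiv.addRight γ).tsum_eq (diagEntry β Y m κ))

/-! ### Holomorphic dependence on the quasi-momentum -/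

lemma differentiableAt_op {v : ℂ → ℤ × ℤ → ℂ} (hκ : ∀ i ∈ Y, emb i + κ ≠ 0)
    (hv : ∀ i, DifferentiableAt ℂ (fun κ => v κ i) κ) (i : ℤ × ℤ) :
    DifferentiableAt ℂ (fun κ => op β Y κ (v κ) i) κ := by
  by_cases hi : i ∈ Y
  · simp only [op_apply_of_mem hi, hop_apply]
    refine DifferentiableAt.div ?_ (by fun_prop) (hκ i hi)
    exact DifferentiableAt.fun_sum fun d _ => (hv (i - d)).const_mul _
  · simp only [op_apply_of_notMem hi]
    fun_prop

lemma differentiableAt_op_pow (v : ℤ × ℤ → ℂ) (hκ : ∀ i ∈ Y, emb i + κ ≠ 0) (a : ℕ) (i : ℤ × ℤ) :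
    DifferentiableAt ℂ (fun κ => (op β Y κ ^ a) v i) κ := by
  induction a generalizing i with
  | zero => simp
  | succ a ih =>
    simp only [pow_succ', Module.End.mul_apply]
    exact differentiableAt_op hκ ih i

lemma exists_norm_diagEntry_le (β : (ℤ × ℤ) →₀ ℂ) (Y : Set (ℤ × ℤ)) {𝒦 : Set ℂ} (h𝒦 : IsCompact 𝒦)
    (h : ∀ i ∈ Y, ∀ κ ∈ 𝒦, emb i + κ ≠ 0) (m : ℕ) :
    ∃ A : ℝ, ∀ κ ∈ 𝒦, ∀ i, ‖diagEntry β Y m κ i‖ ≤ A / wt i ^ m := by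
  obtain ⟨c, hc, hb⟩ := exists_wt_le h𝒦 h
  obtain ⟨A, hA⟩ := exists_norm_op_pow_le β Y hc 1 0 m
  refine ⟨A, fun κ hκ i => ?_⟩
  have := hA κ (fun i hi => hb i hi κ hκ) (Pi.single i 1) (norm_single_le i) i
  rwa [zero_add] at this

lemma exists_closedBall_avoid (Y : Set (ℤ × ℤ)) (κ₀ : ℂ) (hκ : ∀ i ∈ Y, emb i + κ₀ ≠ 0) :
    ∃ r : ℝ, 0 < r ∧ ∀ i ∈ Y, ∀ κ ∈ Metric.closedBall κ₀ r, emb i + κ ≠ 0 := by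
  obtain ⟨c, hc, hb⟩ := exists_wt_le (isCompact_singleton (x := κ₀)) (Y := Y)
    (fun i hi κ h => h ▸ hκ i hi)
  refine ⟨c / 2, by positivity, fun i hi κ h h0 => ?_⟩
  have h1 := hb i hi κ₀ rfl
  have h2 : emb i + κ₀ = κ₀ - κ := by linear_combination h0
  rw [mem_closedBall_iff_norm, norm_sub_rev] at h
  rw [h2] at h1
  nlinarith [one_le_wt i]

lemma summable_diagEntry (hκ : ∀ i ∈ Y, emb i + κ ≠ 0) {m : ℕ} (hm : 3 ≤ m) :
    Summable (diagEntry β Y m κ) := by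
  obtain ⟨A, hA⟩ := exists_norm_diagEntry_le β Y (isCompact_singleton (x := κ))
    (fun i hi κ' h => h ▸ hκ i hi) m
  exact Summable.of_norm_bounded (summable_wt_pow hm A) (hA κ rfl)

lemma differentiableAt_opTrace (hκ : ∀ i ∈ Y, emb i + κ ≠ 0) {m : ℕ} (hm : 3 ≤ m) :
    DifferentiableAt ℂ (opTrace β Y m) κ := by
  obtain ⟨r, hr, hb⟩ := exists_closedBall_avoid Y κ hκ
  obtain ⟨A, hA⟩ := exists_norm_diagEntry_le β Y (isCompact_closedBall κ r) hb m
  have : DifferentiableOn ℂ (fun κ => ∑' i, diagEntry β Y m κ i) (Metric.ball κ r) :=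
    differentiableOn_tsum_of_summable_norm (summable_wt_pow hm A)
      (fun i κ' hκ' => (differentiableAt_op_pow _ (fun j hj => hb j hj κ'
        (Metric.ball_subset_closedBall hκ')) m i).differentiableWithinAt)
      Metric.isOpen_ball (fun i κ' hκ' => hA κ' (Metric.ball_subset_closedBall hκ') i)
  exact this.differentiableAt (Metric.ball_mem_nhds κ hr)

end

/-! ### The traces are constant -/

section Rank1

variable {R T : Module.End ℂ (ℤ × ℤ → ℂ)} {ρ : (ℤ × ℤ → ℂ) →ₗ[ℂ] ℂ} {e : ℤ × ℤ → ℂ} {ε : ℂ}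

lemma pow_apply_of_rank_one (h : ∀ v, T v = R v + (ρ v / ε) • e) (m : ℕ) (v : ℤ × ℤ → ℂ) :
    (T ^ m) v = (R ^ m) v + ∑ a ∈ Finset.range m, (ρ ((R ^ (m - 1 - a)) v) / ε) • (T ^ a) e := by
  induction m with
  | zero => simp
  | succ m ih =>
    rw [pow_succ', Module.End.mul_apply, ih, map_add, map_sum, h ((R ^ m) v), Finset.sum_range_succ',
      pow_succ' R, Module.End.mul_apply]
    have : ∀ a ∈ Finset.range m, T ((ρ ((R ^ (m - 1 - a)) v) / ε) • (T ^ a) e) =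
        (ρ ((R ^ (m + 1 - 1 - (a + 1))) v) / ε) • (T ^ (a + 1)) e := by
      intro a _
      rw [map_smul, pow_succ', Module.End.mul_apply, Nat.add_sub_cancel, Nat.sub_sub, Nat.add_comm 1 a]
    rw [Finset.sum_congr rfl this, pow_zero, Module.End.one_apply, Nat.add_sub_cancel, Nat.sub_zero]
    abel

lemma pow_succ_apply_of_rank_one (h : ∀ v, T v = R v + (ρ v / ε) • e) (a b : ℕ) :
    ρ ((R ^ b) ((T ^ (a + 1)) e)) / ε =
      ρ ((R ^ (b + 1)) ((T ^ a) e)) / ε + ρ ((T ^ a) e) / ε * (ρ ((R ^ b) e) / ε) := by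
  rw [pow_succ' T, Module.End.mul_apply, h, map_add, map_smul, map_add, map_smul, pow_succ R,
    Module.End.mul_apply, smul_eq_mul]
  ring

end Rank1

section

variable {β : (ℤ × ℤ) →₀ ℂ} {Y : Set (ℤ × ℤ)} {κ : ℂ}

lemma rowFinite_hop : RowFinite (hop β) := by
  rw [rowFinite_iff]
  intro i
  refine ⟨β.sum fun d b => Finsupp.single (i - d) b, fun v => ?_⟩
  rw [hop_apply, Finsupp.sum_sum_index (by simp) (by intros; ring)]
  refine Finset.sum_congr rfl fun d _ => ?_
  exact (Finsupp.sum_single_index (h := fun j b => b * v j) (zero_mul _)).symm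

lemma op_eq_of_mem {q : ℤ × ℤ} (hq : q ∈ Y) (v : ℤ × ℤ → ℂ) :
    op β Y κ v = op β (Y \ {q}) κ v + (hop β v q / (emb q + κ)) • Pi.single q 1 := by
  funext i
  rw [Pi.add_apply, Pi.smul_apply, smul_eq_mul]
  by_cases hiq : i = q
  · subst hiq
    rw [op_apply_of_mem hq, op_apply_of_notMem (by simp), Pi.single_eq_same, mul_one, zero_add]
  · rw [Pi.single_eq_of_ne hiq, mul_zero, add_zero]
    by_cases hi : i ∈ Y
    · rw [op_apply_of_mem hi, op_apply_of_mem (Y := Y \ {q}) ⟨hi, hiq⟩]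
    · rw [op_apply_of_notMem hi, op_apply_of_notMem (Y := Y \ {q}) fun h => hi h.1]

lemma opTrace_eq_of_mem {q : ℤ × ℤ} (hq : q ∈ Y) (hκ : ∀ i ∈ Y, emb i + κ ≠ 0) {m : ℕ} (hm : 3 ≤ m) :
    opTrace β Y m κ = opTrace β (Y \ {q}) m κ + ∑ a ∈ Finset.range m,
      hop β ((op β (Y \ {q}) κ ^ (m - 1 - a)) ((op β Y κ ^ a) (Pi.single q 1))) q / (emb q + κ) := by
  have h1 : ∀ a, HasSum (fun i => hop β ((op β (Y \ {q}) κ ^ (m - 1 - a)) (Pi.single i 1)) q /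
      (emb q + κ) * (op β Y κ ^ a) (Pi.single q 1) i)
      (hop β ((op β (Y \ {q}) κ ^ (m - 1 - a)) ((op β Y κ ^ a) (Pi.single q 1))) q / (emb q + κ)) := by
    intro a
    have := ((rowFinite_hop (β := β)).mul ((rowFinite_op (β := β) (Y := Y \ {q}) (κ := κ)).pow
      (m - 1 - a))).hasSum ((op β Y κ ^ a) (Pi.single q 1)) q
    have h := this.div_const (emb q + κ)
    simp only [Module.End.mul_apply, mul_div_right_comm] at h
    exact h
  have h2 := (summable_diagEntry (β := β) (Y := Y \ {q}) (fun i hi => hκ i hi.1) hm).hasSum.add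
    (hasSum_sum fun a (_ : a ∈ Finset.range m) => h1 a)
  rw [opTrace, opTrace, ← h2.tsum_eq]
  refine tsum_congr fun i => ?_
  have h3 := congr_fun (pow_apply_of_rank_one (T := op β Y κ) (R := op β (Y \ {q}) κ)
    (ρ := (LinearMap.proj q).comp (hop β)) (op_eq_of_mem hq) m (Pi.single i 1)) i
  rw [diagEntry, h3, Pi.add_apply, Finset.sum_apply]
  rfl

lemma hop_op_pow_single_eq_zero (hβ : ∀ d, β (rot d) = ω * β d) {q : ℤ × ℤ}
    (hY : ∀ i, q + rot (i - q) ∈ Y ↔ i ∈ Y) (b : ℕ) :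
    hop β ((op β Y (-emb q) ^ b) (Pi.single q 1)) q = 0 := by
  have h1 : rotAt q ((op β Y (-emb q) ^ b) (Pi.single q 1)) = (op β Y (-emb q) ^ b) (Pi.single q 1) := by
    induction b with
    | zero => exact rotAt_single q
    | succ b ih => rw [pow_succ', Module.End.mul_apply, rotAt_op hβ q hY, ih]
  have h2 := hop_rot hβ q ((op β Y (-emb q) ^ b) (Pi.single q 1)) q
  rw [h1, sub_self, rot_zero, add_zero] at h2
  have h3 : (1 - ω) * hop β ((op β Y (-emb q) ^ b) (Pi.single q 1)) q = 0 := by linear_combination h2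
  exact (mul_eq_zero.mp h3).resolve_left (sub_ne_zero.mpr ω_ne_one.symm)

open Filter Topology Asymptotics in
lemma opTrace_isBigO (hβ : ∀ d, β (rot d) = ω * β d) {q : ℤ × ℤ} (hq : q ∈ Y)
    (hY : ∀ i, q + rot (i - q) ∈ Y ↔ i ∈ Y) {m : ℕ} (hm : 3 ≤ m) :
    opTrace β Y m =O[𝓝[≠] (-emb q)] (fun _ => (1 : ℝ)) := by
  have hY' : ∀ i, q + rot (i - q) ∈ Y \ {q} ↔ i ∈ Y \ {q} := by
    intro i
    refine and_congr (hY i) (not_congr ?_)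
    rw [Set.mem_singleton_iff, Set.mem_singleton_iff, add_eq_left, ← sub_eq_zero (a := i)]
    exact ⟨fun h => rot_injective (h.trans rot_zero.symm), fun h => by rw [h, rot_zero]⟩
  have h0 : ∀ i ∈ Y \ {q}, emb i + -emb q ≠ 0 := by
    intro i hi h
    exact hi.2 (emb_injective (add_neg_eq_zero.mp h))
  obtain ⟨r, hr, hav⟩ := exists_closedBall_avoid (Y \ {q}) (-emb q) h0
  have hX0 : ∀ b, (fun κ => hop β ((op β (Y \ {q}) κ ^ b) (Pi.single q 1)) q /
      (emb q + κ)) =O[𝓝[≠] (-emb q)] (fun _ => (1 : ℝ)) := by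
    intro b
    have hd : DifferentiableAt ℂ (fun κ => hop β ((op β (Y \ {q}) κ ^ b) (Pi.single q 1)) q)
        (-emb q) := by
      simp only [hop_apply]
      exact DifferentiableAt.fun_sum fun d _ => (differentiableAt_op_pow _ h0 b _).const_mul _
    have h1 := hd.isBigO_sub
    rw [hop_op_pow_single_eq_zero hβ hY'] at h1
    simp only [sub_zero, sub_neg_eq_add] at h1
    refine ((h1.mono nhdsWithin_le_nhds).mul (isBigO_refl (fun κ => (emb q + κ)⁻¹) _)).trans ?_
    refine IsBigO.of_bound 1 (Eventually.of_forall fun κ => ?_)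
    rw [add_comm κ, norm_mul, norm_inv, norm_one, one_mul]
    exact mul_inv_le_one
  have hX : ∀ a b, (fun κ => hop β ((op β (Y \ {q}) κ ^ b) ((op β Y κ ^ a) (Pi.single q 1))) q /
      (emb q + κ)) =O[𝓝[≠] (-emb q)] (fun _ => (1 : ℝ)) := by
    intro a
    induction a with
    | zero => exact hX0
    | succ a ih =>
      intro b
      have h1 := (ih (b + 1)).add (((ih 0).mul (hX0 b)).congr_right fun _ => mul_one _)
      refine h1.congr_left fun κ => ?_
      exact (pow_succ_apply_of_rank_one (T := op β Y κ) (R := op β (Y \ {q}) κ)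
        (ρ := (LinearMap.proj q).comp (hop β)) (op_eq_of_mem hq) a b).symm
  have h1 := (((differentiableAt_opTrace (β := β) h0 hm).continuousAt.tendsto.isBigO_one ℝ).mono
    (nhdsWithin_le_nhds (s := {-emb q}ᶜ))).add
    (IsBigO.sum (s := Finset.range m) fun a _ => hX a (m - 1 - a))
  refine h1.congr' ?_ EventuallyEq.rfl
  have hb : ∀ᶠ κ in 𝓝[≠] (-emb q), κ ∈ Metric.closedBall (-emb q) r :=
    nhdsWithin_le_nhds (Metric.closedBall_mem_nhds _ hr)
  filter_upwards [hb, self_mem_nhdsWithin] with κ h2 h3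
  rw [Finset.sum_apply]
  refine (opTrace_eq_of_mem hq (fun i hi => ?_) hm).symm
  by_cases hiq : i = q
  · rw [hiq, add_comm, ← sub_neg_eq_add]
    exact sub_ne_zero.mpr h3
  · exact hav i ⟨hi, hiq⟩ κ h2


open Filter Topology in
/-- A holomorphic function with only removable singularities, all of whose values are attained on a
compact set, is constant. -/
lemma eq_of_isBigO_one_of_compact {X 𝒦 : Set ℂ} {h : ℂ → ℂ}
    (hd : ∀ x ∉ X, DifferentiableAt ℂ h x) (hX : ∀ x, ∀ᶠ y in 𝓝[≠] x, y ∉ X)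
    (hb : ∀ x ∈ X, h =O[𝓝[≠] x] (fun _ => (1 : ℝ))) (h𝒦 : IsCompact 𝒦)
    (hper : ∀ κ ∉ X, ∃ κ' ∈ 𝒦, κ' ∉ X ∧ h κ' = h κ) {x y : ℂ} (hx : x ∉ X) (hy : y ∉ X) :
    h x = h y := by
  set g : ℂ → ℂ := fun x => limUnder (𝓝[≠] x) h with hg
  have hgh : ∀ x ∉ X, g x = h x := fun x hx =>
    ((hd x hx).continuousAt.tendsto.mono_left nhdsWithin_le_nhds).limUnder_eq
  have hgd : Differentiable ℂ g := by
    intro x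
    obtain ⟨s, hs, hsX⟩ := eventually_nhdsWithin_iff.mp (hX x) |>.exists_mem
    have hup : Function.update h x (g x) =ᶠ[𝓝 x] g := by
      filter_upwards [hs] with y hy
      by_cases hyx : y = x
      · rw [hyx, Function.update_self]
      · rw [Function.update_of_ne hyx, hgh y (hsX y hy hyx)]
    refine DifferentiableAt.congr_of_eventuallyEq ?_ hup.symm
    by_cases hxX : x ∈ X
    · obtain ⟨C, hC⟩ := (hb x hxX).bound
      have hC' : ∀ᶠ y in 𝓝[≠] x, ‖h y‖ ≤ C := by simpa using hC
      obtain ⟨s', hs', hsC⟩ := eventually_nhdsWithin_iff.mp hC' |>.exists_mem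
      refine (Complex.differentiableOn_update_limUnder_of_bddAbove (inter_mem hs hs') ?_ ?_).differentiableAt
        (inter_mem hs hs')
      · exact fun y hy => (hd y (hsX y hy.1.1 hy.2)).differentiableWithinAt
      · refine ⟨C, ?_⟩
        rintro _ ⟨y, hy, rfl⟩
        exact hsC y hy.1.2 hy.2
    · rw [hgh x hxX, Function.update_eq_self]
      exact hd x hxX
  obtain ⟨C, hC⟩ := h𝒦.exists_bound_of_continuousOn hgd.continuous.continuousOn
  have hC' : ∀ x, ‖g x‖ ≤ C := by
    intro x
    refine le_of_tendsto (hgd.continuous.norm.continuousAt.tendsto.mono_left nhdsWithin_le_nhds :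
      Tendsto _ (𝓝[≠] x) _) ?_
    filter_upwards [hX x] with y hy
    obtain ⟨κ, hκ, hκX, hκy⟩ := hper y hy
    rw [hgh y hy, ← hκy, ← hgh κ hκX]
    exact hC κ hκ
  rw [← hgh x hx, ← hgh y hy]
  refine hgd.apply_eq_apply_of_bounded ?_ x y
  exact (isBounded_iff_forall_norm_le.mpr ⟨C, by rintro _ ⟨x, rfl⟩; exact hC' x⟩)

lemma exists_norm_add_emb_le (κ : ℂ) :
    ∃ γ : ℤ × ℤ, cls γ = 0 ∧ ‖κ + emb γ‖ ≤ 6 := by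
  have h3 : (0 : ℝ) < √3 := by positivity
  have h3' : √3 ≤ 2 := Real.sqrt_le_iff.mpr (by norm_num)
  set a : ℤ := ⌊κ.im / (3 * (√3 / 2))⌋ with ha
  set b : ℤ := ⌊(κ.re + 3 * a / 2) / 3⌋ with hb
  have a1 := Int.floor_le (κ.im / (3 * (√3 / 2)))
  have a2 := Int.lt_floor_add_one (κ.im / (3 * (√3 / 2)))
  have b1 := Int.floor_le ((κ.re + 3 * a / 2) / 3)
  have b2 := Int.lt_floor_add_one ((κ.re + 3 * a / 2) / 3)
  rw [← ha, le_div_iff₀ (by positivity)] at a1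
  rw [← ha, div_lt_iff₀ (by positivity)] at a2
  rw [← hb, le_div_iff₀ (by positivity)] at b1
  rw [← hb, div_lt_iff₀ (by positivity)] at b2
  refine ⟨(-(3 * a), -(3 * b)), ?_, (Complex.norm_le_abs_re_add_abs_im _).trans ?_⟩
  · rw [cls, ZMod.intCast_zmod_eq_zero_iff_dvd]
    exact ⟨-(a + b), by push_cast; ring⟩
  · rw [add_re, add_im, emb_re, emb_im, abs_of_nonneg, abs_of_nonneg] <;> push_cast <;> nlinarith

open Filter Topology in
lemma opTrace_const (hβ : ∀ d, β (rot d) = ω * β d) {m : ℕ} (hm : 3 ≤ m) {κ κ' : ℂ}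
    (hκ : ∀ i ∈ nzcls, emb i + κ ≠ 0) (hκ' : ∀ i ∈ nzcls, emb i + κ' ≠ 0) :
    opTrace β nzcls m κ = opTrace β nzcls m κ' := by
  refine eq_of_isBigO_one_of_compact (X := {κ | ∃ i ∈ nzcls, emb i + κ = 0})
    (𝒦 := Metric.closedBall 0 6) ?_ ?_ ?_ (isCompact_closedBall 0 6) ?_ (by simpa using hκ) (by simpa using hκ')
  · intro κ hκ
    refine differentiableAt_opTrace (by simpa using hκ) hm
  · intro κ
    obtain ⟨r, hr, hav⟩ := exists_closedBall_avoid {i | emb i + κ ≠ 0} κ fun i hi => hi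
    filter_upwards [nhdsWithin_le_nhds (Metric.closedBall_mem_nhds κ hr), self_mem_nhdsWithin] with κ' h1 h2
    rintro ⟨i, -, hi0⟩
    by_cases h3 : emb i + κ = 0
    · exact h2 (add_left_cancel (hi0.trans h3.symm))
    · exact hav i h3 κ' h1 hi0
  · rintro κ ⟨i, hi, h0⟩
    rw [eq_neg_of_add_eq_zero_right h0]
    exact opTrace_isBigO hβ hi (rot_mem_nzcls i) hm
  · intro κ hκ
    obtain ⟨γ, hγ, hb⟩ := exists_norm_add_emb_le κ
    refine ⟨κ + emb γ, by simpa using hb, ?_, opTrace_add (add_mem_nzcls hγ) m κ⟩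
    rintro ⟨i, hi, h0⟩
    refine hκ ⟨i + γ, (add_mem_nzcls hγ i).mpr hi, ?_⟩
    rw [emb_add, ← h0]
    ring

end

/-! ### Arithmetic of the trace at zero quasi-momentum -/

section

variable {β : (ℤ × ℤ) →₀ ℂ} {Y : Set (ℤ × ℤ)}

lemma I_mem_𝔸 : I ∈ 𝔸 := by
  refine mem_𝔸.mpr (IsAlgebraic.of_pow two_pos ?_)
  rw [I_sq]
  exact isAlgebraic_one.neg

lemma ω_mem_𝔸 : ω ∈ 𝔸 := by
  refine mem_𝔸.mpr (IsAlgebraic.of_pow three_pos ?_)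
  rw [ω_cube]
  exact isAlgebraic_one

lemma sqrt_three_mem_𝔸 : ((√3 : ℝ) : ℂ) ∈ 𝔸 := by
  refine mem_𝔸.mpr (IsAlgebraic.of_pow two_pos ?_)
  rw [← ofReal_pow, Real.sq_sqrt (by norm_num)]
  exact mem_𝔸.mp (𝔸.natCast_mem 3)

lemma emb_mem_𝔸 (i : ℤ × ℤ) : emb i ∈ 𝔸 :=
  𝔸.add_mem (𝔸.mul_mem (𝔸.intCast_mem _) ω_mem_𝔸) (𝔸.intCast_mem _)

/-- A horizontal line that avoids all the poles. -/
def line (s : ℝ) : ℂ := I * √3 / 4 + 3 * s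

/-- The parameter at which the translated `line` hits the pole labelled `j`. -/
def linePole (j : ℤ × ℤ) : ℂ := -(emb j + I * √3 / 4) / 3

lemma linePole_mem_𝔸 (j : ℤ × ℤ) : linePole j ∈ 𝔸 :=
  𝔸.div_mem (𝔸.neg_mem (𝔸.add_mem (emb_mem_𝔸 j) (𝔸.div_mem (𝔸.mul_mem I_mem_𝔸 sqrt_three_mem_𝔸)
    (𝔸.natCast_mem 4)))) (𝔸.natCast_mem 3)

lemma linePole_im (j : ℤ × ℤ) : (linePole j).im = -(2 * j.1 + 1) * (√3 / 12) := by
  have : linePole j = -(emb j + ((√3 / 4 : ℝ) : ℂ) * I) * ((1 / 3 : ℝ) : ℂ) := by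
    rw [linePole]; push_cast; ring
  rw [this, im_mul_ofReal, neg_im, add_im, emb_im, im_ofReal_mul, I_im]
  ring

lemma two_mul_add_one_ne_zero (n : ℤ) : (2 * n + 1 : ℝ) ≠ 0 := by
  norm_cast
  omega

lemma linePole_im_ne_zero (j : ℤ × ℤ) : (linePole j).im ≠ 0 := by
  rw [linePole_im]
  exact mul_ne_zero (neg_ne_zero.mpr (two_mul_add_one_ne_zero _)) (by positivity)

lemma emb_add_line (j : ℤ × ℤ) (s : ℝ) : emb j + line s = 3 * (s - linePole j) := by
  rw [line, linePole]
  ring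

lemma emb_add_line_ne_zero (j : ℤ × ℤ) (s : ℝ) : emb j + line s ≠ 0 := by
  rw [emb_add_line]
  refine mul_ne_zero three_ne_zero (sub_ne_zero.mpr fun h => linePole_im_ne_zero j ?_)
  rw [← h, ofReal_im]

lemma smul_mem_fracSpan {W : Set ℂ} {m : ℕ} {c : ℂ} (hc : c ∈ 𝔸) {g : ℝ → ℂ}
    (hg : g ∈ fracSpan W m) : (fun s => c * g s) ∈ fracSpan W m :=
  (fracSpan W m).smul_mem (⟨c, hc⟩ : 𝔸) hg

lemma zero_mem_fracSpan (W : Set ℂ) (m : ℕ) : (fun _ => 0) ∈ fracSpan W m :=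
  (fracSpan W m).zero_mem

lemma op_pow_single_mem_fracSpan (halg : ∀ d, β d ∈ 𝔸) {D : ℝ} (hD0 : 0 ≤ D)
    (hD : ∀ d ∈ β.support, ‖emb d‖ ≤ D) (i : ℤ × ℤ) (m : ℕ) (a : ℕ) (ha : a ≤ m) (j : ℤ × ℤ) :
    (fun s : ℝ => (op β Y (line s) ^ a) (Pi.single i 1) j) ∈
      fracSpan (linePole '' {j | ‖emb j - emb i‖ ≤ m * D}) a := by
  induction a generalizing j with
  | zero =>
    by_cases hij : j = i
    · subst hij
      simpa using one_mem_fracSpan _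
    · simpa [Pi.single_apply, hij] using zero_mem_fracSpan _ _
  | succ a ih =>
    by_cases hj : ‖emb j - emb i‖ ≤ m * D
    · by_cases hjY : j ∈ Y
      · have h1 : (fun s : ℝ => ∑ d ∈ β.support, β d * (op β Y (line s) ^ a) (Pi.single i 1) (j - d)) ∈
            fracSpan (linePole '' {j | ‖emb j - emb i‖ ≤ m * D}) a := by
          have := Submodule.sum_mem _ fun d (_ : d ∈ β.support) =>
            smul_mem_fracSpan (halg d) (ih (Nat.le_of_succ_le ha) (j - d))
          convert this using 1
          funext s
          rw [Finset.sum_apply]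
        have h2 := smul_mem_fracSpan (𝔸.inv_mem (𝔸.natCast_mem 3))
          (inv_sub_mul_mem_fracSpan (Set.mem_image_of_mem linePole hj) h1)
        convert h2 using 1
        funext s
        rw [pow_succ', Module.End.mul_apply, op_apply_of_mem hjY, hop_apply, emb_add_line]
        push_cast
        rw [div_eq_mul_inv, mul_inv]
        ring
      · simpa [pow_succ', op_apply_of_notMem hjY] using zero_mem_fracSpan _ _
    · have h0 : ∀ s : ℝ, (op β Y (line s) ^ (a + 1)) (Pi.single i 1) j = 0 := by
        refine fun s => op_pow_single_eq_zero hD i (a + 1) j (lt_of_le_of_lt ?_ (not_le.mp hj))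
        exact mul_le_mul_of_nonneg_right (by exact_mod_cast ha) hD0
      simpa [h0] using zero_mem_fracSpan _ _

/-- Division with remainder by three in the second coordinate. -/
def columnEquiv : (ℤ × Fin 3) × ℤ ≃ ℤ × ℤ :=
  (Equiv.prodAssoc ℤ (Fin 3) ℤ).trans
    (Equiv.prodCongr (Equiv.refl ℤ) ((Equiv.prodComm _ _).trans (Int.divModEquiv 3).symm))

lemma columnEquiv_apply (p : ℤ × Fin 3) (l : ℤ) : columnEquiv (p, l) = (p.1, (p.2 : ℤ)) + (0, 3 * l) := by
  simp [columnEquiv, Int.divModEquiv]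
  ring

lemma opTrace_zero_mem_piSpan (hβ : ∀ d, β (rot d) = ω * β d) (halg : ∀ d, β d ∈ 𝔸) {m : ℕ}
    (hm : 3 ≤ m) : opTrace β nzcls m 0 ∈ piSpan := by
  obtain ⟨D, hD0, hD⟩ := exists_support_bound β
  set f : ℤ × ℤ → ℝ → ℂ := fun i s => diagEntry β nzcls m (line s) i with hf
  have hfm : ∀ i, f i ∈ fracSpan (linePole '' {j | ‖emb j - emb i‖ ≤ m * D}) m := fun i =>
    op_pow_single_mem_fracSpan halg hD0 hD i m m le_rfl i
  have hW : ∀ S : Set (ℤ × ℤ), ∀ w ∈ linePole '' S, w.im ≠ 0 ∧ IsAlgebraic ℚ w := by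
    rintro S _ ⟨j, -, rfl⟩
    exact ⟨linePole_im_ne_zero j, mem_𝔸.mp (linePole_mem_𝔸 j)⟩
  have hint : ∀ i, Integrable (f i) := fun i =>
    integrable_of_mem_fracSpan (fun w hw => (hW _ w hw).1) (by omega) (hfm i)
  have h0 : ∀ i ∈ nzcls, emb i + (0 : ℂ) ≠ 0 := by
    intro i hi h
    rw [add_zero, emb_eq_zero] at h
    exact hi (h ▸ cls_zero)
  have hconst : ∀ s, opTrace β nzcls m (line s) = opTrace β nzcls m 0 := fun s =>
    opTrace_const hβ hm (fun i _ => emb_add_line_ne_zero i s) h0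
  have h1 : HasSum (fun i => ∫ s in (0 : ℝ)..1, f i s) (opTrace β nzcls m 0) := by
    have hc : IsCompact (line '' Set.Icc 0 1) :=
      isCompact_Icc.image (by unfold line; fun_prop)
    obtain ⟨A, hA⟩ := exists_norm_diagEntry_le β nzcls hc (by
      rintro i - _ ⟨s, -, rfl⟩
      exact emb_add_line_ne_zero i s) m
    have := intervalIntegral.hasSum_integral_of_dominated_convergence (a := 0) (b := 1) (μ := volume)
      (F := f) (f := fun _ => opTrace β nzcls m 0) (fun i _ => A / wt i ^ m)
      (fun i => (hint i).aestronglyMeasurable.restrict)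
      (fun i => Filter.Eventually.of_forall fun s hs => hA _ ⟨s, by
        rw [Set.uIoc_of_le zero_le_one] at hs
        exact Set.Ioc_subset_Icc_self hs, rfl⟩ i)
      (Filter.Eventually.of_forall fun s _ => summable_wt_pow hm A)
      (by simp)
      (Filter.Eventually.of_forall fun s _ => by
        rw [← hconst s]
        exact (summable_diagEntry (fun i _ => emb_add_line_ne_zero i s) hm).hasSum)
    simpa using this
  have h2 : HasSum (fun p : ℤ × Fin 3 => ∫ s, f (p.1, (p.2 : ℤ)) s) (opTrace β nzcls m 0) := by
    refine ((columnEquiv.hasSum_iff).mpr h1).prod_fiberwise fun p => ?_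
    have h := (hint (p.1, (p.2 : ℤ))).hasSum_intervalIntegral_comp_add_int
    have h' : (fun l : ℤ => ∫ s in (0 : ℝ)..1, f (columnEquiv (p, l)) s) =
        fun l : ℤ => ∫ s in (0 : ℝ)..1, f (p.1, (p.2 : ℤ)) (s + l) := by
      funext l
      refine intervalIntegral.integral_congr fun s _ => ?_
      show diagEntry β nzcls m (line s) (columnEquiv (p, l)) = diagEntry β nzcls m (line (s + l)) _
      rw [columnEquiv_apply, diagEntry_add (add_mem_nzcls ?_)]
      · congr 1
        simp only [line, emb]
        push_cast
        ring
      · rw [cls, ZMod.intCast_zmod_eq_zero_iff_dvd]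
        exact ⟨l, by push_cast; ring⟩
    rw [← h'] at h
    exact h
  obtain ⟨N, hN⟩ := exists_nat_gt (2 * (m * D))
  have hfar : ∀ i : ℤ × ℤ, ∀ j ∈ {j | ‖emb j - emb i‖ ≤ m * D}, |(j.1 - i.1 : ℝ)| < N := by
    intro i j hj
    have h3 := (norm_fst_le (j - i)).trans (norm_le_two_mul_norm_emb (j - i))
    rw [emb_sub, Int.norm_eq_abs, Prod.fst_sub, Int.cast_sub] at h3
    have hj' : ‖emb j - emb i‖ ≤ m * D := hj
    linarith
  have h3 : ∀ i : ℤ × ℤ, N < |i.1| → ∫ s, f i s = 0 := by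
    intro i hi
    rcases lt_abs.mp hi with hi | hi
    · refine integral_eq_zero_of_im_neg ?_ (by omega) (hfm i)
      rintro _ ⟨j, hj, rfl⟩
      refine ⟨?_, (hW _ _ ⟨j, hj, rfl⟩).2⟩
      have h4 := (abs_lt.mp (hfar i j hj)).1
      have h5 : (N : ℝ) < i.1 := by exact_mod_cast hi
      rw [linePole_im]
      exact mul_neg_of_neg_of_pos (by linarith) (by positivity)
    · refine integral_eq_zero_of_im_pos ?_ (by omega) (hfm i)
      rintro _ ⟨j, hj, rfl⟩
      refine ⟨?_, (hW _ _ ⟨j, hj, rfl⟩).2⟩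
      have h4 := (abs_lt.mp (hfar i j hj)).2
      have h5 : (N : ℝ) < -i.1 := by exact_mod_cast hi
      have h6 : j.1 ≤ -1 := by
        have : (j.1 : ℝ) < 0 := by linarith
        have : j.1 < 0 := by exact_mod_cast this
        omega
      have h7 : (j.1 : ℝ) ≤ -1 := by exact_mod_cast h6
      rw [linePole_im]
      exact mul_pos (by linarith) (by positivity)
  have h4 : ∀ p ∉ Finset.Icc (-(N : ℤ)) N ×ˢ (Finset.univ : Finset (Fin 3)),
      ∫ s, f (p.1, (p.2 : ℤ)) s = 0 := by
    intro p hp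
    refine h3 _ (not_le.mp fun h => hp ?_)
    rw [abs_le] at h
    simpa using h
  rw [h2.unique (hasSum_sum_of_ne_finset_zero h4)]
  exact Submodule.sum_mem _ fun p _ => integral_mem_piSpan (hW _) (by omega) (hfm _)

end

/-! ### Rotation invariant eigenvectors -/

section

variable {β : (ℤ × ℤ) →₀ ℂ} {Y : Set (ℤ × ℤ)} {κ : ℂ}

lemma summable_entries {A : Module.End ℂ (ℤ × ℤ → ℂ)} {b : ℝ} {s : ℕ} (hs : 3 ≤ s)
    (h : ∀ (J : Finset (ℤ × ℤ)) i, ∑ j ∈ J, ‖A (Pi.single j 1) i‖ ≤ b / wt i ^ s) :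
    Summable fun p : (ℤ × ℤ) × (ℤ × ℤ) => ‖A (Pi.single p.2 1) p.1‖ := by
  have hb : ∀ i, 0 ≤ b / wt i ^ s := fun i => by simpa using h ∅ i
  refine summable_of_sum_le (c := ∑' i, b / wt i ^ s) (fun _ => norm_nonneg _) fun u => ?_
  calc ∑ p ∈ u, ‖A (Pi.single p.2 1) p.1‖
      ≤ ∑ p ∈ u.image Prod.fst ×ˢ u.image Prod.snd, ‖A (Pi.single p.2 1) p.1‖ :=
        Finset.sum_le_sum_of_subset_of_nonneg Finset.subset_product fun _ _ _ => norm_nonneg _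
    _ = ∑ i ∈ u.image Prod.fst, ∑ j ∈ u.image Prod.snd, ‖A (Pi.single j 1) i‖ := Finset.sum_product _ _ _
    _ ≤ ∑ i ∈ u.image Prod.fst, b / wt i ^ s := Finset.sum_le_sum fun i _ => h _ i
    _ ≤ ∑' i, b / wt i ^ s := (summable_wt_pow hs b).sum_le_tsum _ fun i _ => hb i

lemma rowFinite_rotAt (q : ℤ × ℤ) : RowFinite (rotAt q) := by
  rw [rowFinite_iff]
  exact fun i => ⟨Finsupp.single (q + rot (i - q)) 1, fun v => by
    rw [Finsupp.sum_single_index (zero_mul _), one_mul, rotAt_apply]⟩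

/-- Averaging over the rotations about the origin. -/
def rotAvg : Module.End ℂ (ℤ × ℤ → ℂ) := (1 / 3 : ℂ) • (1 + rotAt 0 + rotAt 0 * rotAt 0)

lemma rotAvg_apply (v : ℤ × ℤ → ℂ) (i : ℤ × ℤ) :
    rotAvg v i = 1 / 3 * (v i + v (rot i) + v (rot (rot i))) := by
  simp [rotAvg, rotAt_apply]
  ring

lemma rowFinite_rotAvg : RowFinite rotAvg :=
  ((RowFinite.one.add (rowFinite_rotAt 0)).add ((rowFinite_rotAt 0).mul (rowFinite_rotAt 0))).smul _

lemma rotAvg_apply_rot (v : ℤ × ℤ → ℂ) (i : ℤ × ℤ) : rotAvg v (rot i) = rotAvg v i := by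
  rw [rotAvg_apply, rotAvg_apply, rot_rot_rot]
  ring

lemma rotAvg_eq_self {v : ℤ × ℤ → ℂ} (h : ∀ i, v (rot i) = v i) : rotAvg v = v := by
  funext i
  rw [rotAvg_apply, h (rot i), h i]
  ring

lemma rotAvg_mul_rotAvg : rotAvg * rotAvg = rotAvg :=
  LinearMap.ext fun v => rotAvg_eq_self (rotAvg_apply_rot v)

lemma commute_rotAvg_op (hβ : ∀ d, β (rot d) = ω * β d) : Commute rotAvg (op β nzcls 0) := by
  have h : Commute (rotAt 0) (op β nzcls 0) := LinearMap.ext fun v => by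
    have := rotAt_op hβ 0 (rot_mem_nzcls 0) v
    rwa [emb_zero, neg_zero] at this
  exact (((Commute.one_left _).add_left h).add_left (h.mul_left h)).smul_left _

lemma emb_add_zero_ne_zero : ∀ i ∈ nzcls, emb i + (0 : ℂ) ≠ 0 := by
  intro i hi h
  rw [add_zero, emb_eq_zero] at h
  exact hi (h ▸ cls_zero)

lemma exists_wt_le_nzcls : ∃ c, 0 < c ∧ ∀ i ∈ nzcls, c * wt i ≤ ‖emb i + (0 : ℂ)‖ := by
  obtain ⟨c, hc, h⟩ := exists_wt_le (isCompact_singleton (x := (0 : ℂ))) (Y := nzcls)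
    (by rintro i hi _ rfl; exact emb_add_zero_ne_zero i hi)
  exact ⟨c, hc, fun i hi => h i hi 0 rfl⟩

lemma sum_norm_single_le (J : Finset (ℤ × ℤ)) (i : ℤ × ℤ) :
    ∑ j ∈ J, ‖(Pi.single j 1 : ℤ × ℤ → ℂ) i‖ ≤ 1 := by
  have : ∀ j, ‖(Pi.single j 1 : ℤ × ℤ → ℂ) i‖ = if i = j then 1 else 0 := by
    intro j
    rw [Pi.single_apply]
    split_ifs <;> simp
  simp only [this, Finset.sum_ite_eq]
  split_ifs <;> norm_num

lemma sum_norm_rotAvg_single_le (J : Finset (ℤ × ℤ)) (i : ℤ × ℤ) :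
    ∑ j ∈ J, ‖rotAvg (Pi.single j 1) i‖ ≤ 1 := by
  calc ∑ j ∈ J, ‖rotAvg (Pi.single j 1) i‖
      ≤ ∑ j ∈ J, 1 / 3 * (‖(Pi.single j 1 : ℤ × ℤ → ℂ) i‖ + ‖(Pi.single j 1 : ℤ × ℤ → ℂ) (rot i)‖ +
          ‖(Pi.single j 1 : ℤ × ℤ → ℂ) (rot (rot i))‖) := by
        refine Finset.sum_le_sum fun j _ => ?_
        rw [rotAvg_apply, norm_mul]
        refine mul_le_mul (by norm_num) (norm_add₃_le) (norm_nonneg _) (by norm_num)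
    _ ≤ 1 := by
        rw [← Finset.mul_sum, Finset.sum_add_distrib, Finset.sum_add_distrib]
        linarith [sum_norm_single_le J i, sum_norm_single_le J (rot i), sum_norm_single_le J (rot (rot i))]

lemma op_pow_single_mem_𝔸 (halg : ∀ d, β d ∈ 𝔸) (a : ℕ) (j i : ℤ × ℤ) :
    (op β Y 0 ^ a) (Pi.single j 1) i ∈ 𝔸 := by
  induction a generalizing i with
  | zero =>
    rw [pow_zero, Module.End.one_apply, Pi.single_apply]
    split_ifs
    exacts [𝔸.one_mem, 𝔸.zero_mem]
  | succ a ih =>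
    rw [pow_succ', Module.End.mul_apply]
    by_cases hi : i ∈ Y
    · rw [op_apply_of_mem hi, add_zero]
      exact 𝔸.div_mem (𝔸.sum_mem fun d _ => 𝔸.mul_mem (halg d) (ih _)) (emb_mem_𝔸 i)
    · rw [op_apply_of_notMem hi]
      exact 𝔸.zero_mem

/-- The off-diagonal contributions to the trace on invariant vectors are finite algebraic sums. -/
lemma exists_hasSum_rotated (halg : ∀ d, β d ∈ 𝔸) (a : ℕ) {f : ℤ × ℤ → ℤ × ℤ} {c : ℂ} (hc : c ≠ 1)
    (hf : ∀ i, emb (f i) = c * emb i) :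
    ∃ s ∈ 𝔸, HasSum (fun i => (op β Y 0 ^ a) (Pi.single (f i) 1) i) s := by
  obtain ⟨D, -, hD⟩ := exists_support_bound β
  have hc' : 0 < ‖1 - c‖ := norm_pos_iff.mpr (sub_ne_zero.mpr hc.symm)
  set F := (finite_norm_emb_le (a * D / ‖1 - c‖)).toFinset with hF
  refine ⟨∑ i ∈ F, (op β Y 0 ^ a) (Pi.single (f i) 1) i,
    𝔸.sum_mem fun i _ => op_pow_single_mem_𝔸 halg a _ _, hasSum_sum_of_ne_finset_zero fun i hi => ?_⟩
  refine op_pow_single_eq_zero hD (f i) a i ?_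
  rw [hF, Set.Finite.mem_toFinset] at hi
  have : ¬ ‖emb i‖ ≤ a * D / ‖1 - c‖ := hi
  rw [not_le, div_lt_iff₀ hc'] at this
  rwa [hf, ← one_sub_mul, norm_mul, mul_comm ‖_‖]

lemma rotAvg_single (j : ℤ × ℤ) : rotAvg (Pi.single j 1) =
    (1 / 3 : ℂ) • (Pi.single j 1 + Pi.single (rot (rot j)) 1 + Pi.single (rot j) 1) := by
  funext i
  have h : ∀ i j, (Pi.single j 1 : ℤ × ℤ → ℂ) (rot i) = (Pi.single (rot (rot j)) 1 : ℤ × ℤ → ℂ) i := by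
    intro i j
    rw [Pi.single_apply, Pi.single_apply]
    congr 1
    rw [eq_iff_iff]
    constructor
    · rintro rfl
      rw [rot_rot_rot]
    · rintro rfl
      rw [rot_rot_rot]
  rw [rotAvg_apply, h, h, h, rot_rot_rot]
  rfl

lemma opTrace_eq_zero (hβ : ∀ d, β (rot d) = ω * β d) (halg : ∀ d, β d ∈ 𝔸)
    (hno : ∀ (z : ℂ) (v : ℤ × ℤ → ℂ), (∀ i, ‖v i‖ ≤ 1) → (∀ i, v (rot i) = v i) → v = z • (op β nzcls 0 ^ 4) v → v = 0)
    (n : ℕ) : opTrace β nzcls (4 * (n + 2)) 0 = 0 := by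
  set T := op β nzcls 0 with hT
  set A := T ^ 4 * rotAvg with hA
  have hcomm : Commute rotAvg (T ^ 4) := (commute_rotAvg_op hβ).pow_right 4
  have hAr : RowFinite A := (rowFinite_op.pow 4).mul rowFinite_rotAvg
  obtain ⟨c, hc, hwt⟩ := exists_wt_le_nzcls
  obtain ⟨b, hb⟩ := exists_sum_norm_op_pow_le β nzcls hc 1 0 4
  have hB := summable_entries (A := A) (b := b) (s := 4) (by norm_num) fun J i => by
    have := hb 0 hwt J (fun j => rotAvg (Pi.single j 1))
      (fun i => by simpa using sum_norm_rotAvg_single_le J i) i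
    rw [zero_add] at this
    exact this
  have hpow : ∀ n, A ^ (n + 1) = T ^ (4 * (n + 1)) * rotAvg := by
    intro n
    have : ∀ n, rotAvg ^ (n + 1) = rotAvg := fun n => by
      induction n with
      | zero => exact pow_one _
      | succ n ih => rw [pow_succ, ih, rotAvg_mul_rotAvg]
    rw [hA, hcomm.symm.mul_pow, this, pow_mul]
  have h1 := ktr_eq_zero_of_no_eigenvector (B := fun i j => A (Pi.single j 1) i) hB (fun z v hv1 hv => by
    have hv' : v = z • A v := funext fun i => by
      rw [hv i, (hAr.hasSum v i).tsum_eq]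
      rfl
    have hinv : rotAvg v = v := by
      have h2 : rotAvg * A = A := by
        rw [hA, ← mul_assoc, hcomm.eq, mul_assoc, rotAvg_mul_rotAvg]
      conv_lhs => rw [hv', map_smul, ← Module.End.mul_apply, h2, ← hv']
    refine hno z v hv1 (fun i => ?_) ?_
    · rw [← hinv, rotAvg_apply_rot]
    · rw [hA, Module.End.mul_apply, hinv] at hv'
      exact hv') n
  have h3le : 3 ≤ 4 * (n + 1 + 1) := by omega
  rw [ktr] at h1
  simp only [hAr.kpow, hpow (n + 1), Module.End.mul_apply, rotAvg_single, map_smul, map_add,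
    Pi.smul_apply, Pi.add_apply, smul_eq_mul] at h1
  have hω2 : ω * ω ≠ 1 := fun h => ω_ne_one (by linear_combination ω_cube - ω * h)
  obtain ⟨s, hs, hs'⟩ := exists_hasSum_rotated (Y := nzcls) halg (4 * (n + 1 + 1)) hω2
    (f := fun i => rot (rot i)) (fun i => by rw [emb_rot, emb_rot, mul_assoc])
  obtain ⟨t, ht, ht'⟩ := exists_hasSum_rotated (Y := nzcls) halg (4 * (n + 1 + 1)) ω_ne_one
    (f := rot) (fun i => emb_rot i)
  have h2 := (((summable_diagEntry (β := β) emb_add_zero_ne_zero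
    h3le).hasSum.add hs').add ht').mul_left (1 / 3)
  have h3 := h2.tsum_eq.symm.trans h1
  obtain ⟨y, hy, hy'⟩ := mem_piSpan.mp (opTrace_zero_mem_piSpan hβ halg
    h3le)
  have h4 : opTrace β nzcls (4 * (n + 1 + 1)) 0 = -(s + t) := by
    rw [opTrace]
    linear_combination 3 * h3
  exact eq_zero_of_mem_of_pi_mul (h4 ▸ 𝔸.neg_mem (𝔸.add_mem hs ht)) hy hy'

lemma exists_eigenvector_of_sq {E : Type*} [AddCommGroup E] [Module ℂ E] {M : Submodule ℂ E}
    {L : Module.End ℂ E} (hL : ∀ v ∈ M, L v ∈ M) {c : ℂ} (hc : c ≠ 0) {v : E} (hv : v ∈ M) (hv0 : v ≠ 0)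
    (h : L (L v) = c • v) : ∃ c' : ℂ, c' ≠ 0 ∧ ∃ w ∈ M, w ≠ 0 ∧ L w = c' • w := by
  obtain ⟨b, rfl⟩ := IsAlgClosed.exists_pow_nat_eq c two_pos
  have hb : b ≠ 0 := fun h => hc (by rw [h]; norm_num)
  by_cases hw : L v + b • v = 0
  · exact ⟨-b, neg_ne_zero.mpr hb, v, hv, hv0, by rw [neg_smul]; exact eq_neg_of_add_eq_zero_left hw⟩
  · refine ⟨b, hb, _, M.add_mem (hL v hv) (M.smul_mem b hv), hw, ?_⟩
    rw [map_add, h, map_smul, smul_add, smul_smul, pow_two, add_comm]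

/-- Bounded rotation invariant functions. -/
def bddInv : Submodule ℂ (ℤ × ℤ → ℂ) where
  carrier := {v | (∃ V : ℝ, ∀ i, ‖v i‖ ≤ V) ∧ ∀ i, v (rot i) = v i}
  add_mem' := by
    rintro v w ⟨⟨V, hV⟩, hv⟩ ⟨⟨W, hW⟩, hw⟩
    exact ⟨⟨V + W, fun i => (norm_add_le _ _).trans (add_le_add (hV i) (hW i))⟩,
      fun i => congrArg₂ (· + ·) (hv i) (hw i)⟩
  zero_mem' := ⟨⟨0, fun i => norm_zero.le⟩, fun i => rfl⟩
  smul_mem' := by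
    rintro c v ⟨⟨V, hV⟩, hv⟩
    exact ⟨⟨‖c‖ * V, fun i => (norm_smul_le _ _).trans (mul_le_mul_of_nonneg_left (hV i) (norm_nonneg c))⟩,
      fun i => congrArg (c * ·) (hv i)⟩

lemma exists_bound_op {c : ℝ} (hc : 0 < c) (hκ : ∀ i ∈ Y, c * wt i ≤ ‖emb i + κ‖) {v : ℤ × ℤ → ℂ} {V : ℝ}
    (hV : ∀ i, ‖v i‖ ≤ V) (a : ℕ) : ∃ A : ℝ, ∀ i, ‖(op β Y κ ^ a) v i‖ ≤ A / wt i ^ a := by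
  obtain ⟨A, hA⟩ := exists_norm_op_pow_le β Y hc V 0 a
  refine ⟨A, fun i => ?_⟩
  have := hA κ hκ v (by simpa using hV) i
  rwa [zero_add] at this

lemma op_mem_bddInv (hβ : ∀ d, β (rot d) = ω * β d) {v : ℤ × ℤ → ℂ} (hv : v ∈ bddInv) :
    op β nzcls 0 v ∈ bddInv := by
  obtain ⟨⟨V, hV⟩, hv⟩ := hv
  obtain ⟨c, hc, hwt⟩ := exists_wt_le_nzcls
  refine ⟨?_, ?_⟩
  · obtain ⟨A, hA⟩ := exists_bound_op (β := β) hc hwt hV 1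
    have hA0 : 0 ≤ A := by simpa [wt, emb_zero] using (norm_nonneg _).trans (hA 0)
    exact ⟨A, fun i => (hA i).trans (div_le_self hA0 (by simpa using one_le_wt i))⟩
  · intro i
    have h2 : op β nzcls 0 v = rotAvg (op β nzcls 0 v) := by
      conv_lhs => rw [← rotAvg_eq_self hv]
      exact (LinearMap.congr_fun (commute_rotAvg_op hβ) v).symm
    rw [h2, rotAvg_apply_rot]

/-- If the hopping operator has any eigenvector, it has a rotation invariant one. -/
theorem exists_invariant_eigenvector (hβ : ∀ d, β (rot d) = ω * β d) (halg : ∀ d, β d ∈ 𝔸)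
    {μ : ℂ} {v : ℤ × ℤ → ℂ} {V : ℝ} (hV : ∀ i, ‖v i‖ ≤ V) (hv0 : v ≠ 0)
    (hv : v = μ • op β nzcls 0 v) :
    ∃ ν : ℂ, ∃ w : ℤ × ℤ → ℂ, w ≠ 0 ∧ (∃ W : ℝ, ∀ i, ‖w i‖ ≤ W) ∧ (∀ i, w (rot i) = w i) ∧
      w = ν • op β nzcls 0 w := by
  set T := op β nzcls 0 with hT
  by_contra hcon
  have hno : ∀ (z : ℂ) (v : ℤ × ℤ → ℂ), (∀ i, ‖v i‖ ≤ 1) → (∀ i, v (rot i) = v i) → v = z • (T ^ 4) v → v = 0 := by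
    intro z v hv1 hvr hv
    by_contra hv0
    have hz : z ≠ 0 := by
      rintro rfl
      exact hv0 (by rw [hv, zero_smul])
    have hT1 : ∀ v ∈ bddInv, T v ∈ bddInv := fun v hv => op_mem_bddInv hβ hv
    have h4 : (T * T) ((T * T) v) = z⁻¹ • v := by
      conv_rhs => rw [hv, inv_smul_smul₀ hz]
      rfl
    obtain ⟨c, hc, w, hw, hw0, hwc⟩ := exists_eigenvector_of_sq (M := bddInv)
      (L := T * T) (fun v hv => hT1 _ (hT1 v hv)) (inv_ne_zero hz) ⟨⟨1, hv1⟩, hvr⟩ hv0 h4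
    obtain ⟨d, hd, w', hw', hw0', hwd⟩ := exists_eigenvector_of_sq hT1 hc hw hw0 hwc
    exact hcon ⟨d⁻¹, w', hw0', hw'.1, hw'.2, by rw [hwd, inv_smul_smul₀ hd]⟩
  have htr := opTrace_eq_zero hβ halg hno
  obtain ⟨c, hc, hwt⟩ := exists_wt_le_nzcls
  obtain ⟨b, hb⟩ := exists_sum_norm_op_pow_le β nzcls hc 1 0 8
  have hB := summable_entries (A := T ^ 8) (b := b) (s := 8) (by norm_num) fun J i => by
    have := hb 0 hwt J (fun j => Pi.single j 1) (fun i => by simpa using sum_norm_single_le J i) i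
    simpa using this
  have hr : RowFinite (T ^ 8) := rowFinite_op.pow 8
  refine hv0 (eq_zero_of_ktr_eq_zero (B := fun i j => (T ^ 8) (Pi.single j 1) i) hB (fun n => ?_) (μ ^ 8) v V hV fun i => ?_)
  · rw [ktr]
    simp only [hr.kpow, ← pow_mul]
    have := htr (2 * n)
    rwa [show 4 * (2 * n + 2) = 8 * (n + 1) by ring] at this
  · rw [(hr.hasSum v i).tsum_eq]
    have : ∀ a : ℕ, v = μ ^ a • (T ^ a) v := by
      intro a
      induction a with
      | zero => simp
      | succ a ih =>
        conv_lhs => rw [ih, hv]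
        rw [map_smul, smul_smul, pow_succ, pow_succ, Module.End.mul_apply]
    exact congr_fun (this 8) i

end

/-! ### Fourier coefficients -/

/-- The plane wave with wave vector `K * emb i`. -/
def mode (i : ℤ × ℤ) (z : ℂ) : ℂ := cexp (I * (pair (K * emb i) z : ℂ))

/-- Coordinates on the plane adapted to the lattice of periods. -/
def coord (s t : ℝ) : ℂ := ⟨3 / 2 * t, √3 * (s + t / 2)⟩

/-- The character with frequency `i` in the coordinates `coord`. -/
def char (i : ℤ × ℤ) (s t : ℝ) : ℂ := cexp (2 * Real.pi * I * (i.1 * s + i.2 * t))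

lemma char_add (i j : ℤ × ℤ) (s t : ℝ) : char (i + j) s t = char i s t * char j s t := by
  rw [char, char, char, ← Complex.exp_add]
  congr 1
  push_cast [Prod.fst_add, Prod.snd_add]
  ring

lemma norm_char (i : ℤ × ℤ) (s t : ℝ) : ‖char i s t‖ = 1 := by
  rw [char, show 2 * (Real.pi : ℂ) * I * (i.1 * s + i.2 * t) =
    ((2 * Real.pi * (i.1 * s + i.2 * t) : ℝ) : ℂ) * I by push_cast; ring, norm_exp_ofReal_mul_I]

lemma char_shift (i : ℤ × ℤ) (s t a b : ℝ) : char i (s + a) (t + b) = char i a b * char i s t := by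
  rw [char, char, char, ← Complex.exp_add]
  congr 1
  push_cast
  ring

lemma char_int (i : ℤ × ℤ) (m n : ℤ) : char i m n = 1 := by
  rw [char, ← Complex.exp_int_mul_two_pi_mul_I (i.1 * m + i.2 * n)]
  congr 1
  push_cast
  ring

lemma K_eq : K = ((4 * Real.pi / 3 : ℝ) : ℂ) := by
  rw [K]
  push_cast
  rfl

lemma pair_eq (z w : ℂ) : pair z w = z.re * w.re + z.im * w.im := by
  simp [pair]

lemma pair_K (z : ℂ) : pair z K = 4 * Real.pi / 3 * z.re := by
  rw [pair_eq, K_eq, ofReal_re, ofReal_im]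
  ring

lemma pair_K_mul (z w : ℂ) : pair (K * z) w = 4 * Real.pi / 3 * (z.re * w.re + z.im * w.im) := by
  rw [pair_eq, K_eq, re_ofReal_mul, im_ofReal_mul]
  ring

lemma pair_add_right (z w w' : ℂ) : pair z (w + w') = pair z w + pair z w' := by
  simp only [pair_eq, add_re, add_im]
  ring

lemma mode_coord (i : ℤ × ℤ) (s t : ℝ) : mode i (coord s t) = char i s t := by
  rw [mode, char, pair_K_mul, emb_re, emb_im, coord, mul_comm I]
  have h : (4 * Real.pi / 3 * ((i.2 - i.1 / 2) * (3 / 2 * t) + i.1 * (√3 / 2) * (√3 * (s + t / 2))) : ℝ)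
      = 2 * Real.pi * (i.1 * s + i.2 * t) := by
    linear_combination (2 * Real.pi / 3 * i.1 * (s + t / 2)) * sq_sqrt_three
  rw [h]
  congr 1
  push_cast
  ring

lemma exists_coord_eq (z : ℂ) : ∃ s t, coord s t = z := by
  refine ⟨z.im / √3 - z.re / 3, 2 / 3 * z.re, Complex.ext ?_ ?_⟩ <;> simp [coord]
  · ring
  · field_simp
    ring

lemma continuous_coord : Continuous fun p : ℝ × ℝ => coord p.1 p.2 := by
  have : (fun p : ℝ × ℝ => coord p.1 p.2) =
      fun p : ℝ × ℝ => ((3 / 2 * p.2 : ℝ) : ℂ) + ((√3 * (p.1 + p.2 / 2) : ℝ) : ℂ) * I := by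
    funext p
    exact (mk_eq_add_mul_I _ _)
  rw [this]
  fun_prop

lemma continuous_char (i : ℤ × ℤ) : Continuous fun p : ℝ × ℝ => char i p.1 p.2 := by
  unfold char
  fun_prop

/-- The Fourier coefficients of a function on the plane, in the coordinates `coord`. -/
def fc (f : ℂ → ℂ) (i : ℤ × ℤ) : ℂ :=
  ∫ s in (0 : ℝ)..1, ∫ t in (0 : ℝ)..1, f (coord s t) * char (-i) s t

lemma continuous_inner {f : ℂ → ℂ} (hf : Continuous f) (i : ℤ × ℤ) :
    Continuous fun s : ℝ => ∫ t in (0 : ℝ)..1, f (coord s t) * char (-i) s t :=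
  intervalIntegral.continuous_parametric_intervalIntegral_of_continuous'
    (f := fun s t => f (coord s t) * char (-i) s t)
    ((hf.comp continuous_coord).mul (continuous_char (-i))) 0 1

lemma continuous_section {f : ℂ → ℂ} (hf : Continuous f) (i : ℤ × ℤ) (s : ℝ) :
    Continuous fun t : ℝ => f (coord s t) * char (-i) s t :=
  ((hf.comp continuous_coord).mul (continuous_char (-i))).comp (Continuous.prodMk_right s)

lemma fc_add {f g : ℂ → ℂ} (hf : Continuous f) (hg : Continuous g) (i : ℤ × ℤ) :
    fc (fun z => f z + g z) i = fc f i + fc g i := by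
  simp only [fc, add_mul]
  rw [← intervalIntegral.integral_add ((continuous_inner hf i).intervalIntegrable _ _)
    ((continuous_inner hg i).intervalIntegrable _ _)]
  refine intervalIntegral.integral_congr fun s _ => ?_
  exact intervalIntegral.integral_add ((continuous_section hf i s).intervalIntegrable _ _)
    ((continuous_section hg i s).intervalIntegrable _ _)

lemma fc_const_mul (c : ℂ) (f : ℂ → ℂ) (i : ℤ × ℤ) : fc (fun z => c * f z) i = c * fc f i := by
  simp only [fc, mul_assoc, intervalIntegral.integral_const_mul]

lemma fc_zero (i : ℤ × ℤ) : fc (fun _ => 0) i = 0 := by simp [fc]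

lemma fc_sum {ι : Type*} (J : Finset ι) {f : ι → ℂ → ℂ} (hf : ∀ j ∈ J, Continuous (f j)) (i : ℤ × ℤ) :
    fc (fun z => ∑ j ∈ J, f j z) i = ∑ j ∈ J, fc (f j) i := by
  classical
  induction J using Finset.induction_on with
  | empty => simpa using fc_zero i
  | insert j J hj ih =>
    simp only [Finset.sum_insert hj]
    rw [fc_add (hf j (Finset.mem_insert_self j J))
      (continuous_finsetSum _ fun k hk => hf k (Finset.mem_insert_of_mem hk)),
      ih fun k hk => hf k (Finset.mem_insert_of_mem hk)]

lemma fc_mode_mul (d : ℤ × ℤ) (f : ℂ → ℂ) (i : ℤ × ℤ) :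
    fc (fun z => mode d z * f z) i = fc f (i - d) := by
  simp only [fc, mode_coord, neg_sub, sub_eq_add_neg d i, char_add]
  congr! 4
  ring

lemma norm_fc_le {f : ℂ → ℂ} {C : ℝ} (hC : ∀ z, ‖f z‖ ≤ C) (i : ℤ × ℤ) : ‖fc f i‖ ≤ C := by
  have h : ∀ s t : ℝ, ‖f (coord s t) * char (-i) s t‖ ≤ C := by
    intro s t
    rw [norm_mul, norm_char, mul_one]
    exact hC _
  have h1 : ∀ s : ℝ, ‖∫ t in (0 : ℝ)..1, f (coord s t) * char (-i) s t‖ ≤ C := fun s => by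
    simpa using intervalIntegral.norm_integral_le_of_norm_le_const (a := 0) (b := 1) fun t _ => h s t
  simpa [fc] using intervalIntegral.norm_integral_le_of_norm_le_const (a := 0) (b := 1) fun s _ => h1 s

lemma integral_exp_eq_zero {n : ℤ} (hn : n ≠ 0) :
    ∫ t in (0 : ℝ)..1, cexp (2 * Real.pi * I * (n * t)) = 0 := by
  have hc : 2 * Real.pi * I * n ≠ 0 :=
    mul_ne_zero two_pi_I_ne_zero (Int.cast_ne_zero.mpr hn)
  have h := integral_exp_mul_complex (a := 0) (b := 1) hc
  simp only [mul_assoc] at h ⊢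
  rw [h]
  have : cexp (2 * (Real.pi * (I * (n * ((1 : ℝ) : ℂ))))) = 1 := by
    rw [← Complex.exp_int_mul_two_pi_mul_I n]
    congr 1
    push_cast
    ring
  rw [this]
  simp

lemma fc_one (i : ℤ × ℤ) : fc (fun _ => 1) i = if i = 0 then 1 else 0 := by
  have h : ∀ s t, char (-i) s t = cexp (2 * Real.pi * I * ((-i.1 : ℤ) * s)) *
      cexp (2 * Real.pi * I * ((-i.2 : ℤ) * t)) := by
    intro s t
    rw [char, ← Complex.exp_add]
    congr 1
    push_cast [Prod.fst_neg, Prod.snd_neg]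
    ring
  simp only [fc, one_mul, h, intervalIntegral.integral_const_mul, intervalIntegral.integral_mul_const]
  split_ifs with hi
  · subst hi
    simp
  · by_cases h1 : i.1 = 0
    · have h2 : i.2 ≠ 0 := fun h2 => hi (Prod.ext h1 h2)
      rw [integral_exp_eq_zero (neg_ne_zero.mpr h2), mul_zero]
    · rw [integral_exp_eq_zero (neg_ne_zero.mpr h1), zero_mul]

lemma fc_mode (d i : ℤ × ℤ) : fc (mode d) i = if i = d then 1 else 0 := by
  have := fc_mode_mul d (fun _ => 1) i
  simp only [mul_one] at this
  rw [this, fc_one]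
  simp only [sub_eq_zero]

/-! ### Uniqueness of Fourier coefficients -/

lemma eq_zero_of_integral_char_eq_zero {g : ℝ → ℂ} (hg : Continuous g) (hper : ∀ t, g (t + 1) = g t)
    (h : ∀ n : ℤ, ∫ t in (0 : ℝ)..1, g t * cexp (2 * Real.pi * I * (n * t)) = 0) (t : ℝ) : g t = 0 := by
  have : Fact (0 < (1 : ℝ)) := ⟨one_pos⟩
  have hp : Function.Periodic g 1 := hper
  have hG : Continuous (hp.lift : AddCircle (1 : ℝ) → ℂ) := continuous_coinduced_dom.mpr hg
  let G : C(AddCircle (1 : ℝ), ℂ) := ⟨hp.lift, hG⟩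
  have h0 : fourierCoeff G = 0 := by
    funext n
    rw [fourierCoeff_eq_intervalIntegral _ n 0, zero_add, Pi.zero_apply]
    have : (∫ x in (0 : ℝ)..1, fourier (-n) (x : AddCircle (1 : ℝ)) • G x) =
        ∫ t in (0 : ℝ)..1, g t * cexp (2 * Real.pi * I * ((-n : ℤ) * t)) := by
      refine intervalIntegral.integral_congr fun x _ => ?_
      show fourier (-n) (x : AddCircle (1 : ℝ)) • hp.lift x = _
      rw [fourier_coe_apply, Function.Periodic.lift_coe, smul_eq_mul, mul_comm]
      congr 2
      push_cast
      ring
    rw [this, h (-n), smul_zero]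
  have hs := has_pointwise_sum_fourier_series_of_summable (f := G) (by rw [h0]; exact summable_zero)
    (t : AddCircle (1 : ℝ))
  simp only [h0, Pi.zero_apply, zero_smul] at hs
  exact hs.unique hasSum_zero

lemma coord_add_one_left (s t : ℝ) : coord (s + 1) t = coord s t + (2 * ω + 1) := by
  refine Complex.ext ?_ ?_ <;> simp [coord, ω_re, ω_im] <;> ring

lemma coord_add_one_right (s t : ℝ) : coord s (t + 1) = coord s t + (ω + 2) := by
  refine Complex.ext ?_ ?_ <;> simp [coord, ω_re, ω_im] <;> ring

/-- Periodicity with respect to the lattice of periods of the plane waves `mode i`. -/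
def Per (f : ℂ → ℂ) : Prop := (∀ z, f (z + (2 * ω + 1)) = f z) ∧ ∀ z, f (z + (ω + 2)) = f z

lemma char_add_one_left (i : ℤ × ℤ) (s t : ℝ) : char i (s + 1) t = char i s t := by
  have := char_shift i s t 1 0
  rw [add_zero] at this
  rw [this]
  have := char_int i 1 0
  push_cast at this
  rw [this, one_mul]

lemma char_add_one_right (i : ℤ × ℤ) (s t : ℝ) : char i s (t + 1) = char i s t := by
  have := char_shift i s t 0 1
  rw [add_zero] at this
  rw [this]
  have := char_int i 0 1
  push_cast at this
  rw [this, one_mul]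

lemma char_eq_mul (i : ℤ × ℤ) (s t : ℝ) :
    char i s t = cexp (2 * Real.pi * I * (i.1 * s)) * cexp (2 * Real.pi * I * (i.2 * t)) := by
  rw [char, ← Complex.exp_add, ← mul_add]

lemma eq_zero_of_fc_eq_zero {f : ℂ → ℂ} (hf : Continuous f) (hper : Per f) (h : ∀ i, fc f i = 0)
    (z : ℂ) : f z = 0 := by
  obtain ⟨s, t, rfl⟩ := exists_coord_eq z
  have hs : ∀ (n : ℤ) (s : ℝ), (∫ t in (0 : ℝ)..1, f (coord s t) * cexp (2 * Real.pi * I * (n * t))) = 0 := by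
    intro n
    have e : ∀ s t : ℝ, f (coord s t) * cexp (2 * Real.pi * I * (n * t)) =
        f (coord s t) * char (-(0, -n)) s t := by
      intro s t
      rw [char_eq_mul]
      simp
    refine eq_zero_of_integral_char_eq_zero ?_ ?_ ?_
    · simp only [e]
      exact continuous_inner hf _
    · intro s
      simp only [coord_add_one_left, hper.1]
    · intro m
      rw [← h (-m, -n), fc]
      refine intervalIntegral.integral_congr fun s _ => ?_
      show (∫ t in (0 : ℝ)..1, f (coord s t) * cexp (2 * Real.pi * I * (n * t))) *
        cexp (2 * Real.pi * I * (m * s)) = ∫ t in (0 : ℝ)..1, f (coord s t) * char (-(-m, -n)) s t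
      rw [← intervalIntegral.integral_mul_const]
      refine intervalIntegral.integral_congr fun t _ => ?_
      simp only [char_eq_mul, Prod.fst_neg, Prod.snd_neg, neg_neg]
      ring
  refine eq_zero_of_integral_char_eq_zero (g := fun t => f (coord s t)) ?_ ?_ (fun n => hs n s) t
  · exact (hf.comp continuous_coord).comp (Continuous.prodMk_right s)
  · intro t
    simp only [coord_add_one_right, hper.2]

/-! ### Floquet functions and derivatives -/

/-- Floquet functions of degree `c` over `Λ`. -/
def Floq (c : ℤ) (f : ℂ → ℂ) : Prop :=
  ∀ γ ∈ Λ, ∀ z : ℂ, f (z + γ) = cexp (c * I * (pair γ K : ℂ)) * f z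

lemma Floq.per {c : ℤ} {f : ℂ → ℂ} (hf : Floq c f) : Per f := by
  constructor <;> intro z
  · rw [hf (2 * ω + 1) ⟨2, 1, by push_cast; ring⟩ z, pair_K]
    have : (2 * ω + 1).re = 0 := by
      simp [ω_re]
      norm_num
    rw [this]
    simp
  · rw [hf (ω + 2) ⟨1, 2, by push_cast; ring⟩ z, pair_K]
    have : (ω + 2).re = 3 / 2 := by
      simp only [add_re, ω_re, re_ofNat]
      norm_num
    rw [this, show (c : ℂ) * I * ((4 * Real.pi / 3 * (3 / 2) : ℝ) : ℂ) = c * (2 * Real.pi * I) by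
      push_cast; ring, Complex.exp_int_mul_two_pi_mul_I, one_mul]

lemma Floq.mul {c d : ℤ} {f g : ℂ → ℂ} (hf : Floq c f) (hg : Floq d g) :
    Floq (c + d) fun z => f z * g z := by
  intro γ hγ z
  simp only [hf γ hγ z, hg γ hγ z]
  rw [show (((c + d : ℤ) : ℂ)) * I * (pair γ K : ℂ) = c * I * (pair γ K : ℂ) + d * I * (pair γ K : ℂ) by
    push_cast; ring, Complex.exp_add]
  ring

lemma Floq.add {c : ℤ} {f g : ℂ → ℂ} (hf : Floq c f) (hg : Floq c g) :
    Floq c fun z => f z + g z := by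
  intro γ hγ z
  simp only [hf γ hγ z, hg γ hγ z]
  ring

lemma Floq.const_mul {c : ℤ} {f : ℂ → ℂ} (hf : Floq c f) (b : ℂ) : Floq c fun z => b * f z := by
  intro γ hγ z
  simp only [hf γ hγ z]
  ring

lemma exp_third_ne_one {n : ℤ} (hn : (n : ZMod 3) ≠ 0) : cexp (2 * Real.pi * I * (n / 3)) ≠ 1 := by
  intro h
  obtain ⟨m, hm⟩ := Complex.exp_eq_one_iff.mp h
  have h1 : (n : ℂ) / 3 = m := by
    refine mul_left_cancel₀ two_pi_I_ne_zero ?_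
    rw [hm]
    ring
  have h2 : (n : ℂ) = ((3 * m : ℤ) : ℂ) := by
    push_cast
    linear_combination 3 * h1
  rw [Int.cast_injective h2] at hn
  refine hn ?_
  push_cast
  have : (3 : ZMod 3) = 0 := rfl
  rw [this, zero_mul]

lemma fc_eq_zero_of_floq {c : ℤ} {f : ℂ → ℂ} (hf : Floq c f) {i : ℤ × ℤ} (hi : cls i ≠ (c : ZMod 3)) :
    fc f i = 0 := by
  let F : ℝ → ℝ → ℂ := fun s t => f (coord s t) * char (-i) s t
  have hF1 : ∀ s t, F (s + 1) t = F s t := by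
    intro s t
    simp only [F, coord_add_one_left, char_add_one_left, hf.per.1]
  have hF2 : ∀ s t, F s (t + 1) = F s t := by
    intro s t
    simp only [F, coord_add_one_right, char_add_one_right, hf.per.2]
  set θ : ℂ := cexp (2 * Real.pi * I * ((2 * (c - (i.1 + i.2)) : ℤ) / 3)) with hθ
  have hcoord : ∀ s t, coord (s + -(1 / 3)) (t + 2 / 3) = coord s t + 1 := by
    intro s t
    refine Complex.ext ?_ ?_
    · simp [coord]
      ring
    · simp [coord]
      ring
  have h1 : (1 : ℂ) ∈ Λ := ⟨0, 1, by simp⟩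
  have hshift : ∀ s t, F (s + -(1 / 3)) (t + 2 / 3) = θ * F s t := by
    intro s t
    simp only [F]
    rw [hcoord, char_shift, hf 1 h1, pair_K, one_re]
    have : θ = cexp (c * I * ((4 * Real.pi / 3 * 1 : ℝ) : ℂ)) * char (-i) (-(1 / 3)) (2 / 3) := by
      rw [hθ, char, ← Complex.exp_add]
      refine Complex.exp_eq_exp_iff_exists_int.mpr ⟨-i.1, ?_⟩
      push_cast [Prod.fst_neg, Prod.snd_neg]
      ring
    rw [this]
    ring
  have hI : fc f i = ∫ s in (0 : ℝ)..1, ∫ t in (0 : ℝ)..1, F s t := rfl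
  have hI2 : (∫ s in (0 : ℝ)..1, ∫ t in (0 : ℝ)..1, F (s + -(1 / 3)) (t + 2 / 3)) = fc f i := by
    have e : ∀ s, (∫ t in (0 : ℝ)..1, F s (t + 2 / 3)) = ∫ t in (0 : ℝ)..1, F s t := by
      intro s
      rw [intervalIntegral.integral_comp_add_right (fun t => F s t), zero_add, add_comm (1 : ℝ)]
      have := Function.Periodic.intervalIntegral_add_eq (f := F s) (T := 1) (hF2 s) (2 / 3) 0
      rw [this, zero_add]
    simp only [e]
    rw [intervalIntegral.integral_comp_add_right (fun s => ∫ t in (0 : ℝ)..1, F s t), zero_add,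
      add_comm (1 : ℝ)]
    have hp : Function.Periodic (fun s => ∫ t in (0 : ℝ)..1, F s t) 1 := fun s => by
      simp only [hF1]
    rw [hp.intervalIntegral_add_eq (-(1 / 3)) 0, zero_add, hI]
  have hθ1 : θ ≠ 1 := by
    refine exp_third_ne_one ?_
    intro h0
    have h3 : ∀ x : ZMod 3, 2 * x = 0 → x = 0 := by decide
    push_cast at h0
    have := h3 _ h0
    refine hi ?_
    rw [cls]
    push_cast
    linear_combination -this
  simp only [hshift, intervalIntegral.integral_const_mul] at hI2
  rw [← hI] at hI2
  have : (θ - 1) * fc f i = 0 := by linear_combination hI2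
  exact (mul_eq_zero.mp this).resolve_left (sub_ne_zero.mpr hθ1)

/-- The linear map underlying `coord`. -/
def coordL : ℝ × ℝ →L[ℝ] ℂ :=
  ((√3 : ℂ) * I) • (ofRealCLM.comp (ContinuousLinearMap.fst ℝ ℝ ℝ)) +
    ((3 / 2 : ℂ) + √3 / 2 * I) • (ofRealCLM.comp (ContinuousLinearMap.snd ℝ ℝ ℝ))

lemma coordL_apply (p : ℝ × ℝ) : coordL p = coord p.1 p.2 := by
  refine Complex.ext ?_ ?_ <;> simp [coordL, coord] <;> ring

lemma coord_injective : Function.Injective fun p : ℝ × ℝ => coord p.1 p.2 := by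
  rintro ⟨s, t⟩ ⟨s', t'⟩ h
  have h1 := congrArg Complex.re h
  have h2 := congrArg Complex.im h
  simp only [coord] at h1 h2
  have h3 : t = t' := by linarith
  have h4 : s + t / 2 = s' + t' / 2 := mul_left_cancel₀ (by positivity) h2
  exact Prod.ext (by simp only; linarith) h3

/-- The exponent of `char i`, as a linear map. -/
def charL (i : ℤ × ℤ) : ℝ × ℝ →L[ℝ] ℂ :=
  (2 * Real.pi * I * i.1) • (ofRealCLM.comp (ContinuousLinearMap.fst ℝ ℝ ℝ)) +
    (2 * Real.pi * I * i.2) • (ofRealCLM.comp (ContinuousLinearMap.snd ℝ ℝ ℝ))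

lemma char_eq_exp (i : ℤ × ℤ) (p : ℝ × ℝ) : char i p.1 p.2 = cexp (charL i p) := by
  rw [char]
  congr 1
  simp [charL]
  ring

lemma fc_eq_of_Dbar {w H : ℂ → ℂ} {X : Set ℂ} (hw : Continuous w) (hper : Per w)
    (hX : X.Countable) (hH : Continuous H) (hd : ∀ z ∉ X, DifferentiableAt ℝ w z)
    (hD : ∀ z ∉ X, Dbar w z = H z) (i : ℤ × ℤ) : fc H i = K * emb i * fc w i := by
  classical
  set a : ℂ := 1 / I * (-1 / 3 + I * √3 / 3) with ha
  set b : ℂ := 1 / I * (2 / 3) with hb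
  let φ : ℝ × ℝ → ℂ := fun p => w (coord p.1 p.2) * char (-i) p.1 p.2
  let φ' : ℝ × ℝ → ℝ × ℝ →L[ℝ] ℂ := fun p =>
    w (coord p.1 p.2) • (cexp (charL (-i) p) • charL (-i)) +
      char (-i) p.1 p.2 • ((fderiv ℝ w (coord p.1 p.2)).comp coordL)
  let E : ℝ × ℝ → ℂ := fun p =>
    (H (coord p.1 p.2) - K * emb i * w (coord p.1 p.2)) * char (-i) p.1 p.2
  let s : Set (ℝ × ℝ) := (fun p : ℝ × ℝ => coord p.1 p.2) ⁻¹' X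
  have hs : s.Countable := hX.preimage_of_injOn coord_injective.injOn
  have hφc : Continuous φ := (hw.comp continuous_coord).mul (continuous_char (-i))
  have hEc : Continuous E := ((hH.comp continuous_coord).sub
    (continuous_const.mul (hw.comp continuous_coord))).mul (continuous_char (-i))
  have hφ : ∀ p ∉ s, HasFDerivAt φ (φ' p) p := by
    intro p hp
    have h1 : HasFDerivAt (fun p : ℝ × ℝ => coord p.1 p.2) coordL p := by
      have : (fun p : ℝ × ℝ => coord p.1 p.2) = coordL := funext fun p => (coordL_apply p).symm
      rw [this]
      exact coordL.hasFDerivAt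
    have h2 : HasFDerivAt (fun p : ℝ × ℝ => char (-i) p.1 p.2) (cexp (charL (-i) p) • charL (-i)) p := by
      have : (fun p : ℝ × ℝ => char (-i) p.1 p.2) = fun p => cexp (charL (-i) p) :=
        funext fun p => char_eq_exp _ p
      rw [this]
      exact (charL (-i)).hasFDerivAt.cexp
    have h3 : HasFDerivAt (fun p : ℝ × ℝ => w (coord p.1 p.2))
        ((fderiv ℝ w (coord p.1 p.2)).comp coordL) p :=
      HasFDerivAt.comp p (hd _ hp).hasFDerivAt h1
    exact h3.mul h2
  have hE : ∀ p ∉ s, a * φ' p (1, 0) + b * φ' p (0, 1) = E p := by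
    intro p hp
    have hDp := hD _ hp
    have e1 : coordL (1, 0) = √3 • I := by
      refine Complex.ext ?_ ?_ <;> simp [coordL]
    have e2 : coordL (0, 1) = (3 / 2 : ℝ) • (1 : ℂ) + (√3 / 2) • I := by
      refine Complex.ext ?_ ?_ <;> simp [coordL]
    have f1 : charL (-i) (1, 0) = -(2 * Real.pi * I * i.1) := by simp [charL]
    have f2 : charL (-i) (0, 1) = -(2 * Real.pi * I * i.2) := by simp [charL]
    have hemb : K * emb i = 2 * Real.pi * (2 / 3 * i.2 - i.1 / 3 + I * √3 / 3 * i.1) := by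
      refine Complex.ext ?_ ?_
      · rw [K_eq, re_ofReal_mul, emb_re]
        simp
        ring
      · rw [K_eq, im_ofReal_mul, emb_im]
        simp
        ring
    have h3 : (√3 : ℂ) * √3 = 3 := by
      rw [← ofReal_mul, ← sq, sq_sqrt_three]
      norm_num
    simp only [φ', E, _root_.add_apply, _root_.smul_apply,
      ContinuousLinearMap.comp_apply, e1, e2, f1, f2, map_add, map_smul, ← hDp, hemb, Dbar,
      ← char_eq_exp, ha, hb, one_div, inv_I]
    simp only [smul_eq_mul, real_smul]
    push_cast
    generalize fderiv ℝ w (coord p.1 p.2) 1 = A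
    generalize fderiv ℝ w (coord p.1 p.2) I = B
    generalize char (-i) p.1 p.2 = c
    generalize w (coord p.1 p.2) = W
    linear_combination (-c * B * I * I / 3) * h3 + (2 * Real.pi * W * c * (I * √3 / 3 * i.1 + 2 / 3 * i.2 - i.1 / 3)) * I_mul_I
  have hsum : ∀ p, (if p ∈ s then (ContinuousLinearMap.fst ℝ ℝ ℝ).smulRight (E p)
      else a • φ' p) (1, 0) + (if p ∈ s then (0 : ℝ × ℝ →L[ℝ] ℂ) else b • φ' p) (0, 1) = E p := by
    intro p
    by_cases hp : p ∈ s
    · simp [hp]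
    · rw [if_neg hp, if_neg hp, ← hE p hp]
      rfl
  have key := integral2_divergence_prod_of_hasFDerivAt_off_countable
    (fun p => a * φ p) (fun p => b * φ p)
    (fun p => if p ∈ s then (ContinuousLinearMap.fst ℝ ℝ ℝ).smulRight (E p)
      else a • φ' p)
    (fun p => if p ∈ s then 0 else b • φ' p) 0 0 1 1 s hs
    (continuous_const.mul hφc).continuousOn (continuous_const.mul hφc).continuousOn
    (fun p hp => by
      rw [if_neg hp.2]
      exact (hφ p hp.2).const_mul a)
    (fun p hp => by
      rw [if_neg hp.2]
      exact (hφ p hp.2).const_mul b)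
    (by
      simp only [hsum]
      exact hEc.continuousOn.integrableOn_compact (isCompact_uIcc.prod isCompact_uIcc))
  simp only [hsum] at key
  have hφ1 : ∀ t, φ (1, t) = φ (0, t) := by
    intro t
    have h1 := coord_add_one_left 0 t
    have h2 := char_add_one_left (-i) 0 t
    rw [zero_add] at h1 h2
    simp only [φ, h1, h2, hper.1]
  have hφ2 : ∀ s, φ (s, 1) = φ (s, 0) := by
    intro s
    have h1 := coord_add_one_right s 0
    have h2 := char_add_one_right (-i) s 0
    rw [zero_add] at h1 h2
    simp only [φ, h1, h2, hper.2]
  simp only [hφ1, hφ2, sub_self, zero_add] at key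
  have h4 : fc (fun z => H z + -(K * emb i) * w z) i = 0 := by
    rw [← key, fc]
    simp only [E]
    congr! 4
    ring
  rw [fc_add (g := fun z => -(K * emb i) * w z) hH (continuous_const.mul hw), fc_const_mul] at h4
  linear_combination h4

/-! ### Fourier series -/

/-- The phase of `mode i`, as a linear map. -/
def phase (i : ℤ × ℤ) : ℂ →L[ℝ] ℝ :=
  (4 * Real.pi / 3) • ((emb i).re • reCLM + (emb i).im • imCLM)

lemma phase_apply (i : ℤ × ℤ) (z : ℂ) : phase i z = pair (K * emb i) z := by
  rw [pair_K_mul]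
  simp [phase]
  ring

lemma norm_phase_le (i : ℤ × ℤ) : ‖phase i‖ ≤ 10 * wt i := by
  refine ContinuousLinearMap.opNorm_le_bound _ (by have := wt_pos i; positivity) fun z => ?_
  rw [phase_apply, pair, K_eq, mul_assoc, re_ofReal_mul, norm_mul, Real.norm_eq_abs, Real.norm_eq_abs,
    abs_of_pos (by positivity)]
  have h1 : |(emb i * (starRingEnd ℂ) z).re| ≤ ‖emb i‖ * ‖z‖ := by
    refine (abs_re_le_norm _).trans ?_
    rw [norm_mul, RCLike.norm_conj]
  have h2 : 4 * Real.pi / 3 ≤ 10 := by linarith [Real.pi_lt_four]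
  have h3 : ‖emb i‖ ≤ wt i := by
    rw [wt]
    linarith
  calc 4 * Real.pi / 3 * |(emb i * (starRingEnd ℂ) z).re| ≤ 10 * (‖emb i‖ * ‖z‖) := by gcongr
    _ ≤ 10 * (wt i * ‖z‖) := by gcongr
    _ = 10 * wt i * ‖z‖ := by ring

lemma mode_eq_comp (i : ℤ × ℤ) : mode i = (fun t : ℝ => cexp (I * t)) ∘ phase i := by
  funext z
  simp [mode, phase_apply]

lemma contDiff_exp_I_mul : ContDiff ℝ (⊤ : ℕ∞) fun t : ℝ => cexp (I * t) :=
  (contDiff_const.mul ofRealCLM.contDiff).cexp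

lemma contDiff_mode (i : ℤ × ℤ) : ContDiff ℝ (⊤ : ℕ∞) (mode i) := by
  rw [mode_eq_comp]
  exact contDiff_exp_I_mul.comp (phase i).contDiff

lemma continuous_mode (i : ℤ × ℤ) : Continuous (mode i) := (contDiff_mode i).continuous

lemma norm_mode (i : ℤ × ℤ) (z : ℂ) : ‖mode i z‖ = 1 := by
  rw [mode, mul_comm, norm_exp_ofReal_mul_I]

lemma iteratedDeriv_exp_I_mul (k : ℕ) :
    iteratedDeriv k (fun t : ℝ => cexp (I * t)) = fun t : ℝ => I ^ k * cexp (I * t) := by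
  induction k with
  | zero => simp
  | succ k ih =>
    rw [iteratedDeriv_succ, ih]
    funext t
    have h1 : HasDerivAt (fun t : ℝ => I * (t : ℂ)) (I * 1) t :=
      (ofRealCLM.hasDerivAt (x := t)).const_mul I
    have h2 := (h1.cexp.const_mul (I ^ k)).deriv
    rw [h2, pow_succ]
    ring

lemma norm_iteratedFDeriv_mode_le (i : ℤ × ℤ) (k : ℕ) (z : ℂ) :
    ‖iteratedFDeriv ℝ k (mode i) z‖ ≤ (10 * wt i) ^ k := by
  rw [mode_eq_comp, (phase i).iteratedFDeriv_comp_right contDiff_exp_I_mul z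
    (by exact_mod_cast le_top)]
  refine (ContinuousMultilinearMap.norm_compContinuousLinearMap_le _ _).trans ?_
  rw [norm_iteratedFDeriv_eq_norm_iteratedDeriv, iteratedDeriv_exp_I_mul, norm_mul, norm_pow, norm_I,
    one_pow, one_mul, mul_comm I, norm_exp_ofReal_mul_I, one_mul, Finset.prod_const, Finset.card_univ,
    Fintype.card_fin]
  exact pow_le_pow_left₀ (norm_nonneg _) (norm_phase_le i) k

lemma pair_omega (z w : ℂ) : pair (ω * z) (ω * w) = pair z w := by
  have h : ω * (starRingEnd ℂ) ω = 1 := by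
    rw [mul_conj, normSq_eq_norm_sq, norm_ω]
    simp
  rw [pair, pair, map_mul, show ω * z * ((starRingEnd ℂ) ω * (starRingEnd ℂ) w) =
    ω * (starRingEnd ℂ) ω * (z * (starRingEnd ℂ) w) by ring, h, one_mul]

lemma mode_rot (i : ℤ × ℤ) (z : ℂ) : mode (rot i) (ω * z) = mode i z := by
  rw [mode, mode, emb_rot, show K * (ω * emb i) = ω * (K * emb i) by ring, pair_omega]

lemma mode_add (i : ℤ × ℤ) (z w : ℂ) : mode i (z + w) = mode i w * mode i z := by
  rw [mode, mode, mode, pair_add_right, ← Complex.exp_add]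
  congr 1
  push_cast
  ring

lemma mode_neg (i : ℤ × ℤ) (z : ℂ) : mode i (-z) = mode (-i) z := by
  rw [mode, mode, emb_neg, pair_eq, pair_eq]
  congr 2
  simp
  ring

lemma floq_mode {c : ℤ} {i : ℤ × ℤ} (hi : cls i = (c : ZMod 3)) : Floq c (mode i) := by
  rintro γ ⟨m, n, rfl⟩ z
  rw [mode_add]
  congr 1
  rw [cls, ZMod.intCast_eq_intCast_iff_dvd_sub] at hi
  obtain ⟨q, hq⟩ := hi
  rw [mode, pair_K, pair_K_mul, Complex.exp_eq_exp_iff_exists_int]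
  refine ⟨i.1 * m - i.1 * n - 2 * q * n + q * m, ?_⟩
  have hre : ((m : ℂ) * ω + n).re = n - m / 2 := by
    simp [ω_re]
    ring
  have him : ((m : ℂ) * ω + n).im = m * √3 / 2 := by
    simp [ω_im]
    ring
  rw [hre, him, emb_re, emb_im]
  have h3 : (√3 : ℂ) * √3 = 3 := by
    rw [← ofReal_mul, ← sq, sq_sqrt_three]
    norm_num
  have hc : (c : ℂ) = i.1 + i.2 + 3 * q := by
    have : ((c : ℤ) : ℂ) = ((i.1 + i.2 + 3 * q : ℤ) : ℂ) := by
      congr 1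
      push_cast at hq
      linarith
    rw [this]
    push_cast
    ring
  rw [hc]
  push_cast
  linear_combination (Real.pi / 3 * I * i.1 * m) * h3

/-- The Fourier series with coefficients `v`. -/
def ser (v : ℤ × ℤ → ℂ) (z : ℂ) : ℂ := ∑' i, v i * mode i z

/-- Rapidly decreasing families. -/
def Rapid (v : ℤ × ℤ → ℂ) : Prop := ∀ s : ℕ, ∃ A : ℝ, ∀ i, ‖v i‖ ≤ A / wt i ^ s

lemma Rapid.summable {v : ℤ × ℤ → ℂ} (hv : Rapid v) : Summable fun i => ‖v i‖ := by
  obtain ⟨A, hA⟩ := hv 3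
  exact Summable.of_nonneg_of_le (fun _ => norm_nonneg _) hA (summable_wt_pow le_rfl A)

lemma Rapid.summable_mode {v : ℤ × ℤ → ℂ} (hv : Rapid v) (z : ℂ) :
    Summable fun i => v i * mode i z :=
  Summable.of_norm (by simpa [norm_mode] using hv.summable)

lemma Rapid.contDiff {v : ℤ × ℤ → ℂ} (hv : Rapid v) : ContDiff ℝ (⊤ : ℕ∞) (ser v) := by
  choose A hA using hv
  refine contDiff_tsum (v := fun k i => 10 ^ k * A (k + 3) / wt i ^ 3)
    (fun i => contDiff_const.mul (contDiff_mode i)) (fun k _ => summable_wt_pow le_rfl _) ?_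
  intro k i z _
  have hc : ContDiffAt ℝ k (mode i) z :=
    ((contDiff_mode i).of_le (by exact_mod_cast le_top)).contDiffAt
  have : iteratedFDeriv ℝ k (fun z => v i * mode i z) z = v i • iteratedFDeriv ℝ k (mode i) z :=
    iteratedFDeriv_const_smul_apply (a := v i) hc
  rw [this, norm_smul]
  have hw := wt_pos i
  calc ‖v i‖ * ‖iteratedFDeriv ℝ k (mode i) z‖ ≤ A (k + 3) / wt i ^ (k + 3) * (10 * wt i) ^ k := by
        gcongr
        · exact (norm_nonneg _).trans (hA (k + 3) i)
        · exact hA (k + 3) i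
        · exact norm_iteratedFDeriv_mode_le i k z
    _ = 10 ^ k * A (k + 3) / wt i ^ 3 := by
        rw [mul_pow, pow_add]
        field_simp

lemma Rapid.fc_ser {v : ℤ × ℤ → ℂ} (hv : Rapid v) (i : ℤ × ℤ) : fc (ser v) i = v i := by
  have hs := hv.summable
  have key : ∀ J : Finset (ℤ × ℤ), i ∈ J → ‖fc (ser v) i - v i‖ ≤ ∑' j, ‖v j‖ - ∑ j ∈ J, ‖v j‖ := by
    intro J hJ
    have h1 : fc (fun z => ser v z + ∑ j ∈ J, -v j * mode j z) i = fc (ser v) i - v i := by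
      rw [fc_add (g := fun z => ∑ j ∈ J, -v j * mode j z) hv.contDiff.continuous
        (continuous_finsetSum _ fun j _ => continuous_const.mul (continuous_mode j)),
        fc_sum (f := fun j z => -v j * mode j z) J fun j _ => continuous_const.mul (continuous_mode j)]
      simp only [fc_const_mul]
      simp only [fc_mode]
      simp [hJ, sub_eq_add_neg]
    rw [← h1]
    refine norm_fc_le (fun z => ?_) i
    have h2 := (hv.summable_mode z).sum_add_tsum_compl (s := J)
    have h3 := hs.sum_add_tsum_compl (s := J)
    have h4 : ser v z + ∑ j ∈ J, -v j * mode j z = ∑' j : ↑((J : Set (ℤ × ℤ))ᶜ), v j * mode j z := by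
      rw [ser, ← h2]
      simp only [neg_mul, Finset.sum_neg_distrib]
      ring
    rw [h4, ← h3, add_sub_cancel_left]
    refine (norm_tsum_le_tsum_norm ?_).trans (le_of_eq ?_)
    · simp only [norm_mul, norm_mode, mul_one]
      exact hs.subtype _
    · simp [norm_mode]
  have ht : Filter.Tendsto (fun J : Finset (ℤ × ℤ) => ∑' j, ‖v j‖ - ∑ j ∈ J, ‖v j‖) Filter.atTop
      (nhds (∑' j, ‖v j‖ - ∑' j, ‖v j‖)) := tendsto_const_nhds.sub hs.hasSum
  rw [sub_self] at ht
  have h0 : ‖fc (ser v) i - v i‖ ≤ 0 := by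
    refine ge_of_tendsto ht ?_
    filter_upwards [Filter.eventually_ge_atTop {i}] with J hJ
    exact key J (hJ (Finset.mem_singleton_self i))
  exact sub_eq_zero.mp (norm_le_zero_iff.mp h0)

lemma floq_ser {c : ℤ} {v : ℤ × ℤ → ℂ} (hv : ∀ i, cls i ≠ (c : ZMod 3) → v i = 0) : Floq c (ser v) := by
  intro γ hγ z
  rw [ser, ser, ← tsum_mul_left]
  refine tsum_congr fun i => ?_
  by_cases hi : cls i = (c : ZMod 3)
  · rw [floq_mode hi γ hγ z]
    ring
  · rw [hv i hi]
    ring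

lemma ser_rot {v : ℤ × ℤ → ℂ} (hv : ∀ i, v (rot i) = v i) (z : ℂ) : ser v (ω * z) = ser v z := by
  rw [ser, ser, ← rotEquiv.tsum_eq]
  refine tsum_congr fun i => ?_
  show v (rot i) * mode (rot i) (ω * z) = _
  rw [hv, mode_rot]

/-! ### The Dirac system on Fourier coefficients -/

/-- The trigonometric polynomial with coefficients `c`. -/
def pot (c : (ℤ × ℤ) →₀ ℂ) (z : ℂ) : ℂ := c.sum fun d b => b * mode d z

/-- Reflection of a coefficient family. -/
def refl (c : (ℤ × ℤ) →₀ ℂ) : (ℤ × ℤ) →₀ ℂ := c.mapDomain Neg.neg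

lemma hop_eq_sum (c : (ℤ × ℤ) →₀ ℂ) (v : ℤ × ℤ → ℂ) (i : ℤ × ℤ) :
    hop c v i = c.sum fun d b => b * v (i - d) := rfl

lemma hop_add_left (c c' : (ℤ × ℤ) →₀ ℂ) (v : ℤ × ℤ → ℂ) (i : ℤ × ℤ) :
    hop (c + c') v i = hop c v i + hop c' v i := by
  simp only [hop_eq_sum]
  exact Finsupp.sum_add_index' (by simp) (by intros; ring)

lemma hop_smul_left (b : ℂ) (c : (ℤ × ℤ) →₀ ℂ) (v : ℤ × ℤ → ℂ) (i : ℤ × ℤ) :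
    hop (b • c) v i = b * hop c v i := by
  simp only [hop_eq_sum]
  rw [Finsupp.sum_smul_index (by simp), Finsupp.sum, Finsupp.sum, Finset.mul_sum]
  exact Finset.sum_congr rfl fun _ _ => by ring

lemma hop_refl (c : (ℤ × ℤ) →₀ ℂ) (v : ℤ × ℤ → ℂ) (i : ℤ × ℤ) :
    hop (refl c) v i = c.sum fun d b => b * v (i + d) := by
  rw [hop_eq_sum, refl, Finsupp.sum_mapDomain_index_inj neg_injective]
  simp

lemma pot_neg (c : (ℤ × ℤ) →₀ ℂ) (z : ℂ) : pot c (-z) = pot (refl c) z := by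
  rw [pot, pot, refl, Finsupp.sum_mapDomain_index_inj neg_injective]
  simp only [mode_neg]

lemma contDiff_pot (c : (ℤ × ℤ) →₀ ℂ) : ContDiff ℝ (⊤ : ℕ∞) (pot c) := by
  unfold pot Finsupp.sum
  exact ContDiff.sum fun d _ => contDiff_const.mul (contDiff_mode d)

lemma fc_pot_mul (c : (ℤ × ℤ) →₀ ℂ) {f : ℂ → ℂ} (hf : Continuous f) (i : ℤ × ℤ) :
    fc (fun z => pot c z * f z) i = hop c (fc f) i := by
  rw [hop_apply]
  have : (fun z => pot c z * f z) = fun z => ∑ d ∈ c.support, c d * (mode d z * f z) := by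
    funext z
    rw [pot, Finsupp.sum, Finset.sum_mul]
    exact Finset.sum_congr rfl fun _ _ => by ring
  rw [this, fc_sum (f := fun d z => c d * (mode d z * f z)) c.support
    fun d _ => continuous_const.mul ((continuous_mode d).mul hf)]
  refine Finset.sum_congr rfl fun d _ => ?_
  rw [fc_const_mul, fc_mode_mul]

lemma floq_pot {c : (ℤ × ℤ) →₀ ℂ} {q : ℤ} (hc : ∀ d ∈ c.support, cls d = (q : ZMod 3)) :
    Floq q (pot c) := by
  intro γ hγ z
  rw [pot, pot, Finsupp.sum, Finsupp.sum, Finset.mul_sum]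
  refine Finset.sum_congr rfl fun d hd => ?_
  rw [floq_mode (hc d hd) γ hγ z]
  ring

lemma floq_pot_refl {c : (ℤ × ℤ) →₀ ℂ} (hc : ∀ d ∈ c.support, cls d = 1) :
    Floq (-1) (pot (refl c)) := by
  intro γ hγ z
  have h := floq_pot (q := 1) (c := c) (by simpa using hc) (-γ) (by
    obtain ⟨m, n, rfl⟩ := hγ
    exact ⟨-m, -n, by push_cast; ring⟩) (-z)
  rw [← pot_neg, ← pot_neg, neg_add, h]
  congr 2
  simp [pair]
  ring

/-- The part of a family in one residue class. -/
def part (q : ZMod 3) (v : ℤ × ℤ → ℂ) (i : ℤ × ℤ) : ℂ := if cls i = q then v i else 0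

lemma part_of_eq {q : ZMod 3} {i : ℤ × ℤ} (hi : cls i = q) (v : ℤ × ℤ → ℂ) : part q v i = v i :=
  if_pos hi

lemma part_of_ne {q : ZMod 3} {i : ℤ × ℤ} (hi : cls i ≠ q) (v : ℤ × ℤ → ℂ) : part q v i = 0 :=
  if_neg hi

/-- The Fourier coefficients of solutions of the Dirac system with potential `pot c`. -/
def IsCoef (c : (ℤ × ℤ) →₀ ℂ) (α k : ℂ) (v : ℤ × ℤ → ℂ) : Prop :=
  (∀ i, cls i = 0 → v i = 0) ∧
    ∀ i, cls i ≠ 0 → (K * emb i + k) * v i + α * hop (c + refl c) v i = 0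

section
variable {c : (ℤ × ℤ) →₀ ℂ} {α k : ℂ} {v : ℤ × ℤ → ℂ}

lemma hop_part_one (hc : ∀ d ∈ c.support, cls d = 1) (hv : ∀ i, cls i = 0 → v i = 0) (i : ℤ × ℤ) :
    hop c (part 1 v) i = part 2 (hop (c + refl c) v) i := by
  have h2 : ∀ x : ZMod 3, x - 1 = 1 ↔ x = 2 := by decide
  by_cases hi : cls i = 2
  · rw [part_of_eq hi]
    have h0 : hop (refl c) v i = 0 := by
      rw [hop_refl, Finsupp.sum]
      refine Finset.sum_eq_zero fun d hd => ?_
      rw [hv _ (by rw [cls_add, hc d hd, hi]; rfl), mul_zero]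
    rw [hop_add_left, h0, add_zero, hop_apply, hop_apply]
    refine Finset.sum_congr rfl fun d hd => ?_
    rw [part_of_eq (by rw [cls_sub, hc d hd, hi]; rfl)]
  · rw [part_of_ne hi, hop_apply]
    refine Finset.sum_eq_zero fun d hd => ?_
    rw [part_of_ne (by rw [Ne, cls_sub, hc d hd, h2]; exact hi), mul_zero]

lemma hop_part_two (hc : ∀ d ∈ c.support, cls d = 1) (hv : ∀ i, cls i = 0 → v i = 0) (i : ℤ × ℤ) :
    hop (refl c) (part 2 v) i = part 1 (hop (c + refl c) v) i := by
  have h2 : ∀ x : ZMod 3, x + 1 = 2 ↔ x = 1 := by decide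
  by_cases hi : cls i = 1
  · rw [part_of_eq hi]
    have h0 : hop c v i = 0 := by
      rw [hop_apply]
      refine Finset.sum_eq_zero fun d hd => ?_
      rw [hv _ (by rw [cls_sub, hc d hd, hi]; rfl), mul_zero]
    rw [hop_add_left, h0, zero_add, hop_refl, hop_refl]
    refine Finset.sum_congr rfl fun d hd => ?_
    show c d * part 2 v (i + d) = c d * v (i + d)
    rw [part_of_eq (by rw [cls_add, hc d hd, hi]; rfl)]
  · rw [part_of_ne hi, hop_refl]
    refine Finset.sum_eq_zero fun d hd => ?_
    show c d * part 2 v (i + d) = 0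
    rw [part_of_ne (by rw [Ne, cls_add, hc d hd, h2]; exact hi), mul_zero]

lemma norm_part_le (q : ZMod 3) (v : ℤ × ℤ → ℂ) (i : ℤ × ℤ) : ‖part q v i‖ ≤ ‖v i‖ := by
  rw [part]
  split_ifs <;> simp

lemma Rapid.part (hv : Rapid v) (q : ZMod 3) : Rapid (part q v) := by
  intro s
  obtain ⟨A, hA⟩ := hv s
  exact ⟨A, fun i => (norm_part_le q v i).trans (hA i)⟩

lemma four_le_norm_K : 4 ≤ ‖K‖ := by
  rw [K_eq, norm_real, Real.norm_eq_abs, abs_of_pos (by positivity)]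
  linarith [Real.pi_gt_three]

lemma le_norm_K_mul_emb_add (k : ℂ) (i : ℤ × ℤ) : 4 * ‖emb i‖ - ‖k‖ ≤ ‖K * emb i + k‖ := by
  have h1 := norm_sub_le (K * emb i + k) k
  rw [add_sub_cancel_right, norm_mul] at h1
  have h2 := mul_le_mul_of_nonneg_right four_le_norm_K (norm_nonneg (emb i))
  linarith

lemma exists_norm_hop_le (β : (ℤ × ℤ) →₀ ℂ) {A : ℝ} {s : ℕ} (h : ∀ i, ‖v i‖ ≤ A / wt i ^ s) :
    ∃ B, 0 ≤ B ∧ ∀ i, ‖hop β v i‖ ≤ B / wt i ^ s := by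
  have hA0 : 0 ≤ A := by
    have := (norm_nonneg _).trans (h 0)
    rwa [wt, emb_zero, norm_zero, add_zero, one_pow, div_one] at this
  refine ⟨A * ∑ d ∈ β.support, ‖β d‖ * wt d ^ s, ?_, fun i => ?_⟩
  · refine mul_nonneg hA0 (Finset.sum_nonneg fun d _ => ?_)
    have := wt_pos d
    positivity
  · have := sum_norm_hop_le (β := β) (J := {0}) (v := fun _ => v) (A := A) (s := s)
      (by simpa using h) i
    simpa using this

lemma IsCoef.rapid (hv : IsCoef c α k v) {V : ℝ} (hV : ∀ i, ‖v i‖ ≤ V) : Rapid v := by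
  intro s
  induction s with
  | zero => exact ⟨V, by simpa using hV⟩
  | succ s ih =>
    obtain ⟨A, hA⟩ := ih
    obtain ⟨B, hB0, hB⟩ := exists_norm_hop_le (c + refl c) hA
    have hA0 : 0 ≤ A := by
      have := (norm_nonneg _).trans (hA 0)
      rwa [wt, emb_zero, norm_zero, add_zero, one_pow, div_one] at this
    refine ⟨‖α‖ * B + A * (‖k‖ + 2), fun i => ?_⟩
    have hw := wt_pos i
    by_cases hi : cls i = 0
    · rw [hv.1 i hi, norm_zero]
      positivity
    rw [le_div_iff₀ (by positivity), pow_succ]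
    by_cases hik : ‖k‖ + 1 ≤ ‖emb i‖
    · have h1 : ‖K * emb i + k‖ * ‖v i‖ = ‖α‖ * ‖hop (c + refl c) v i‖ := by
        rw [← norm_mul, ← norm_mul, ← norm_neg (α * _)]
        congr 1
        linear_combination hv.2 i hi
      have h2 := hB i
      rw [le_div_iff₀ (by positivity)] at h2
      have h3 : wt i ≤ ‖K * emb i + k‖ := by
        refine le_trans ?_ (le_norm_K_mul_emb_add k i)
        rw [wt]
        linarith [norm_nonneg k]
      calc ‖v i‖ * (wt i ^ s * wt i) = wt i * ‖v i‖ * wt i ^ s := by ring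
        _ ≤ ‖K * emb i + k‖ * ‖v i‖ * wt i ^ s := by gcongr
        _ = ‖α‖ * (‖hop (c + refl c) v i‖ * wt i ^ s) := by rw [h1]; ring
        _ ≤ ‖α‖ * B := by gcongr
        _ ≤ ‖α‖ * B + A * (‖k‖ + 2) := le_add_of_nonneg_right (by positivity)
    · have h2 := hA i
      rw [le_div_iff₀ (by positivity)] at h2
      have h3 : wt i ≤ ‖k‖ + 2 := by
        rw [wt]
        linarith
      calc ‖v i‖ * (wt i ^ s * wt i) = ‖v i‖ * wt i ^ s * wt i := by ring
        _ ≤ A * (‖k‖ + 2) := by gcongr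
        _ ≤ ‖α‖ * B + A * (‖k‖ + 2) := le_add_of_nonneg_left (by positivity)

end

lemma Per.dbar {f : ℂ → ℂ} (hf : Per f) : Per (Dbar f) := by
  have h : ∀ γ, (∀ z, f (z + γ) = f z) → ∀ z, Dbar f (z + γ) = Dbar f z := by
    intro γ hγ z
    have : fderiv ℝ f (z + γ) = fderiv ℝ f z := by
      rw [← fderiv_comp_add_right]
      simp only [hγ]
    rw [Dbar, Dbar, this]
  exact ⟨h _ hf.1, h _ hf.2⟩

lemma continuous_Dbar {f : ℂ → ℂ} (hf : ContDiff ℝ (⊤ : ℕ∞) f) : Continuous (Dbar f) := by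
  have h := hf.continuous_fderiv (by simp)
  unfold Dbar
  exact continuous_const.mul ((h.clm_apply continuous_const).add
    (continuous_const.mul (h.clm_apply continuous_const)))

lemma Per.add {f g : ℂ → ℂ} (hf : Per f) (hg : Per g) : Per fun z => f z + g z :=
  ⟨fun z => by simp only [hf.1, hg.1], fun z => by simp only [hf.2, hg.2]⟩

lemma Per.mul {f g : ℂ → ℂ} (hf : Per f) (hg : Per g) : Per fun z => f z * g z :=
  ⟨fun z => by simp only [hf.1, hg.1], fun z => by simp only [hf.2, hg.2]⟩

lemma Per.const (b : ℂ) : Per fun _ => b := ⟨fun _ => rfl, fun _ => rfl⟩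

lemma Dbar_ser_add {v w : ℤ × ℤ → ℂ} {c : (ℤ × ℤ) →₀ ℂ} {α k : ℂ} {p q r : ℤ} (hv : Rapid v)
    (hw : Rapid w) (hvp : Floq p (ser v)) (hwq : Floq q (ser w)) (hc : Floq r (pot c))
    (h : ∀ i, (K * emb i + k) * v i + α * hop c w i = 0) (z : ℂ) :
    Dbar (ser v) z + k * ser v z + α * pot c z * ser w z = 0 := by
  have hvc := hv.contDiff
  have hwc := hw.contDiff
  have hD := continuous_Dbar hvc
  have hp := (contDiff_pot c).continuous.mul hwc.continuous
  have h1 : Continuous fun z => k * ser v z := continuous_const.mul hvc.continuous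
  have h2 : Continuous fun z => α * (pot c z * ser w z) := continuous_const.mul hp
  rw [mul_assoc]
  refine eq_zero_of_fc_eq_zero (f := fun z => Dbar (ser v) z + k * ser v z + α * (pot c z * ser w z))
    ((hD.add h1).add h2) ((hvp.per.dbar.add ((Per.const k).mul hvp.per)).add
      ((Per.const α).mul (hc.per.mul hwq.per))) (fun i => ?_) z
  rw [fc_add (f := fun z => Dbar (ser v) z + k * ser v z) (hD.add h1) h2, fc_add hD h1, fc_const_mul,
    fc_const_mul, fc_pot_mul c hwc.continuous, fc_eq_of_Dbar hvc.continuous hvp.per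
      (X := ∅) Set.countable_empty hD (fun z _ => (hvc.differentiable (by simp)) z) (fun _ _ => rfl),
    hv.fc_ser, show fc (ser w) = w from funext hw.fc_ser]
  linear_combination h i

/-! ### Regularity, synthesis and finite dimension -/

lemma Floq.exists_bound {q : ℤ} {f : ℂ → ℂ} (hf : Floq q f) (hc : Continuous f) :
    ∃ C : ℝ, ∀ z, ‖f z‖ ≤ C := by
  have hK : IsCompact (Set.Icc (0 : ℝ) 1 ×ˢ Set.Icc (0 : ℝ) 1) := isCompact_Icc.prod isCompact_Icc
  obtain ⟨C, hC⟩ := hK.exists_bound_of_continuousOn (hc.comp continuous_coord).continuousOn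
  refine ⟨C, fun z => ?_⟩
  obtain ⟨s, t, rfl⟩ := exists_coord_eq z
  have h1 : coord s t = coord (Int.fract s) (Int.fract t) +
      ((2 * ⌊s⌋ + ⌊t⌋ : ℤ) * ω + (⌊s⌋ + 2 * ⌊t⌋ : ℤ)) := by
    have hs := Int.fract_add_floor s
    have ht := Int.fract_add_floor t
    refine Complex.ext ?_ ?_
    · simp only [coord, add_re, mul_re, intCast_re, intCast_im, ω_re, ω_im]
      push_cast
      linear_combination (-3 / 2) * ht
    · simp only [coord, add_im, mul_im, intCast_re, intCast_im, ω_re, ω_im]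
      push_cast
      linear_combination (-√3) * hs + (-√3 / 2) * ht
  have h2 : ‖f (coord s t)‖ = ‖f (coord (Int.fract s) (Int.fract t))‖ := by
    rw [h1, hf _ ⟨_, _, rfl⟩, norm_mul]
    rw [show (q : ℂ) * I * (pair ((2 * ⌊s⌋ + ⌊t⌋ : ℤ) * ω + (⌊s⌋ + 2 * ⌊t⌋ : ℤ)) K : ℂ) =
      ((q * pair ((2 * ⌊s⌋ + ⌊t⌋ : ℤ) * ω + (⌊s⌋ + 2 * ⌊t⌋ : ℤ)) K : ℝ) : ℂ) * I by push_cast; ring,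
      norm_exp_ofReal_mul_I, one_mul]
  rw [h2]
  exact hC (Int.fract s, Int.fract t)
    ⟨⟨Int.fract_nonneg s, (Int.fract_lt_one s).le⟩, ⟨Int.fract_nonneg t, (Int.fract_lt_one t).le⟩⟩

/-- Continuous Floquet pairs solving the Dirac system outside of a countable set. -/
structure WeakSol (c : (ℤ × ℤ) →₀ ℂ) (α k : ℂ) (w : ℂ → ℂ × ℂ) (X : Set ℂ) : Prop where
  countable : X.Countable
  cont_fst : Continuous fun z => (w z).1
  cont_snd : Continuous fun z => (w z).2
  floq_fst : Floq (-1) fun z => (w z).1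
  floq_snd : Floq 1 fun z => (w z).2
  diff_fst : ∀ z ∉ X, DifferentiableAt ℝ (fun z => (w z).1) z
  diff_snd : ∀ z ∉ X, DifferentiableAt ℝ (fun z => (w z).2) z
  eq_fst : ∀ z ∉ X, Dbar (fun z => (w z).1) z + k * (w z).1 + α * pot c z * (w z).2 = 0
  eq_snd : ∀ z ∉ X, Dbar (fun z => (w z).2) z + k * (w z).2 + α * pot (refl c) z * (w z).1 = 0

/-- The Fourier coefficients of a pair of functions. -/
def coefs (w : ℂ → ℂ × ℂ) (i : ℤ × ℤ) : ℂ := fc (fun z => (w z).1) i + fc (fun z => (w z).2) i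

/-- The pair of functions with given Fourier coefficients. -/
def synth (v : ℤ × ℤ → ℂ) (z : ℂ) : ℂ × ℂ := (ser (part 2 v) z, ser (part 1 v) z)

section
variable {c : (ℤ × ℤ) →₀ ℂ} {α k : ℂ} {v : ℤ × ℤ → ℂ}

lemma part_coefs {w : ℂ → ℂ × ℂ} (h1 : Floq (-1) fun z => (w z).1) (h2 : Floq 1 fun z => (w z).2) :
    part 2 (coefs w) = fc (fun z => (w z).1) ∧ part 1 (coefs w) = fc (fun z => (w z).2) := by
  constructor <;> funext i
  · by_cases hi : cls i = 2
    · rw [part_of_eq hi, coefs, fc_eq_zero_of_floq h2 (by rw [hi]; decide), add_zero]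
    · rw [part_of_ne hi, fc_eq_zero_of_floq h1]
      rwa [show ((-1 : ℤ) : ZMod 3) = 2 by decide]
  · by_cases hi : cls i = 1
    · rw [part_of_eq hi, coefs, fc_eq_zero_of_floq h1 (by rw [hi]; decide), zero_add]
    · rw [part_of_ne hi, fc_eq_zero_of_floq h2]
      rwa [show ((1 : ℤ) : ZMod 3) = 1 by decide]

lemma coefs_eq_zero {w : ℂ → ℂ × ℂ} (h1 : Floq (-1) fun z => (w z).1) (h2 : Floq 1 fun z => (w z).2)
    {i : ℤ × ℤ} (hi : cls i = 0) : coefs w i = 0 := by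
  rw [coefs, fc_eq_zero_of_floq h1 (by rw [hi]; decide), fc_eq_zero_of_floq h2 (by rw [hi]; decide),
    add_zero]

lemma exists_norm_coefs_le {w : ℂ → ℂ × ℂ} (c1 : Continuous fun z => (w z).1)
    (c2 : Continuous fun z => (w z).2) (h1 : Floq (-1) fun z => (w z).1)
    (h2 : Floq 1 fun z => (w z).2) : ∃ V : ℝ, ∀ i, ‖coefs w i‖ ≤ V := by
  obtain ⟨A, hA⟩ := h1.exists_bound c1
  obtain ⟨B, hB⟩ := h2.exists_bound c2
  exact ⟨A + B, fun i => (norm_add_le _ _).trans (add_le_add (norm_fc_le hA i) (norm_fc_le hB i))⟩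

lemma fc_of_Dbar {c : (ℤ × ℤ) →₀ ℂ} {f g : ℂ → ℂ} {p : ℤ} {X : Set ℂ} (hX : X.Countable)
    (hf : Continuous f) (hg : Continuous g) (hfp : Floq p f)
    (hd : ∀ z ∉ X, DifferentiableAt ℝ f z)
    (h : ∀ z ∉ X, Dbar f z + k * f z + α * pot c z * g z = 0) (i : ℤ × ℤ) :
    (K * emb i + k) * fc f i + α * hop c (fc g) i = 0 := by
  have hp := (contDiff_pot c).continuous.mul hg
  have h1 : Continuous fun z => -k * f z := continuous_const.mul hf
  have h2 : Continuous fun z => -α * (pot c z * g z) := continuous_const.mul hp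
  have := fc_eq_of_Dbar (H := fun z => -k * f z + -α * (pot c z * g z)) hf hfp.per hX (h1.add h2) hd
    (fun z hz => by linear_combination h z hz) i
  rw [fc_add h1 h2, fc_const_mul, fc_const_mul, fc_pot_mul c hg] at this
  linear_combination -this

lemma WeakSol.isCoef (hc : ∀ d ∈ c.support, cls d = 1) {w : ℂ → ℂ × ℂ} {X : Set ℂ}
    (hw : WeakSol c α k w X) : IsCoef c α k (coefs w) := by
  obtain ⟨p2, p1⟩ := part_coefs hw.floq_fst hw.floq_snd
  have h0 : ∀ i, cls i = 0 → coefs w i = 0 := fun i => coefs_eq_zero hw.floq_fst hw.floq_snd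
  refine ⟨h0, fun i hi => ?_⟩
  have hcases : ∀ x : ZMod 3, x ≠ 0 → x = 1 ∨ x = 2 := by decide
  rcases hcases _ hi with hi | hi
  · have := fc_of_Dbar hw.countable hw.cont_snd hw.cont_fst hw.floq_snd hw.diff_snd hw.eq_snd i
    rwa [← p1, ← p2, hop_part_two hc h0, part_of_eq hi, part_of_eq hi] at this
  · have := fc_of_Dbar hw.countable hw.cont_fst hw.cont_snd hw.floq_fst hw.diff_fst hw.eq_fst i
    rwa [← p1, ← p2, hop_part_one hc h0, part_of_eq hi, part_of_eq hi] at this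

lemma IsCoef.synth_mem (hc : ∀ d ∈ c.support, cls d = 1) (hv : IsCoef c α k v) {V : ℝ}
    (hV : ∀ i, ‖v i‖ ≤ V) : synth v ∈ kerSet (pot c) (pot (refl c)) α k := by
  have hr := hv.rapid hV
  have hr1 := hr.part 1
  have hr2 := hr.part 2
  have f2 : Floq (-1) (ser (part 2 v)) := floq_ser fun i hi => part_of_ne hi v
  have f1 : Floq 1 (ser (part 1 v)) := floq_ser fun i hi => part_of_ne (by simpa using hi) v
  have fc1 : Floq 1 (pot c) := floq_pot (by simpa using hc)
  refine ⟨hr2.contDiff.prodMk hr1.contDiff, fun z => ?_, fun z => ?_, fun γ hγ z => ?_, fun γ hγ z => ?_⟩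
  · refine Dbar_ser_add hr2 hr1 f2 f1 fc1 (fun i => ?_) z
    rw [hop_part_one hc hv.1]
    by_cases hi : cls i = 2
    · rw [part_of_eq hi, part_of_eq hi]
      exact hv.2 i (by rw [hi]; decide)
    · rw [part_of_ne hi, part_of_ne hi, mul_zero, mul_zero, add_zero]
  · refine Dbar_ser_add hr1 hr2 f1 f2 (floq_pot_refl hc) (fun i => ?_) z
    rw [hop_part_two hc hv.1]
    by_cases hi : cls i = 1
    · rw [part_of_eq hi, part_of_eq hi]
      exact hv.2 i (by rw [hi]; decide)
    · rw [part_of_ne hi, part_of_ne hi, mul_zero, mul_zero, add_zero]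
  · have := f2 γ hγ z
    push_cast at this
    rwa [neg_one_mul] at this
  · have := f1 γ hγ z
    push_cast at this
    rwa [one_mul] at this

lemma eq_of_fc_eq {f g : ℂ → ℂ} (hf : Continuous f) (hg : Continuous g) (hfp : Per f) (hgp : Per g)
    (h : fc f = fc g) : f = g := by
  funext z
  have h2 : Continuous fun z => -1 * g z := continuous_const.mul hg
  have := eq_zero_of_fc_eq_zero (f := fun z => f z + -1 * g z) (hf.add h2)
    (hfp.add ((Per.const (-1)).mul hgp)) (fun i => by rw [fc_add hf h2, fc_const_mul, h]; ring) z
  linear_combination this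

lemma synth_coefs {w : ℂ → ℂ × ℂ} (c1 : Continuous fun z => (w z).1)
    (c2 : Continuous fun z => (w z).2) (h1 : Floq (-1) fun z => (w z).1)
    (h2 : Floq 1 fun z => (w z).2) (hr : Rapid (coefs w)) : synth (coefs w) = w := by
  obtain ⟨p2, p1⟩ := part_coefs h1 h2
  have hr1 := hr.part 1
  have hr2 := hr.part 2
  have e1 : ser (part 2 (coefs w)) = fun z => (w z).1 := by
    refine eq_of_fc_eq hr2.contDiff.continuous c1 ?_ h1.per ?_
    · exact (floq_ser (c := -1) fun i hi => part_of_ne hi _).per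
    · rw [← p2]
      exact funext hr2.fc_ser
  have e2 : ser (part 1 (coefs w)) = fun z => (w z).2 := by
    refine eq_of_fc_eq hr1.contDiff.continuous c2 ?_ h2.per ?_
    · exact (floq_ser (c := 1) fun i hi => part_of_ne (by simpa using hi) _).per
    · rw [← p1]
      exact funext hr1.fc_ser
  funext z
  exact Prod.ext (congrFun e1 z) (congrFun e2 z)

lemma coefs_synth (hv : ∀ i, cls i = 0 → v i = 0) (hr : Rapid v) : coefs (synth v) = v := by
  funext i
  show fc (ser (part 2 v)) i + fc (ser (part 1 v)) i = v i
  rw [(hr.part 2).fc_ser, (hr.part 1).fc_ser]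
  have hcases : ∀ x : ZMod 3, x = 0 ∨ x = 1 ∨ x = 2 := by decide
  rcases hcases (cls i) with hi | hi | hi
  · rw [part_of_ne (by rw [hi]; decide), part_of_ne (by rw [hi]; decide), hv i hi, add_zero]
  · rw [part_of_ne (by rw [hi]; decide), part_of_eq hi, zero_add]
  · rw [part_of_eq hi, part_of_ne (by rw [hi]; decide), add_zero]

lemma WeakSol.mem_kerSet (hc : ∀ d ∈ c.support, cls d = 1) {w : ℂ → ℂ × ℂ} {X : Set ℂ}
    (hw : WeakSol c α k w X) : w ∈ kerSet (pot c) (pot (refl c)) α k := by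
  obtain ⟨V, hV⟩ := exists_norm_coefs_le hw.cont_fst hw.cont_snd hw.floq_fst hw.floq_snd
  have h := hw.isCoef hc
  rw [← synth_coefs hw.cont_fst hw.cont_snd hw.floq_fst hw.floq_snd (h.rapid hV)]
  exact h.synth_mem hc hV

lemma weakSol_of_mem {u : ℂ → ℂ × ℂ} (hu : u ∈ kerSet (pot c) (pot (refl c)) α k) :
    WeakSol c α k u ∅ := by
  obtain ⟨h1, h2, h3, h4, h5⟩ := hu
  have d1 : ContDiff ℝ (⊤ : ℕ∞) fun z => (u z).1 := contDiff_fst.comp h1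
  have d2 : ContDiff ℝ (⊤ : ℕ∞) fun z => (u z).2 := contDiff_snd.comp h1
  refine ⟨Set.countable_empty, d1.continuous, d2.continuous, fun γ hγ z => ?_, fun γ hγ z => ?_,
    fun z _ => (d1.differentiable (by simp)) z, fun z _ => (d2.differentiable (by simp)) z,
    fun z _ => h2 z, fun z _ => h3 z⟩
  · have := h4 γ hγ z
    push_cast
    rwa [neg_one_mul]
  · have := h5 γ hγ z
    push_cast
    rwa [one_mul]

end

lemma Dbar_add {f g : ℂ → ℂ} {z : ℂ} (hf : DifferentiableAt ℝ f z) (hg : DifferentiableAt ℝ g z) :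
    Dbar (fun z => f z + g z) z = Dbar f z + Dbar g z := by
  rw [Dbar, Dbar, Dbar, fderiv_fun_add hf hg]
  simp only [_root_.add_apply]
  ring

lemma Dbar_const_mul {f : ℂ → ℂ} {z : ℂ} (hf : DifferentiableAt ℝ f z) (b : ℂ) :
    Dbar (fun z => b * f z) z = b * Dbar f z := by
  rw [Dbar, Dbar, fderiv_const_mul hf]
  simp only [_root_.smul_apply, smul_eq_mul]
  ring

lemma InKer.add {Up Um : ℂ → ℂ} {α k : ℂ} {u w : ℂ → ℂ × ℂ} (hu : InKer Up Um α k u)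
    (hw : InKer Up Um α k w) : InKer Up Um α k (u + w) := by
  obtain ⟨h1, h2, h3, h4, h5⟩ := hu
  obtain ⟨k1, k2, k3, k4, k5⟩ := hw
  have d1 : Differentiable ℝ fun z => (u z).1 := (contDiff_fst.comp h1).differentiable (by simp)
  have d2 : Differentiable ℝ fun z => (u z).2 := (contDiff_snd.comp h1).differentiable (by simp)
  have e1 : Differentiable ℝ fun z => (w z).1 := (contDiff_fst.comp k1).differentiable (by simp)
  have e2 : Differentiable ℝ fun z => (w z).2 := (contDiff_snd.comp k1).differentiable (by simp)
  refine ⟨h1.add k1, fun z => ?_, fun z => ?_, fun γ hγ z => ?_, fun γ hγ z => ?_⟩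
  · have := Dbar_add (d1 z) (e1 z)
    simp only [Pi.add_apply, Prod.fst_add, Prod.snd_add, this]
    linear_combination h2 z + k2 z
  · have := Dbar_add (d2 z) (e2 z)
    simp only [Pi.add_apply, Prod.fst_add, Prod.snd_add, this]
    linear_combination h3 z + k3 z
  · simp only [Pi.add_apply, Prod.fst_add, h4 γ hγ z, k4 γ hγ z]
    ring
  · simp only [Pi.add_apply, Prod.snd_add, h5 γ hγ z, k5 γ hγ z]
    ring

lemma InKer.smul {Up Um : ℂ → ℂ} {α k : ℂ} {u : ℂ → ℂ × ℂ} (hu : InKer Up Um α k u) (b : ℂ) :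
    InKer Up Um α k (b • u) := by
  obtain ⟨h1, h2, h3, h4, h5⟩ := hu
  have d1 : Differentiable ℝ fun z => (u z).1 := (contDiff_fst.comp h1).differentiable (by simp)
  have d2 : Differentiable ℝ fun z => (u z).2 := (contDiff_snd.comp h1).differentiable (by simp)
  refine ⟨contDiff_const.smul h1, fun z => ?_, fun z => ?_, fun γ hγ z => ?_, fun γ hγ z => ?_⟩
  · have := Dbar_const_mul (d1 z) b
    simp only [Pi.smul_apply, Prod.smul_fst, Prod.smul_snd, smul_eq_mul, this]
    linear_combination b * h2 z
  · have := Dbar_const_mul (d2 z) b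
    simp only [Pi.smul_apply, Prod.smul_fst, Prod.smul_snd, smul_eq_mul, this]
    linear_combination b * h3 z
  · simp only [Pi.smul_apply, Prod.smul_fst, h4 γ hγ z, smul_eq_mul]
    ring
  · simp only [Pi.smul_apply, Prod.smul_snd, h5 γ hγ z, smul_eq_mul]
    ring

lemma InKer.zero {Up Um : ℂ → ℂ} {α k : ℂ} : InKer Up Um α k 0 := by
  refine ⟨contDiff_const, fun z => ?_, fun z => ?_, fun γ hγ z => ?_, fun γ hγ z => ?_⟩ <;>
    simp [Dbar]

/-- `Ker(α,k)` as a submodule. -/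
def kerSub (Up Um : ℂ → ℂ) (α k : ℂ) : Submodule ℂ (ℂ → ℂ × ℂ) where
  carrier := kerSet Up Um α k
  add_mem' hu hw := InKer.add hu hw
  zero_mem' := InKer.zero
  smul_mem' b _ hu := InKer.smul hu b

lemma kerDim_eq (Up Um : ℂ → ℂ) (α k : ℂ) : kerDim Up Um α k = Module.finrank ℂ (kerSub Up Um α k) := by
  have : Submodule.span ℂ (kerSet Up Um α k) = kerSub Up Um α k :=
    Submodule.span_eq (kerSub Up Um α k)
  rw [kerDim, this]

section
variable {c : (ℤ × ℤ) →₀ ℂ} {α k : ℂ} {v : ℤ × ℤ → ℂ}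

lemma IsCoef.exists_finset (c : (ℤ × ℤ) →₀ ℂ) (α k : ℂ) : ∃ J : Finset (ℤ × ℤ),
    ∀ v, IsCoef c α k v → ∀ V : ℝ, (∀ i, ‖v i‖ ≤ V) → (∀ j ∈ J, v j = 0) → v = 0 := by
  set β := c + refl c with hβ
  set B := ∑ d ∈ β.support, ‖β d‖ with hB
  have hB0 : 0 ≤ B := Finset.sum_nonneg fun d _ => norm_nonneg _
  refine ⟨(finite_norm_emb_le (‖k‖ + 2 * ‖α‖ * B + 1)).toFinset, fun v hv V hV hJ => ?_⟩
  have hbdd : BddAbove (Set.range fun i => ‖v i‖) := ⟨V, by rintro _ ⟨i, rfl⟩; exact hV i⟩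
  set S := ⨆ i, ‖v i‖ with hS
  have hle : ∀ i, ‖v i‖ ≤ S := le_ciSup hbdd
  have hS0 : 0 ≤ S := (norm_nonneg _).trans (hle 0)
  have hhalf : ∀ i, ‖v i‖ ≤ S / 2 := by
    intro i
    by_cases hi : ‖emb i‖ ≤ ‖k‖ + 2 * ‖α‖ * B + 1
    · rw [hJ i (by simpa using hi), norm_zero]
      positivity
    by_cases hi0 : cls i = 0
    · rw [hv.1 i hi0, norm_zero]
      positivity
    push Not at hi
    have h1 : ‖K * emb i + k‖ * ‖v i‖ = ‖α‖ * ‖hop β v i‖ := by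
      rw [← norm_mul, ← norm_mul, ← norm_neg (α * _)]
      congr 1
      linear_combination hv.2 i hi0
    have h2 : ‖hop β v i‖ ≤ B * S := by
      rw [hop_apply, hB, Finset.sum_mul]
      refine norm_sum_le_of_le _ fun d _ => ?_
      rw [norm_mul]
      exact mul_le_mul_of_nonneg_left (hle _) (norm_nonneg _)
    have h3 : 2 * (‖α‖ * B) + 1 ≤ ‖K * emb i + k‖ := by
      have := le_norm_K_mul_emb_add k i
      have h5 : 0 ≤ ‖α‖ * B := by positivity
      nlinarith [norm_nonneg k]
    have h4 : (2 * (‖α‖ * B) + 1) * ‖v i‖ ≤ ‖α‖ * B * S := by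
      calc (2 * (‖α‖ * B) + 1) * ‖v i‖ ≤ ‖K * emb i + k‖ * ‖v i‖ := by gcongr
        _ = ‖α‖ * ‖hop β v i‖ := h1
        _ ≤ ‖α‖ * (B * S) := by gcongr
        _ = ‖α‖ * B * S := by ring
    have h5 : 0 ≤ ‖α‖ * B := by positivity
    have h6 : (2 * (‖α‖ * B) + 1) * ‖v i‖ ≤ (2 * (‖α‖ * B) + 1) * (S / 2) := by nlinarith
    exact le_of_mul_le_mul_left h6 (by positivity)
  have hS1 : S ≤ S / 2 := ciSup_le hhalf
  funext i
  exact norm_le_zero_iff.mp ((hle i).trans (by linarith))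

lemma finite_kerSub (hc : ∀ d ∈ c.support, cls d = 1) (α k : ℂ) :
    Module.Finite ℂ (kerSub (pot c) (pot (refl c)) α k) := by
  obtain ⟨J, hJ⟩ := IsCoef.exists_finset c α k
  let T : kerSub (pot c) (pot (refl c)) α k →ₗ[ℂ] (J → ℂ) :=
    { toFun := fun u j => coefs u.1 j
      map_add' := fun u w => by
        funext j
        have hu := weakSol_of_mem u.2
        have hw := weakSol_of_mem w.2
        show fc (fun z => (u.1 z).1 + (w.1 z).1) j + fc (fun z => (u.1 z).2 + (w.1 z).2) j = 
          coefs u.1 j + coefs w.1 j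
        rw [fc_add hu.cont_fst hw.cont_fst, fc_add hu.cont_snd hw.cont_snd, coefs, coefs]
        ring
      map_smul' := fun b u => by
        funext j
        show fc (fun z => b * (u.1 z).1) j + fc (fun z => b * (u.1 z).2) j = b * coefs u.1 j
        rw [fc_const_mul, fc_const_mul, coefs]
        ring }
  refine Module.Finite.of_injective T ((injective_iff_map_eq_zero T).mpr fun u hu => ?_)
  have hs := weakSol_of_mem u.2
  obtain ⟨V, hV⟩ := exists_norm_coefs_le hs.cont_fst hs.cont_snd hs.floq_fst hs.floq_snd
  have hcoef := hs.isCoef hc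
  have h0 : coefs u.1 = 0 := hJ _ hcoef V hV fun j hj => congrFun hu ⟨j, hj⟩
  have h1 := synth_coefs hs.cont_fst hs.cont_snd hs.floq_fst hs.floq_snd (hcoef.rapid hV)
  refine Subtype.ext ?_
  rw [← h1, h0]
  funext z
  simp [synth, ser, part]

lemma two_le_kerDim (hc : ∀ d ∈ c.support, cls d = 1) {u w : ℂ → ℂ × ℂ}
    (hu : u ∈ kerSet (pot c) (pot (refl c)) α k) (hw : w ∈ kerSet (pot c) (pot (refl c)) α k)
    (h : ∀ a b : ℂ, (∀ z, a • u z + b • w z = 0) → a = 0 ∧ b = 0) :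
    2 ≤ kerDim (pot c) (pot (refl c)) α k := by
  have := finite_kerSub hc α k
  rw [kerDim_eq]
  have hli : LinearIndependent ℂ ![(⟨u, hu⟩ : kerSub (pot c) (pot (refl c)) α k), ⟨w, hw⟩] := by
    rw [LinearIndependent.pair_iff]
    intro a b hab
    exact h a b fun z => congrFun (congrArg Subtype.val hab) z
  simpa using hli.fintype_card_le_finrank

end

/-! ### The coefficients of the potential -/

lemma fc_pot (c : (ℤ × ℤ) →₀ ℂ) (i : ℤ × ℤ) : fc (pot c) i = c i := by
  have := fc_pot_mul c (f := fun _ => 1) continuous_const i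
  simp only [mul_one] at this
  have h : fc (pot c) i = hop c (fc fun _ => 1) i := this
  rw [h, hop_apply]
  simp only [fc_one, sub_eq_zero]
  simp [eq_comm]

lemma pot_injective {c c' : (ℤ × ℤ) →₀ ℂ} (h : pot c = pot c') : c = c' := by
  ext i
  rw [← fc_pot, h, fc_pot]

lemma apply_rot_of_pot_omega {c : (ℤ × ℤ) →₀ ℂ} (h : ∀ z, pot c (ω * z) = ω * pot c z) (d : ℤ × ℤ) :
    c (rot d) = ω * c d := by
  have h1 : c = (ω • c).mapDomain rot := by
    refine pot_injective (funext fun z => ?_)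
    obtain ⟨y, rfl⟩ : ∃ y, ω * y = z := ⟨ω⁻¹ * z, by rw [← mul_assoc, mul_inv_cancel₀ ω_ne_zero, one_mul]⟩
    rw [h, pot, pot, Finsupp.sum_mapDomain_index_inj rot_injective, Finsupp.sum_smul_index (by simp),
      Finsupp.sum, Finsupp.sum, Finset.mul_sum]
    refine Finset.sum_congr rfl fun d _ => ?_
    rw [mode_rot]
    ring
  conv_lhs => rw [h1, Finsupp.mapDomain_apply rot_injective]
  simp

lemma exists_emb_of_mem_Λdual {p : ℂ} (hp : p ∈ Λdual) :
    ∃ d : ℤ × ℤ, cls d = 1 ∧ p + K = K * emb d := by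
  obtain ⟨m, n, rfl⟩ := hp
  refine ⟨(2 * n - m, n - 2 * m + 1), ?_, ?_⟩
  · rw [cls]
    push_cast
    have : (3 : ZMod 3) = 0 := rfl
    linear_combination (n - m : ZMod 3) * this
  · have h3 : (√3 : ℂ) * √3 = 3 := by
      rw [← ofReal_mul, ← sq, sq_sqrt_three]
      norm_num
    have hs : (√3 : ℂ) ≠ 0 := by
      intro h
      rw [h] at h3
      norm_num at h3
    have hω : ω = -1 / 2 + √3 / 2 * I := by
      refine Complex.ext ?_ ?_
      · simp [ω_re]
      · simp [ω_im]
    have h1 : I / √3 = (2 * ω + 1) / 3 := by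
      rw [hω, div_eq_div_iff hs (by norm_num)]
      linear_combination -I * h3
    rw [emb, K]
    push_cast
    linear_combination 4 * Real.pi * (m * ω + n) * h1 + 8 * Real.pi / 3 * m * ω_sq

section

open Filter Topology

/-! ### Quasi-periodic meromorphic functions -/

/-- The character of `Λ` with momentum `k`. -/
def chi (k : ℂ) (i : ℤ × ℤ) : ℂ := cexp (I * (pair k (emb i) : ℂ))

lemma chi_add (k : ℂ) (i j : ℤ × ℤ) : chi k (i + j) = chi k i * chi k j := by
  rw [chi, chi, chi, ← Complex.exp_add, emb_add, pair_add_right]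
  push_cast
  ring_nf

lemma chi_ne_zero (k : ℂ) (i : ℤ × ℤ) : chi k i ≠ 0 := Complex.exp_ne_zero _

lemma norm_chi (k : ℂ) (i : ℤ × ℤ) : ‖chi k i‖ = 1 := by
  rw [chi, mul_comm, norm_exp_ofReal_mul_I]

lemma chi_zero (k : ℂ) : chi k 0 = 1 := by
  simp [chi, emb_zero, pair_eq]

section
variable {P : Fin 3 → ℂ} {k p : ℂ}

/-- A rational function with simple poles at the points `P j`. -/
def kernel (P : Fin 3 → ℂ) (z : ℂ) : ℂ := ∏ j, (z - P j)⁻¹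

/-- The residue of `kernel P` at `q`. -/
def kernelRes (P : Fin 3 → ℂ) (q : ℂ) : ℂ :=
  ∑ j, if q = P j then ∏ l ∈ Finset.univ.erase j, (P j - P l)⁻¹ else 0

/-- The sum of `kernel P` over `Λ` twisted by a character. -/
def latSum (P : Fin 3 → ℂ) (k z : ℂ) : ℂ := ∑' i, (chi k i)⁻¹ * kernel P (z + emb i)

lemma kernelRes_of_ne {q : ℂ} (h : ∀ j, q ≠ P j) : kernelRes P q = 0 :=
  Finset.sum_eq_zero fun j _ => if_neg (h j)

lemma kernelRes_apply (hP : Function.Injective P) (j : Fin 3) :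
    kernelRes P (P j) = ∏ l ∈ Finset.univ.erase j, (P j - P l)⁻¹ := by
  rw [kernelRes, Finset.sum_eq_single j]
  · simp
  · intro l _ hl
    exact if_neg fun h => hl (hP h).symm
  · simp

lemma differentiableAt_kernel {q : ℂ} (h : ∀ j, q ≠ P j) : DifferentiableAt ℂ (kernel P) q := by
  unfold kernel
  refine DifferentiableAt.fun_finsetProd fun j _ => ?_
  exact (differentiableAt_id.sub_const _).inv (sub_ne_zero.mpr (h j))

lemma tendsto_mul_kernel (hP : Function.Injective P) (q : ℂ) :
    Tendsto (fun z => (z - q) * kernel P z) (𝓝[≠] q) (𝓝 (kernelRes P q)) := by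
  by_cases h : ∀ j, q ≠ P j
  · rw [kernelRes_of_ne h]
    have h1 : ContinuousAt (fun z => (z - q) * kernel P z) q :=
      (continuousAt_id.sub continuousAt_const).mul (differentiableAt_kernel h).continuousAt
    have h2 := h1.tendsto
    simp only [sub_self, zero_mul] at h2
    exact h2.mono_left nhdsWithin_le_nhds
  · push Not at h
    obtain ⟨j, rfl⟩ := h
    rw [kernelRes_apply hP]
    have h1 : ContinuousAt (fun z => ∏ l ∈ Finset.univ.erase j, (z - P l)⁻¹) (P j) := by
      refine tendsto_finsetProd _ fun l hl => ?_
      have : P j - P l ≠ 0 := sub_ne_zero.mpr fun h => (Finset.ne_of_mem_erase hl) (hP h).symm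
      exact ((continuousAt_id.sub continuousAt_const).inv₀ this)
    refine (h1.tendsto.mono_left nhdsWithin_le_nhds).congr' ?_
    filter_upwards [self_mem_nhdsWithin] with z hz
    rw [kernel, ← Finset.mul_prod_erase Finset.univ _ (Finset.mem_univ j), ← mul_assoc,
      mul_inv_cancel₀ (sub_ne_zero.mpr hz), one_mul]

lemma exists_latSum_eq (P : Fin 3 → ℂ) (k p : ℂ) (F₀ : Finset (ℤ × ℤ)) :
    ∃ F : Finset (ℤ × ℤ), F₀ ⊆ F ∧ ∃ T : ℂ → ℂ, DifferentiableOn ℂ T (Metric.ball p 1) ∧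
      ∀ z ∈ Metric.ball p 1,
        latSum P k z = ∑ i ∈ F, (chi k i)⁻¹ * kernel P (z + emb i) + T z := by
  classical
  set R : ℝ := ∑ j, ‖P j‖ + ‖p‖ + 1 with hR
  have hPj : ∀ j, ‖P j‖ ≤ ∑ j, ‖P j‖ := fun j =>
    Finset.single_le_sum (f := fun j => ‖P j‖) (fun _ _ => norm_nonneg _) (Finset.mem_univ j)
  have hR1 : 1 ≤ R := by
    have := (norm_nonneg _).trans (hPj 0)
    linarith [norm_nonneg p]
  set F := F₀ ∪ (finite_norm_emb_le (2 * R)).toFinset with hF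
  set t : ℤ × ℤ → ℂ → ℂ := fun i z => if i ∈ F then 0 else (chi k i)⁻¹ * kernel P (z + emb i) with ht
  have hnot : ∀ i ∉ F, 2 * R < ‖emb i‖ := by
    intro i hi
    by_contra hle
    exact hi (Finset.mem_union_right _ (by simpa using hle))
  have hlow : ∀ i ∉ F, ∀ z ∈ Metric.ball p 1, ∀ j, wt i / 4 ≤ ‖z + emb i - P j‖ := by
    intro i hi z hz j
    have h1 := hnot i hi
    have h2 : ‖z - p‖ < 1 := by simpa [dist_eq_norm] using hz
    have h3 : ‖emb i‖ ≤ ‖z + emb i - P j‖ + ‖z - p‖ + ‖p‖ + ‖P j‖ := by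
      calc ‖emb i‖ = ‖(z + emb i - P j) - (z - p) - p + P j‖ := by congr 1; ring
        _ ≤ _ := (norm_add_le _ _).trans (add_le_add_left ((norm_sub_le _ _).trans
          (add_le_add_left (norm_sub_le _ _) _)) _)
    have h4 := hPj j
    rw [wt]
    linarith
  have hbound : ∀ i, ∀ z ∈ Metric.ball p 1, ‖t i z‖ ≤ 64 / wt i ^ 3 := by
    intro i z hz
    have hw := wt_pos i
    by_cases hi : i ∈ F
    · simp only [ht, if_pos hi, norm_zero]
      positivity
    · simp only [ht, if_neg hi, norm_mul, norm_inv, norm_chi, inv_one, one_mul, kernel, norm_prod]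
      calc ∏ j, ‖z + emb i - P j‖⁻¹ ≤ ∏ _j : Fin 3, (wt i / 4)⁻¹ := by
            refine Finset.prod_le_prod (fun _ _ => by positivity) fun j _ => ?_
            exact inv_anti₀ (by positivity) (hlow i hi z hz j)
        _ = 64 / wt i ^ 3 := by
            rw [Finset.prod_const, Finset.card_univ, Fintype.card_fin, inv_div, div_pow]
            norm_num
  have hsum := summable_wt_pow (le_refl 3) 64
  refine ⟨F, Finset.subset_union_left, fun z => ∑' i, t i z, ?_, fun z hz => ?_⟩
  · refine differentiableOn_tsum_of_summable_norm hsum (fun i => ?_) Metric.isOpen_ball hbound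
    by_cases hi : i ∈ F
    · simp only [ht, if_pos hi]
      exact differentiableOn_const _
    · simp only [ht, if_neg hi]
      intro z hz
      refine DifferentiableAt.differentiableWithinAt ?_
      refine ((differentiableAt_kernel fun j h => ?_).comp z
        (differentiableAt_id.add_const (emb i))).const_mul _
      have := hlow i hi z hz j
      rw [show z + emb i = P j from h, sub_self, norm_zero] at this
      linarith [wt_pos i]
  · have hs2 : Summable fun i => t i z := Summable.of_norm_bounded hsum fun i => hbound i z hz
    have hs1 : Summable fun i => if i ∈ F then (chi k i)⁻¹ * kernel P (z + emb i) else 0 :=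
      summable_of_ne_finset_zero (s := F) fun i hi => if_neg hi
    have h1 : latSum P k z = ∑' i, ((if i ∈ F then (chi k i)⁻¹ * kernel P (z + emb i) else 0) + t i z) := by
      rw [latSum]
      refine tsum_congr fun i => ?_
      by_cases hi : i ∈ F <;> simp [ht, hi]
    rw [h1, hs1.tsum_add hs2, tsum_eq_sum (s := F) fun i hi => if_neg hi]
    congr 1
    exact Finset.sum_congr rfl fun i hi => if_pos hi

lemma differentiableAt_latSum (h : ∀ i j, p + emb i ≠ P j) : DifferentiableAt ℂ (latSum P k) p := by
  obtain ⟨F, -, T, hT, hG⟩ := exists_latSum_eq P k p ∅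
  have hball := Metric.ball_mem_nhds p one_pos
  have h1 : DifferentiableAt ℂ
      (fun z => ∑ i ∈ F, (chi k i)⁻¹ * kernel P (z + emb i) + T z) p := by
    refine DifferentiableAt.fun_add (DifferentiableAt.fun_sum fun i _ => ?_)
      ((hT p (Metric.mem_ball_self one_pos)).differentiableAt hball)
    exact ((differentiableAt_kernel (h i)).comp p (differentiableAt_id.add_const (emb i))).const_mul _
  refine h1.congr_of_eventuallyEq ?_
  filter_upwards [hball] with z hz using hG z hz

lemma tendsto_mul_latSum (hP : Function.Injective P) (F₀ : Finset (ℤ × ℤ))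
    (h : ∀ i ∉ F₀, ∀ j, p + emb i ≠ P j) :
    Tendsto (fun z => (z - p) * latSum P k z) (𝓝[≠] p)
      (𝓝 (∑ i ∈ F₀, (chi k i)⁻¹ * kernelRes P (p + emb i))) := by
  obtain ⟨F, hF, T, hT, hG⟩ := exists_latSum_eq P k p F₀
  have hball := Metric.ball_mem_nhds p one_pos
  have hTc : ContinuousAt T p :=
    ((hT p (Metric.mem_ball_self one_pos)).differentiableAt hball).continuousAt
  have h1 : ∑ i ∈ F₀, (chi k i)⁻¹ * kernelRes P (p + emb i) =
      ∑ i ∈ F, (chi k i)⁻¹ * kernelRes P (p + emb i) := by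
    refine Finset.sum_subset hF fun i _ hi => ?_
    rw [kernelRes_of_ne (h i hi), mul_zero]
  have h2 : Tendsto (fun z => ∑ i ∈ F, (chi k i)⁻¹ * ((z - p) * kernel P (z + emb i)) + (z - p) * T z)
      (𝓝[≠] p) (𝓝 (∑ i ∈ F, (chi k i)⁻¹ * kernelRes P (p + emb i) + (p - p) * T p)) := by
    refine Tendsto.add (tendsto_finsetSum _ fun i _ => Tendsto.const_mul _ ?_) ?_
    · have hm : Tendsto (fun z => z + emb i) (𝓝[≠] p) (𝓝[≠] (p + emb i)) := by
        refine tendsto_nhdsWithin_of_tendsto_nhds_of_eventually_within _ ?_ ?_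
        · exact (continuousAt_id.add continuousAt_const).tendsto.mono_left nhdsWithin_le_nhds
        · filter_upwards [self_mem_nhdsWithin] with z hz h
          exact hz (add_right_cancel h)
      have := (tendsto_mul_kernel hP (p + emb i)).comp hm
      refine this.congr fun z => ?_
      simp
    · exact ((continuousAt_id.sub continuousAt_const).mul hTc).tendsto.mono_left nhdsWithin_le_nhds
  rw [h1]
  rw [sub_self, zero_mul, add_zero] at h2
  refine h2.congr' ?_
  filter_upwards [nhdsWithin_le_nhds hball] with z hz
  rw [hG z hz, mul_add, Finset.mul_sum]
  congr 1
  exact Finset.sum_congr rfl fun i _ => by ring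

lemma latSum_add (P : Fin 3 → ℂ) (k z : ℂ) (j : ℤ × ℤ) :
    latSum P k (z + emb j) = chi k j * latSum P k z := by
  rw [latSum, latSum, ← tsum_mul_left, ← (Equiv.addRight j).tsum_eq fun i =>
    chi k j * ((chi k i)⁻¹ * kernel P (z + emb i))]
  refine tsum_congr fun i => ?_
  rw [Equiv.coe_addRight, chi_add, emb_add, mul_inv, add_assoc, add_comm (emb j)]
  field_simp [chi_ne_zero k j]

end

/-! ### Dividing by zeros at the stacking points -/

/-- The stacking point `i/√3`. -/
def zS : ℂ := I / √3

/-- The stacking points modulo `Λ`. -/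
def stack : Set ℂ := {z | ∃ i, z + emb i = zS ∨ z + emb i = -zS}

lemma zS_re : zS.re = 0 := by
  rw [zS, div_ofReal_re, I_re, zero_div]

lemma zS_im : zS.im = 1 / √3 := by
  rw [zS, div_ofReal_im, I_im]

lemma zS_im' : zS.im = √3 / 3 := by
  rw [zS_im, div_eq_div_iff (by positivity) (by norm_num)]
  linarith [sq_sqrt_three]

lemma two_mul_zS_ne (i : ℤ × ℤ) : 2 * zS ≠ emb i := by
  intro h
  have h1 := congrArg im h
  have h2 := congrArg re h
  simp only [mul_im, re_ofNat, im_ofNat, zS_im', zS_re, emb_im, mul_re] at h1 h2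
  have : (√3 : ℝ) ≠ 0 := by positivity
  have h3 : (2 : ℝ) * 2 = 3 * i.1 := mul_left_cancel₀ this (by linear_combination 6 * h1)
  have h4 : (2 : ℤ) * 2 = 3 * i.1 := by exact_mod_cast h3
  omega

lemma countable_stack : stack.Countable := by
  have : stack ⊆ Set.range (fun i => zS - emb i) ∪ Set.range (fun i => -zS - emb i) := by
    rintro z ⟨i, h | h⟩
    · exact Or.inl ⟨i, by simp [← h]⟩
    · exact Or.inr ⟨i, by simp [← h]⟩
  exact ((Set.countable_range _).union (Set.countable_range _)).mono this

lemma eventually_notMem_stack (p : ℂ) : ∀ᶠ z in 𝓝[≠] p, z ∉ stack := by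
  set R : ℝ := ‖p‖ + 1 + ‖zS‖ with hR
  have hfin := finite_norm_emb_le R
  set Y : Set ℂ := (fun i => zS - emb i) '' {i | ‖emb i‖ ≤ R} ∪ (fun i => -zS - emb i) '' {i | ‖emb i‖ ≤ R}
    with hY
  have hYfin : Y.Finite := (hfin.image _).union (hfin.image _)
  have h1 : ∀ᶠ z in 𝓝[≠] p, z ∉ Y := by
    have h2 : ∀ᶠ z in 𝓝 p, z ∉ Y \ {p} := (hYfin.subset Set.sdiff_subset).isClosed.isOpen_compl.mem_nhds (by simp)
    filter_upwards [nhdsWithin_le_nhds h2, self_mem_nhdsWithin] with z hz hzp h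
    exact hz ⟨h, hzp⟩
  filter_upwards [h1, nhdsWithin_le_nhds (Metric.ball_mem_nhds p one_pos)] with z hz hb
  rintro ⟨i, hi⟩
  have hz1 : ‖z‖ ≤ ‖p‖ + 1 := by
    have : ‖z - p‖ < 1 := by simpa [dist_eq_norm] using hb
    calc ‖z‖ = ‖p + (z - p)‖ := by ring_nf
      _ ≤ _ := (norm_add_le _ _).trans (by linarith)
  rcases hi with hi | hi
  · refine hz (Or.inl ⟨i, ?_, by simp [← hi]⟩)
    calc ‖emb i‖ = ‖zS - z‖ := by rw [← hi]; ring_nf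
      _ ≤ _ := (norm_sub_le _ _).trans (by linarith)
  · refine hz (Or.inr ⟨i, ?_, by simp [← hi]⟩)
    calc ‖emb i‖ = ‖-zS - z‖ := by rw [← hi]; ring_nf
      _ ≤ _ := (norm_sub_le _ _).trans (by rw [norm_neg]; linarith)

lemma isOpen_compl_stack : IsOpen stackᶜ := by
  refine isOpen_iff_mem_nhds.mpr fun p hp => ?_
  have h := eventually_notMem_stack p
  rw [eventually_nhdsWithin_iff] at h
  filter_upwards [h] with z hz
  by_cases hzp : z = p
  · rwa [hzp]
  · exact hz hzp

lemma add_emb_mem_stack {z : ℂ} (j : ℤ × ℤ) : z + emb j ∈ stack ↔ z ∈ stack := by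
  constructor
  · rintro ⟨i, hi⟩
    refine ⟨j + i, ?_⟩
    rwa [emb_add, ← add_assoc]
  · rintro ⟨i, hi⟩
    refine ⟨i - j, ?_⟩
    rwa [emb_sub, add_assoc, add_sub_cancel]

lemma zS_mem_stack : zS ∈ stack := ⟨0, Or.inl (by rw [emb_zero, add_zero])⟩

lemma neg_zS_mem_stack : -zS ∈ stack := ⟨0, Or.inr (by rw [emb_zero, add_zero])⟩

lemma exists_continuous_extension {g : ℂ → ℂ} (h1 : ∀ z ∉ stack, ContinuousAt g z)
    (h2 : ∀ p ∈ stack, ∃ B, Tendsto g (𝓝[≠] p) (𝓝 B)) :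
    ∃ w : ℂ → ℂ, Continuous w ∧ ∀ z ∉ stack, w z = g z := by
  classical
  choose! B hB using h2
  refine ⟨fun z => if z ∈ stack then B z else g z, ?_, fun z hz => if_neg hz⟩
  rw [continuous_iff_continuousAt]
  intro p
  by_cases hp : p ∈ stack
  · rw [← continuousWithinAt_compl_self, ContinuousWithinAt, if_pos hp]
    refine (hB p hp).congr' ?_
    filter_upwards [eventually_notMem_stack p] with z hz
    rw [if_neg hz]
  · refine (h1 p hp).congr ?_
    filter_upwards [isOpen_compl_stack.mem_nhds hp] with z hz
    rw [if_neg hz]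

/-! ### Vanishing at the stacking points -/

lemma omega_mul_zS : ω * zS = zS + emb (-1, -1) := by
  refine Complex.ext ?_ ?_
  · simp only [mul_re, ω_re, ω_im, zS_re, zS_im', add_re, emb_re]
    have := sq_sqrt_three
    push_cast
    nlinarith
  · simp only [mul_im, ω_re, ω_im, zS_re, zS_im', add_im, emb_im]
    push_cast
    ring

lemma pair_emb_K (i : ℤ × ℤ) : pair (emb i) K = 2 * Real.pi * ((2 * i.2 - i.1 : ℤ) / 3 : ℝ) := by
  rw [pair_K, emb_re]
  push_cast
  ring

lemma Floq.eq_zero_of_rot {q : ℤ} {f : ℂ → ℂ} (hf : Floq q f) (hq : (q : ZMod 3) ≠ 0)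
    (hrot : ∀ z, f (ω * z) = f z) : ∀ z ∈ stack, f z = 0 := by
  have key : ∀ p, ∀ i : ℤ × ℤ, ω * p = p + emb i → ((2 * i.2 - i.1 : ℤ) : ZMod 3) ≠ 0 → f p = 0 := by
    intro p i hp hi
    have h1 := hf (emb i) ⟨i.1, i.2, rfl⟩ p
    rw [← hp, hrot, pair_emb_K] at h1
    have h2 := exp_third_ne_one (n := q * (2 * i.2 - i.1)) (by
      have : Fact (Nat.Prime 3) := ⟨by norm_num⟩
      rw [Int.cast_mul]
      exact mul_ne_zero hq hi)
    by_contra h0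
    refine h2 ?_
    have h3 : cexp (q * I * ((2 * Real.pi * ((2 * i.2 - i.1 : ℤ) / 3 : ℝ) : ℝ) : ℂ)) = 1 :=
      mul_right_cancel₀ h0 (by rw [← h1, one_mul])
    rw [← h3]
    congr 1
    push_cast
    ring
  have h1 : f zS = 0 := key zS (-1, -1) omega_mul_zS (by decide)
  have h2 : f (-zS) = 0 := by
    refine key (-zS) (1, 1) ?_ (by decide)
    rw [mul_neg, omega_mul_zS, show ((1, 1) : ℤ × ℤ) = -(-1, -1) from rfl, emb_neg]
    ring
  rintro z ⟨i, hi⟩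
  have h3 := hf (emb i) ⟨i.1, i.2, rfl⟩ z
  have h4 : f (z + emb i) = 0 := by
    rcases hi with hi | hi <;> rw [hi] <;> assumption
  rw [h4] at h3
  exact (mul_eq_zero.mp h3.symm).resolve_left (Complex.exp_ne_zero _)

/-! ### The operator `Dbar` and holomorphic functions -/

lemma Dbar_mul {f g : ℂ → ℂ} {z : ℂ} (hf : DifferentiableAt ℝ f z) (hg : DifferentiableAt ℝ g z) :
    Dbar (fun z => f z * g z) z = Dbar f z * g z + f z * Dbar g z := by
  rw [Dbar, Dbar, Dbar, fderiv_fun_mul hf hg]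
  simp only [_root_.add_apply, _root_.smul_apply, smul_eq_mul]
  ring

lemma Dbar_eq_zero {f : ℂ → ℂ} {z : ℂ} (hf : DifferentiableAt ℂ f z) : Dbar f z = 0 := by
  rw [Dbar, hf.fderiv_restrictScalars ℝ]
  simp only [ContinuousLinearMap.coe_restrictScalars']
  have h : fderiv ℂ f z I = I * fderiv ℂ f z 1 := by
    rw [← smul_eq_mul, ← map_smul, smul_eq_mul, mul_one]
  rw [h, ← mul_assoc, I_mul_I]
  ring

lemma hasDerivAt_of_Dbar_eq_zero {f : ℂ → ℂ} {z : ℂ} (hf : DifferentiableAt ℝ f z)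
    (h : Dbar f z = 0) : HasDerivAt f (fderiv ℝ f z 1) z := by
  have h1 : fderiv ℝ f z I = I * fderiv ℝ f z 1 := by
    rw [Dbar] at h
    have h2 := (mul_eq_zero.mp h).resolve_left (by simp)
    linear_combination (-I) * h2 + (fderiv ℝ f z I) * I_mul_I
  rw [hasDerivAt_iff_hasFDerivAt]
  refine hasFDerivAt_of_restrictScalars ℝ hf.hasFDerivAt ?_
  ext w
  have hw : w = w.re • (1 : ℂ) + w.im • I := by simp
  conv_rhs => rw [hw, map_add, map_smul, map_smul, h1]
  simp
  linear_combination -(fderiv ℝ f z 1) * re_add_im w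

lemma tendsto_div_of_Dbar_eq_zero {f : ℂ → ℂ} {p : ℂ} (hf : DifferentiableAt ℝ f p)
    (h : Dbar f p = 0) (h0 : f p = 0) :
    Tendsto (fun z => (z - p)⁻¹ * f z) (𝓝[≠] p) (𝓝 (fderiv ℝ f p 1)) := by
  have := (hasDerivAt_of_Dbar_eq_zero hf h).tendsto_slope
  refine this.congr fun z => ?_
  rw [slope_def_field, h0]
  ring

/-- The exponential `exp(-i⟨k,z⟩)`. -/
def expo (k z : ℂ) : ℂ := cexp (-(I * (pair k z : ℂ)))

lemma hasFDerivAt_expo (k z : ℂ) : HasFDerivAt (expo k)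
    (expo k z • (-(I • (ofRealCLM.comp (k.re • reCLM + k.im • imCLM))))) z := by
  have h : HasFDerivAt (fun z => -(I * (pair k z : ℂ)))
      (-(I • (ofRealCLM.comp (k.re • reCLM + k.im • imCLM)))) z := by
    have h1 : (fun z => -(I * (pair k z : ℂ))) =
        fun z => (-(I • (ofRealCLM.comp (k.re • reCLM + k.im • imCLM)))) z := by
      funext z
      simp [pair_eq]
      ring
    rw [h1]
    exact ContinuousLinearMap.hasFDerivAt _
  exact h.cexp

lemma Dbar_expo (k z : ℂ) : Dbar (expo k) z = -k * expo k z := by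
  rw [Dbar, (hasFDerivAt_expo k z).fderiv]
  simp only [_root_.smul_apply, _root_.neg_apply, ContinuousLinearMap.comp_apply,
    _root_.add_apply, reCLM_apply, imCLM_apply, ofRealCLM_apply, smul_eq_mul, one_re, one_im, I_re, I_im]
  push_cast
  have : k = k.re + k.im * I := (re_add_im k).symm
  rw [one_div, inv_I]
  linear_combination (expo k z * (k.re + I * k.im)) * I_mul_I + expo k z * this

lemma expo_add_emb (k z : ℂ) (i : ℤ × ℤ) : expo k (z + emb i) = (chi k i)⁻¹ * expo k z := by
  rw [expo, expo, chi, ← Complex.exp_neg, ← Complex.exp_add, pair_add_right]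
  push_cast
  ring_nf

lemma expo_ne_zero (k z : ℂ) : expo k z ≠ 0 := Complex.exp_ne_zero _

/-! ### Moving along the Brillouin zone -/

/-- Functions with multipliers `chi k` that are holomorphic up to simple poles in `stack`. -/
structure Mero (k : ℂ) (G : ℂ → ℂ) : Prop where
  add_emb : ∀ z i, G (z + emb i) = chi k i * G z
  diff : ∀ z ∉ stack, DifferentiableAt ℂ G z
  pole : ∀ p ∈ stack, ∃ A, Tendsto (fun z => (z - p) * G z) (𝓝[≠] p) (𝓝 A)

section
variable {c : (ℤ × ℤ) →₀ ℂ} {α k : ℂ} {G : ℂ → ℂ}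

lemma differentiableAt_expo_mul (hG : Mero k G) {z : ℂ} (hz : z ∉ stack) :
    DifferentiableAt ℝ (fun z => expo k z * G z) z :=
  (hasFDerivAt_expo k z).differentiableAt.mul ((hG.diff z hz).restrictScalars ℝ)

lemma Dbar_expo_mul (hG : Mero k G) {z : ℂ} (hz : z ∉ stack) :
    Dbar (fun z => expo k z * G z) z = -k * (expo k z * G z) := by
  rw [Dbar_mul (hasFDerivAt_expo k z).differentiableAt ((hG.diff z hz).restrictScalars ℝ),
    Dbar_eq_zero (hG.diff z hz), Dbar_expo]
  ring

/-- Multiplication by a meromorphic multiplier, one component at a time. -/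
lemma Mero.exists_mul (hG : Mero k G) {q : ℤ} {f : ℂ → ℂ} (hf : Differentiable ℝ f)
    (hq : Floq q f) (h0 : ∀ p ∈ stack, f p = 0) (hD : ∀ p ∈ stack, Dbar f p = 0) :
    ∃ w : ℂ → ℂ, Continuous w ∧ (∀ z ∉ stack, w z = expo k z * G z * f z) ∧ Floq q w ∧
      (∀ z ∉ stack, DifferentiableAt ℝ w z) ∧
      ∀ z ∉ stack, Dbar w z + k * w z = expo k z * G z * Dbar f z := by
  obtain ⟨w, hw, hwg⟩ := exists_continuous_extension (g := fun z => expo k z * G z * f z)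
    (fun z hz => (differentiableAt_expo_mul hG hz).continuousAt.mul (hf z).continuousAt)
    (fun p hp => by
      obtain ⟨A, hA⟩ := hG.pole p hp
      have h1 := tendsto_div_of_Dbar_eq_zero (hf p) (hD p hp) (h0 p hp)
      have h2 : Tendsto (expo k) (𝓝[≠] p) (𝓝 (expo k p)) :=
        (hasFDerivAt_expo k p).continuousAt.tendsto.mono_left nhdsWithin_le_nhds
      refine ⟨_, ((h2.mul hA).mul h1).congr' ?_⟩
      filter_upwards [self_mem_nhdsWithin] with z hz
      have : z - p ≠ 0 := sub_ne_zero.mpr hz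
      field_simp)
  have hev : ∀ z ∉ stack, w =ᶠ[𝓝 z] fun z => expo k z * G z * f z := by
    intro z hz
    filter_upwards [isOpen_compl_stack.mem_nhds hz] with y hy using hwg y hy
  refine ⟨w, hw, hwg, ?_, fun z hz => ?_, fun z hz => ?_⟩
  · rintro γ ⟨m, n, rfl⟩ z
    have hdense : Dense stackᶜ := countable_stack.dense_compl ℝ
    refine congrFun (Continuous.ext_on hdense (f := fun z => w (z + emb (m, n)))
      (g := fun z => cexp (q * I * (pair (emb (m, n)) K : ℂ)) * w z) (by fun_prop) (by fun_prop) ?_) z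
    intro y hy
    have hy' : y + emb (m, n) ∉ stack := fun h => hy ((add_emb_mem_stack _).mp h)
    show w (y + emb (m, n)) = _ * w y
    rw [hwg _ hy', hwg _ hy, expo_add_emb, hG.add_emb, hq (emb (m, n)) ⟨m, n, rfl⟩ y]
    field_simp [chi_ne_zero k (m, n)]
  · exact ((differentiableAt_expo_mul hG hz).mul (hf z)).congr_of_eventuallyEq (hev z hz)
  · have h1 : Dbar w z = Dbar (fun z => expo k z * G z * f z) z := by
      rw [Dbar, Dbar, (hev z hz).fderiv_eq]
    rw [h1, hwg z hz, Dbar_mul (differentiableAt_expo_mul hG hz) (hf z), Dbar_expo_mul hG hz]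
    ring

lemma Mero.exists_mem_kerSet (hc : ∀ d ∈ c.support, cls d = 1) (hG : Mero k G) {u : ℂ → ℂ × ℂ}
    (hu : u ∈ kerSet (pot c) (pot (refl c)) α 0) (h0 : ∀ p ∈ stack, u p = 0) :
    ∃ w ∈ kerSet (pot c) (pot (refl c)) α k, ∀ z ∉ stack, w z = (expo k z * G z) • u z := by
  have hs := weakSol_of_mem hu
  have h01 : ∀ p ∈ stack, (u p).1 = 0 := fun p hp => by rw [h0 p hp, Prod.fst_zero]
  have h02 : ∀ p ∈ stack, (u p).2 = 0 := fun p hp => by rw [h0 p hp, Prod.snd_zero]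
  obtain ⟨w₁, c₁, e₁, f₁, d₁, D₁⟩ := hG.exists_mul (fun z => hs.diff_fst z (by simp)) hs.floq_fst
    h01 fun p hp => by simpa [h01 p hp, h02 p hp] using hs.eq_fst p (by simp)
  obtain ⟨w₂, c₂, e₂, f₂, d₂, D₂⟩ := hG.exists_mul (fun z => hs.diff_snd z (by simp)) hs.floq_snd
    h02 fun p hp => by simpa [h01 p hp, h02 p hp] using hs.eq_snd p (by simp)
  refine ⟨fun z => (w₁ z, w₂ z), ?_, fun z hz => ?_⟩
  · have hw : WeakSol c α k (fun z => (w₁ z, w₂ z)) stack :=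
      { countable := countable_stack
        cont_fst := c₁
        cont_snd := c₂
        floq_fst := f₁
        floq_snd := f₂
        diff_fst := d₁
        diff_snd := d₂
        eq_fst := fun z hz => by
          have := hs.eq_fst z (by simp)
          show Dbar w₁ z + k * w₁ z + α * pot c z * w₂ z = 0
          rw [D₁ z hz, e₂ z hz]
          linear_combination expo k z * G z * this
        eq_snd := fun z hz => by
          have := hs.eq_snd z (by simp)
          show Dbar w₂ z + k * w₂ z + α * pot (refl c) z * w₁ z = 0
          rw [D₂ z hz, e₁ z hz]
          linear_combination expo k z * G z * this }
    exact hw.mem_kerSet hc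
  · simp only [e₁ z hz, e₂ z hz]
    exact Prod.ext rfl rfl

lemma two_le_kerDim_of_mero (hc : ∀ d ∈ c.support, cls d = 1) {u : ℂ → ℂ × ℂ}
    (hu : u ∈ kerSet (pot c) (pot (refl c)) α 0) (hu0 : u ≠ 0) (h0 : ∀ p ∈ stack, u p = 0)
    {G₁ G₂ : ℂ → ℂ} (h1 : Mero k G₁) (h2 : Mero k G₂)
    (h : ∀ a b : ℂ, (∀ z ∉ stack, a * G₁ z + b * G₂ z = 0) → a = 0 ∧ b = 0) :
    2 ≤ kerDim (pot c) (pot (refl c)) α k := by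
  obtain ⟨w₁, m₁, e₁⟩ := h1.exists_mem_kerSet hc hu h0
  obtain ⟨w₂, m₂, e₂⟩ := h2.exists_mem_kerSet hc hu h0
  refine two_le_kerDim hc m₁ m₂ fun a b hab => h a b ?_
  have hprod : ∀ z ∉ stack, u z ≠ 0 → a * G₁ z + b * G₂ z = 0 := by
    intro z hz huz
    have h3 := hab z
    rw [e₁ z hz, e₂ z hz, smul_smul, smul_smul, ← add_smul] at h3
    have h4 := (smul_eq_zero.mp h3).resolve_right huz
    refine mul_left_cancel₀ (expo_ne_zero k z) ?_
    linear_combination h4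
  have hcont : Continuous u := hu.1.continuous
  obtain ⟨z₀, hz₀⟩ := Function.ne_iff.mp hu0
  have hopen : IsOpen {z | u z ≠ 0} := isOpen_ne_fun hcont continuous_const
  obtain ⟨z₁, hz₁, hz₁'⟩ := (countable_stack.dense_compl ℝ).inter_open_nonempty _ hopen ⟨z₀, hz₀⟩
  have han : AnalyticOnNhd ℂ (fun z => a * G₁ z + b * G₂ z) stackᶜ := by
    refine DifferentiableOn.analyticOnNhd (fun z hz => ?_) isOpen_compl_stack
    exact (((h1.diff z hz).const_mul a).add ((h2.diff z hz).const_mul b)).differentiableWithinAt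
  have hconn : IsPreconnected stackᶜ := by
    refine (countable_stack.isPathConnected_compl_of_one_lt_rank ?_).isConnected.isPreconnected
    rw [Complex.rank_real_complex]
    exact Nat.one_lt_ofNat
  have hev : (fun z => a * G₁ z + b * G₂ z) =ᶠ[𝓝 z₁] 0 := by
    filter_upwards [hopen.mem_nhds hz₁, isOpen_compl_stack.mem_nhds hz₁'] with z hz hz'
      using hprod z hz' hz
  exact fun z hz => han.eqOn_zero_of_preconnected_of_eventuallyEq_zero hconn hz₁' hev hz

end

section
variable {P : Fin 3 → ℂ} {k p : ℂ}

lemma mero_latSum (hP : Function.Injective P) (hPs : ∀ j, P j ∈ stack) (k : ℂ) :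
    Mero k (latSum P k) where
  add_emb := latSum_add P k
  diff z hz := differentiableAt_latSum fun i j h => hz ((add_emb_mem_stack i).mp (h ▸ hPs j))
  pole p _ := by
    have hfin : {i | ∃ j, p + emb i = P j}.Finite := by
      rw [Set.ofPred_exists]
      exact Set.finite_iUnion fun j => (Set.finite_singleton (P j)).preimage
        ((add_right_injective p).comp emb_injective).injOn
    exact ⟨_, tendsto_mul_latSum hP hfin.toFinset fun i hi j h => hi (by simpa using ⟨j, h⟩)⟩

lemma residue_relation {G₁ G₂ : ℂ → ℂ} {a b A₁ A₂ : ℂ} (h : ∀ z ∉ stack, a * G₁ z + b * G₂ z = 0)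
    (h1 : Tendsto (fun z => (z - p) * G₁ z) (𝓝[≠] p) (𝓝 A₁))
    (h2 : Tendsto (fun z => (z - p) * G₂ z) (𝓝[≠] p) (𝓝 A₂)) : a * A₁ + b * A₂ = 0 := by
  refine tendsto_nhds_unique ((h1.const_mul a).add (h2.const_mul b))
    (tendsto_const_nhds.congr' ?_)
  filter_upwards [eventually_notMem_stack p] with z hz
  linear_combination -(z - p) * h z hz

/-- Three points on a line. -/
def collinear (s : ℂ) (i : ℤ × ℤ) (j : Fin 3) : ℂ := s + emb ((j : ℕ) • i)

lemma emb_nsmul (n : ℕ) (i : ℤ × ℤ) : emb (n • i) = n * emb i := by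
  show ((n • i.1 : ℤ) : ℂ) * ω + ((n • i.2 : ℤ) : ℂ) = n * (i.1 * ω + i.2)
  rw [nsmul_eq_mul, nsmul_eq_mul]
  push_cast
  ring

lemma collinear_injective (s : ℂ) {i : ℤ × ℤ} (hi : i ≠ 0) : Function.Injective (collinear s i) := by
  intro j l h
  have h1 := add_left_cancel h
  rw [emb_nsmul, emb_nsmul] at h1
  have h2 := mul_right_cancel₀ (fun h => hi (emb_eq_zero.mp h)) h1
  exact Fin.ext (by exact_mod_cast h2)

lemma kernelRes_collinear (s : ℂ) {i : ℤ × ℤ} (hi : i ≠ 0) :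
    kernelRes (collinear s i) (collinear s i 0) = (2 * emb i ^ 2)⁻¹ ∧
    kernelRes (collinear s i) (collinear s i 1) = -(emb i ^ 2)⁻¹ ∧
    kernelRes (collinear s i) (collinear s i 2) = (2 * emb i ^ 2)⁻¹ := by
  have h0 : emb i ≠ 0 := fun h => hi (emb_eq_zero.mp h)
  have e0 : Finset.univ.erase (0 : Fin 3) = {1, 2} := by decide
  have e1 : Finset.univ.erase (1 : Fin 3) = {0, 2} := by decide
  have e2 : Finset.univ.erase (2 : Fin 3) = {0, 1} := by decide
  have hne : ∀ j l, collinear s i j - collinear s i l = ((j : ℕ) - (l : ℕ) : ℂ) * emb i := by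
    intro j l
    rw [collinear, collinear, emb_nsmul, emb_nsmul]
    ring
  refine ⟨?_, ?_, ?_⟩
  · rw [kernelRes_apply (collinear_injective s hi), e0, Finset.prod_pair (by decide), hne, hne]
    simp
    field_simp
  · rw [kernelRes_apply (collinear_injective s hi), e1, Finset.prod_pair (by decide), hne, hne]
    simp
    norm_num
    field_simp
  · rw [kernelRes_apply (collinear_injective s hi), e2, Finset.prod_pair (by decide), hne, hne]
    simp
    norm_num
    field_simp

lemma tendsto_mul_latSum_collinear (s : ℂ) {i : ℤ × ℤ} (hi : i ≠ 0) :
    Tendsto (fun z => (z - s) * latSum (collinear s i) k z) (𝓝[≠] s)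
      (𝓝 ((1 - (chi k i)⁻¹) ^ 2 * (2 * emb i ^ 2)⁻¹)) := by
  classical
  have h0 : emb i ≠ 0 := fun h => hi (emb_eq_zero.mp h)
  have h1 := tendsto_mul_latSum (k := k) (p := s) (collinear_injective s hi)
    (Finset.univ.image fun j : Fin 3 => (j : ℕ) • i) (fun l hl j h => hl (by
      refine Finset.mem_image.mpr ⟨j, Finset.mem_univ _, ?_⟩
      exact (emb_injective (add_left_cancel h)).symm))
  have hinj : Function.Injective fun j : Fin 3 => (j : ℕ) • i := by
    intro j l h
    exact collinear_injective s hi (by simp only [collinear, show (j : ℕ) • i = (l : ℕ) • i from h])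
  rw [Finset.sum_image hinj.injOn, Fin.sum_univ_three] at h1
  obtain ⟨r0, r1, r2⟩ := kernelRes_collinear s hi
  rw [collinear] at r0 r1 r2
  rw [r0, r1, r2] at h1
  convert h1 using 2
  have c2 : chi k (((2 : Fin 3) : ℕ) • i) = chi k i * chi k i := by
    rw [show ((2 : Fin 3) : ℕ) • i = i + i from two_nsmul i, chi_add]
  have c1 : chi k (((1 : Fin 3) : ℕ) • i) = chi k i := by
    rw [show ((1 : Fin 3) : ℕ) • i = i from one_nsmul i]
  have c0 : chi k (((0 : Fin 3) : ℕ) • i) = 1 := by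
    rw [show ((0 : Fin 3) : ℕ) • i = 0 from zero_nsmul i, chi_zero]
  rw [c0, c1, c2]
  have := chi_ne_zero k i
  field_simp
  ring

lemma exists_mero_of_chi_ne_one {i : ℤ × ℤ} (h : chi k i ≠ 1) : ∃ G₁ G₂ : ℂ → ℂ, Mero k G₁ ∧ Mero k G₂ ∧
    ∀ a b : ℂ, (∀ z ∉ stack, a * G₁ z + b * G₂ z = 0) → a = 0 ∧ b = 0 := by
  have hi : i ≠ 0 := by
    rintro rfl
    exact h (chi_zero k)
  have hA : (1 - (chi k i)⁻¹) ^ 2 * (2 * emb i ^ 2)⁻¹ ≠ 0 := by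
    have h0 : emb i ≠ 0 := fun h => hi (emb_eq_zero.mp h)
    refine mul_ne_zero (pow_ne_zero 2 (sub_ne_zero.mpr fun h' => h ?_)) (inv_ne_zero (mul_ne_zero two_ne_zero (pow_ne_zero 2 h0)))
    exact (inv_eq_one.mp h'.symm)
  have hz1 : Tendsto (fun z => (z - -zS) * latSum (collinear zS i) k z) (𝓝[≠] (-zS)) (𝓝 0) := by
    have := tendsto_mul_latSum (k := k) (p := -zS) (collinear_injective zS hi) ∅ (fun l _ j h => by
      refine two_mul_zS_ne (l - (j : ℕ) • i) ?_
      rw [emb_sub]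
      rw [collinear] at h
      linear_combination -h)
    simpa using this
  have hz2 : Tendsto (fun z => (z - zS) * latSum (collinear (-zS) i) k z) (𝓝[≠] zS) (𝓝 0) := by
    have := tendsto_mul_latSum (k := k) (p := zS) (collinear_injective (-zS) hi) ∅ (fun l _ j h => by
      refine two_mul_zS_ne ((j : ℕ) • i - l) ?_
      rw [emb_sub]
      rw [collinear] at h
      linear_combination h)
    simpa using this
  refine ⟨_, _, mero_latSum (collinear_injective zS hi) (fun j => (add_emb_mem_stack _).mpr zS_mem_stack) k,
    mero_latSum (collinear_injective (-zS) hi) (fun j => (add_emb_mem_stack _).mpr neg_zS_mem_stack) k,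
    fun a b hab => ⟨?_, ?_⟩⟩
  · have := residue_relation hab (tendsto_mul_latSum_collinear zS hi) hz2
    rw [mul_zero, add_zero] at this
    exact (mul_eq_zero.mp this).resolve_right hA
  · have := residue_relation hab hz1 (tendsto_mul_latSum_collinear (-zS) hi)
    rw [mul_zero, zero_add] at this
    exact (mul_eq_zero.mp this).resolve_right hA

lemma exists_mero_of_chi_eq_one (h : ∀ i, chi k i = 1) : ∃ G₁ G₂ : ℂ → ℂ, Mero k G₁ ∧ Mero k G₂ ∧
    ∀ a b : ℂ, (∀ z ∉ stack, a * G₁ z + b * G₂ z = 0) → a = 0 ∧ b = 0 := by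
  have hone : emb (0, 1) = 1 := by simp [emb]
  have n0 : 2 * zS ≠ 0 := by
    rw [← emb_zero]
    exact two_mul_zS_ne 0
  have n1 : 2 * zS + 1 ≠ 0 := by
    intro h
    refine two_mul_zS_ne (-(0, 1)) ?_
    rw [emb_neg, hone]
    linear_combination h
  set P : Fin 3 → ℂ := ![zS, -zS, zS + 1] with hPdef
  have p0 : P 0 = zS := rfl
  have p1 : P 1 = -zS := rfl
  have p2 : P 2 = zS + 1 := rfl
  have hP : Function.Injective P := by
    have a01 : P 0 ≠ P 1 := fun h => n0 (by rw [p0, p1] at h; linear_combination h)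
    have a02 : P 0 ≠ P 2 := fun h => one_ne_zero (α := ℂ) (by rw [p0, p2] at h; linear_combination -h)
    have a12 : P 1 ≠ P 2 := fun h => n1 (by rw [p1, p2] at h; linear_combination -h)
    intro j l hjl
    fin_cases j <;> fin_cases l <;>
      first
      | rfl
      | exact (a01 hjl).elim
      | exact (a02 hjl).elim
      | exact (a12 hjl).elim
      | exact (a01 hjl.symm).elim
      | exact (a02 hjl.symm).elim
      | exact (a12 hjl.symm).elim
  have hPs : ∀ j, P j ∈ stack := by
    intro j
    fin_cases j
    · exact zS_mem_stack
    · exact neg_zS_mem_stack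
    · show zS + 1 ∈ stack
      rw [← hone]
      exact (add_emb_mem_stack _).mpr zS_mem_stack
  have hone' : Tendsto (fun z : ℂ => (z - -zS) * (1 : ℂ)) (𝓝[≠] (-zS)) (𝓝 0) := by
    have : ContinuousAt (fun z : ℂ => (z - -zS) * (1 : ℂ)) (-zS) := by fun_prop
    simpa [ContinuousAt] using this.tendsto.mono_left nhdsWithin_le_nhds
  have hres := tendsto_mul_latSum (k := k) (p := -zS) hP {0} (fun i hi j hj => by
    fin_cases j
    · exact two_mul_zS_ne i (by
        have : -zS + emb i = zS := hj
        linear_combination -this)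
    · refine hi (Finset.mem_singleton.mpr (emb_eq_zero.mp ?_))
      have : -zS + emb i = -zS := hj
      linear_combination this
    · refine two_mul_zS_ne (i - (0, 1)) ?_
      have : -zS + emb i = zS + 1 := hj
      rw [emb_sub, hone]
      linear_combination -this)
  rw [Finset.sum_singleton, emb_zero, add_zero, ← p1, kernelRes_apply hP, h 0, inv_one, one_mul, p1] at hres
  refine ⟨fun _ => 1, latSum P k, ⟨fun z i => by rw [h i, one_mul], fun z _ => differentiableAt_const _,
    fun p _ => ⟨0, ?_⟩⟩, mero_latSum hP hPs k, fun a b hab => ?_⟩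
  · have : ContinuousAt (fun z : ℂ => (z - p) * (1 : ℂ)) p := by fun_prop
    simpa [ContinuousAt] using this.tendsto.mono_left nhdsWithin_le_nhds
  · have hb : b = 0 := by
      have h1 := residue_relation hab hone' hres
      rw [mul_zero, zero_add] at h1
      refine (mul_eq_zero.mp h1).resolve_right (Finset.prod_ne_zero_iff.mpr fun l hl => ?_)
      exact inv_ne_zero (sub_ne_zero.mpr fun h => Finset.ne_of_mem_erase hl (hP (p1.trans h)).symm)
    obtain ⟨z, hz⟩ := (countable_stack.dense_compl ℝ).nonempty
    have h2 := hab z hz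
    rw [hb] at h2
    exact ⟨by linear_combination h2, hb⟩

end

section
variable {c : (ℤ × ℤ) →₀ ℂ} {α : ℂ}

lemma two_le_kerDim_of_invariant (hc : ∀ d ∈ c.support, cls d = 1) {u : ℂ → ℂ × ℂ}
    (hu : u ∈ kerSet (pot c) (pot (refl c)) α 0) (hu0 : u ≠ 0) (hrot : ∀ z, u (ω * z) = u z) (k : ℂ) :
    2 ≤ kerDim (pot c) (pot (refl c)) α k := by
  have hs := weakSol_of_mem hu
  have h1 := hs.floq_fst.eq_zero_of_rot (by decide) fun z => by rw [hrot]
  have h2 := hs.floq_snd.eq_zero_of_rot (by decide) fun z => by rw [hrot]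
  have h0 : ∀ p ∈ stack, u p = 0 := fun p hp => Prod.ext (h1 p hp) (h2 p hp)
  have hG : ∃ G₁ G₂ : ℂ → ℂ, Mero k G₁ ∧ Mero k G₂ ∧
      ∀ a b : ℂ, (∀ z ∉ stack, a * G₁ z + b * G₂ z = 0) → a = 0 ∧ b = 0 := by
    by_cases h : ∀ i, chi k i = 1
    · exact exists_mero_of_chi_eq_one h
    · push Not at h
      exact exists_mero_of_chi_ne_one h.choose_spec
  obtain ⟨G₁, G₂, m₁, m₂, h⟩ := hG
  exact two_le_kerDim_of_mero hc hu hu0 h0 m₁ m₂ h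

end

end

/-! ### Assembly -/

lemma K_ne_zero : K ≠ 0 := by
  simp [K, Real.pi_ne_zero]

lemma K_inv_mul_mem {b : ℂ} (hb : InPiQomega b) : K⁻¹ * b ∈ 𝔸 := by
  obtain ⟨q, hq, rfl⟩ := hb
  have hle : Subfield.closure {ω / (√3 : ℂ)} ≤ 𝔸.toSubfield := by
    rw [Subfield.closure_le, Set.singleton_subset_iff]
    exact div_mem ω_mem_𝔸 sqrt_three_mem_𝔸
  have hq' : q ∈ 𝔸 := hle hq
  have h : K⁻¹ * (Real.pi * q) = 3 / 4 * q := by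
    have : (Real.pi : ℂ) ≠ 0 := by exact_mod_cast Real.pi_ne_zero
    rw [K]
    field_simp
  rw [h]
  exact mul_mem (div_mem (ofNat_mem 𝔸 3) (ofNat_mem 𝔸 4)) hq'

lemma exists_eq_pot {S : Finset ℂ} (hS : ↑S ⊆ Λdual) {a : ℂ → ℂ} (ha : ∀ p ∈ S, InPiQomega (a p))
    {U : ℂ → ℂ} (hU : ∀ z, U z = ∑ p ∈ S, a p * cexp (I * (pair (p + K) z : ℂ))) :
    ∃ c : (ℤ × ℤ) →₀ ℂ, U = pot c ∧ (∀ d ∈ c.support, cls d = 1) ∧ ∀ d, K⁻¹ * c d ∈ 𝔸 := by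
  classical
  have hd : ∀ p ∈ S, ∃ d : ℤ × ℤ, cls d = 1 ∧ p + K = K * emb d :=
    fun p hp => exists_emb_of_mem_Λdual (hS hp)
  choose! d hd1 hd2 using hd
  have happ : ∀ e, (∑ p ∈ S, Finsupp.single (d p) (a p)) e = ∑ p ∈ S, if d p = e then a p else 0 := by
    intro e
    rw [Finsupp.finsetSum_apply]
    exact Finset.sum_congr rfl fun p _ => Finsupp.single_apply
  refine ⟨∑ p ∈ S, Finsupp.single (d p) (a p), ?_, fun e he => ?_, fun e => ?_⟩
  · funext z
    rw [hU, pot, ← Finsupp.sum_finsetSum_index (by simp) (by intros; ring)]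
    refine Finset.sum_congr rfl fun p hp => ?_
    rw [Finsupp.sum_single_index (by simp), mode, hd2 p hp]
  · by_contra h
    refine Finsupp.mem_support_iff.mp he ?_
    rw [happ]
    exact Finset.sum_eq_zero fun p hp => if_neg fun hpe : d p = e => h (hpe ▸ hd1 p hp)
  · rw [happ, Finset.mul_sum]
    refine sum_mem fun p hp => ?_
    split_ifs
    · exact K_inv_mul_mem (ha p hp)
    · rw [mul_zero]
      exact zero_mem _

section
variable {c : (ℤ × ℤ) →₀ ℂ} {α : ℂ} {v : ℤ × ℤ → ℂ}

lemma isCoef_iff_eq_smul_op : IsCoef c α 0 v ↔ v = (-α) • op (K⁻¹ • (c + refl c)) nzcls 0 v := by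
  have hkey : ∀ i, cls i ≠ 0 → ((K * emb i + 0) * v i + α * hop (c + refl c) v i = 0 ↔
      v i = ((-α) • op (K⁻¹ • (c + refl c)) nzcls 0 v) i) := by
    intro i hi
    have h0 : emb i ≠ 0 := by
      intro h
      rw [emb_eq_zero.mp h] at hi
      exact hi cls_zero
    have hK := K_ne_zero
    rw [Pi.smul_apply, op_apply_of_mem (show i ∈ nzcls from hi), hop_smul_left, smul_eq_mul,
      add_zero, add_zero]
    constructor
    · intro h
      field_simp
      linear_combination h
    · intro h
      rw [h]
      field_simp
      ring
  constructor
  · rintro ⟨h1, h2⟩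
    funext i
    by_cases hi : cls i = 0
    · rw [h1 i hi, Pi.smul_apply, op_apply_of_notMem (show i ∉ nzcls from fun h => h hi), smul_zero]
    · exact (hkey i hi).mp (h2 i hi)
  · intro h
    refine ⟨fun i hi => ?_, fun i hi => (hkey i hi).mpr (congrFun h i)⟩
    rw [h, Pi.smul_apply, op_apply_of_notMem (show i ∉ nzcls from fun h => h hi), smul_zero]

lemma synth_rot (hv : ∀ i, v (rot i) = v i) (z : ℂ) : synth v (ω * z) = synth v z := by
  have h : ∀ q i, part q v (rot i) = part q v i := by
    intro q i
    by_cases hi : cls i = q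
    · rw [part_of_eq hi, part_of_eq (by rw [cls_rot, hi]), hv]
    · rw [part_of_ne hi, part_of_ne (by rwa [cls_rot])]
  rw [synth, synth, ser_rot (h 2), ser_rot (h 1)]

lemma exists_bounded_isCoef (hc : ∀ d ∈ c.support, cls d = 1) {k : ℂ} {u : ℂ → ℂ × ℂ}
    (hu : u ∈ kerSet (pot c) (pot (refl c)) α k) (hu0 : u ≠ 0) :
    ∃ v, IsCoef c α k v ∧ v ≠ 0 ∧ ∃ V : ℝ, ∀ i, ‖v i‖ ≤ V := by
  have hs := weakSol_of_mem hu
  obtain ⟨V, hV⟩ := exists_norm_coefs_le hs.cont_fst hs.cont_snd hs.floq_fst hs.floq_snd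
  have hcoef := hs.isCoef hc
  refine ⟨coefs u, hcoef, fun h0 => hu0 ?_, V, hV⟩
  rw [← synth_coefs hs.cont_fst hs.cont_snd hs.floq_fst hs.floq_snd (hcoef.rapid hV), h0]
  funext z
  simp [synth, ser, part]

lemma exists_invariant_mem_kerSet (hc : ∀ d ∈ c.support, cls d = 1)
    (hrot : ∀ d, c (rot d) = ω * c d) (halg : ∀ d, K⁻¹ * c d ∈ 𝔸) {u : ℂ → ℂ × ℂ}
    (hu : u ∈ kerSet (pot c) (pot (refl c)) α 0) (hu0 : u ≠ 0) :
    ∃ ν : ℂ, ∃ w ∈ kerSet (pot c) (pot (refl c)) ν 0, w ≠ 0 ∧ ∀ z, w (ω * z) = w z := by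
  obtain ⟨v, hv, hv0, V, hV⟩ := exists_bounded_isCoef hc hu hu0
  have hrefl : ∀ d, refl c d = c (-d) := fun d => by
    conv_lhs => rw [← neg_neg d]
    exact Finsupp.mapDomain_apply neg_injective c (-d)
  obtain ⟨ν, w, hw0, ⟨W, hW⟩, hwrot, hw⟩ := exists_invariant_eigenvector
    (β := K⁻¹ • (c + refl c)) (fun d => by
      simp only [Finsupp.smul_apply, Finsupp.add_apply, hrefl, smul_eq_mul, ← rot_neg, hrot]
      ring)
    (fun d => by
      simp only [Finsupp.smul_apply, Finsupp.add_apply, hrefl, smul_eq_mul, mul_add]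
      exact add_mem (halg d) (halg (-d)))
    hV hv0 (isCoef_iff_eq_smul_op.mp hv)
  have hcoef : IsCoef c (-ν) 0 w := isCoef_iff_eq_smul_op.mpr (by rwa [neg_neg])
  refine ⟨-ν, synth w, hcoef.synth_mem hc hW, fun h => hw0 ?_, synth_rot hwrot⟩
  rw [← coefs_synth hcoef.1 (hcoef.rapid hW), h]
  funext i
  simp [coefs, fc_zero]

end

/-- **Statement 3: existence of degenerate magic angles for potentials with
coefficients in `π·ℚ(ω/√3)`.** -/
theorem exists_degenerate_magic (S : Finset ℂ) (hS : ↑S ⊆ Λdual) (a : ℂ → ℂ)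
    (ha : ∀ p ∈ S, InPiQomega (a p)) (U : ℂ → ℂ)
    (hUdef : ∀ z : ℂ, U z = ∑ p ∈ S, a p * Complex.exp (Complex.I * (pair (p + K) z : ℂ)))
    (hrot : ∀ z : ℂ, U (ω * z) = ω * U z)
    (hmagic : ∃ α : ℂ, IsMagic U (fun z => U (-z)) α) :
    ∃ α : ℂ, IsMagic U (fun z => U (-z)) α ∧
      ∀ k : ℂ, 2 ≤ kerDim U (fun z => U (-z)) α k := by
  obtain ⟨c, rfl, hc, halg⟩ := exists_eq_pot hS ha hUdef
  have hneg : (fun z => pot c (-z)) = pot (refl c) := funext (pot_neg c)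
  simp only [hneg] at hmagic ⊢
  obtain ⟨α, hα⟩ := hmagic
  obtain ⟨u, hu, hu0⟩ := hα 0
  obtain ⟨ν, w, hw, hw0, hwrot⟩ :=
    exists_invariant_mem_kerSet hc (apply_rot_of_pot_omega hrot) halg hu hu0
  have hdim := two_le_kerDim_of_invariant hc hw hw0 hwrot
  refine ⟨ν, fun k => ?_, hdim⟩
  by_contra! hzero
  have h1 : Submodule.span ℂ (kerSet (pot c) (pot (refl c)) ν k) = ⊥ :=
    Submodule.span_eq_bot.mpr hzero
  have h2 := hdim k
  rw [kerDim, h1, finrank_bot] at h2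
  omega

end TBG
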